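/- Let P be a simple polygon, and let Q be the subpolygon of P obtained by cutting P along all nonredundant cuts of P (removing, for each nonredundant cut C, the pocket Pocket(C)). If Q is nonempty, then Q is a simple polygon, and if Π is a connected curve contained in P that intersects every nonredundant cut of P, then every vertex of Q is visible from some point of Π. -/

import Mathlib

open Set

noncomputable section

/-- The Euclidean plane. -/
abbrev E2 := EuclideanSpace ℝ (Fin 2)

/-- A simple polygon in the plane, given by its cyclic sequence of vertices.
Adjacent edges meet exactly at their common vertex, and non-adjacent edges
are disjoint, so the boundary is a simple closed polygonal curve. -/
structure SimplePolygon where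
  n : ℕ
  three_le : 3 ≤ n
  vtx : ZMod n → E2
  inj : Function.Injective vtx
  adj_edges : ∀ i : ZMod n,
    segment ℝ (vtx i) (vtx (i + 1)) ∩ segment ℝ (vtx (i + 1)) (vtx (i + 2)) = {vtx (i + 1)}
  nonadj_edges : ∀ i j : ZMod n, i ≠ j → i + 1 ≠ j → j + 1 ≠ i →
    segment ℝ (vtx i) (vtx (i + 1)) ∩ segment ℝ (vtx j) (vtx (j + 1)) = ∅

namespace SimplePolygon

variable (P : SimplePolygon)

/-- The boundary `∂P`: the union of the edges. -/
def boundary : Set E2 := ⋃ i : ZMod P.n, segment ℝ (P.vtx i) (P.vtx (i + 1))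

/-- The compact region bounded by `∂P`: the boundary together with all points of the
bounded connected components of its complement. -/
def region : Set E2 :=
  P.boundary ∪ {x | x ∉ P.boundary ∧ Bornology.IsBounded (connectedComponentIn P.boundaryᶜ x)}

/-- `x` sees `y` (in `P`) if the closed segment `[x,y]` is contained in `P`. -/
def Visible (x y : E2) : Prop := segment ℝ x y ⊆ P.region

/-- The vertex `vtx i` is reflex: its internal angle is strictly larger than `π`, i.e.
near the vertex the midpoint of two points at equal small parameter along the two
incident edges lies outside the region. -/
def IsReflex (i : ZMod P.n) : Prop :=
  ∃ ε₀ > (0 : ℝ), ∀ ε ∈ Set.Ioo (0 : ℝ) ε₀,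
    midpoint ℝ (P.vtx i + ε • (P.vtx (i - 1) - P.vtx i))
               (P.vtx i + ε • (P.vtx (i + 1) - P.vtx i)) ∉ P.region

/-- `P` is star-shaped if a single point of `P` sees all of `P`. -/
def IsStarShaped : Prop := ∃ x ∈ P.region, ∀ y ∈ P.region, P.Visible x y

/-- A visibility path: a connected curve inside `P` from which every point of `P`
is visible. -/
def IsVisibilityPath (Pth : Set E2) : Prop :=
  IsConnected Pth ∧ Pth ⊆ P.region ∧ ∀ x ∈ P.region, ∃ p ∈ Pth, P.Visible x p

/-- The pocket, inside `P`, determined by a cut segment `s` on the side of the point `u`: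
the closure of the connected component of `P \ s` containing `u`, together with `s`. -/
def pocketOfSeg (s : Set E2) (u : E2) : Set E2 :=
  closure (connectedComponentIn (P.region \ s) u) ∪ s

end SimplePolygon

/-- A cut of a simple polygon `P`: for a reflex vertex `v = vtx i` with adjacent
vertex `u = vtx j`, the segment from `v` to the closest point `w` of `∂P` hit by
the ray from `v` in the direction from `u` to `v`. -/
structure SimplePolygon.Cut (P : SimplePolygon) where
  i : ZMod P.n
  j : ZMod P.n
  adj : j = i + 1 ∨ j = i - 1
  reflex : P.IsReflex i
  t : ℝ
  t_pos : 0 < t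
  hits : P.vtx i + t • (P.vtx i - P.vtx j) ∈ P.boundary
  first_hit : ∀ s ∈ Set.Ioo (0 : ℝ) t, P.vtx i + s • (P.vtx i - P.vtx j) ∉ P.boundary
  inside : segment ℝ (P.vtx i) (P.vtx i + t • (P.vtx i - P.vtx j)) ⊆ P.region

namespace SimplePolygon.Cut

variable {P : SimplePolygon} (C : P.Cut)

/-- The reflex vertex generating the cut. -/
def v : E2 := P.vtx C.i

/-- The adjacent vertex `u`; the edge `u v` is the generator of the cut. -/
def u : E2 := P.vtx C.j

/-- The other endpoint of the cut, on `∂P`. -/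
def w : E2 := P.vtx C.i + C.t • (P.vtx C.i - P.vtx C.j)

/-- The cut as a segment. -/
def seg : Set E2 := segment ℝ C.v C.w

/-- `Pocket(C)`: the part of `P` cut off by `C` that contains the generator vertex `u`. -/
def pocket : Set E2 := P.pocketOfSeg C.seg C.u

/-- A cut is redundant if the pocket of some cut is strictly contained in its pocket. -/
def Redundant : Prop := ∃ C' : P.Cut, C'.pocket ⊂ C.pocket

/-- A nonredundant (essential) cut. -/
def Nonredundant : Prop := ¬ C.Redundant

/-- `x` is a vertex of the polygon `Pocket(C)`: either the endpoint `w` of the cut, or a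
vertex of `P` belonging to the pocket. -/
def PocketVertex (x : E2) : Prop :=
  x = C.w ∨ ∃ k : ZMod P.n, P.vtx k = x ∧ x ∈ C.pocket

end SimplePolygon.Cut

/-- Length of a polygonal path given by its list of vertices. -/
def polyLength (l : List E2) : ℝ := ((l.zip l.tail).map fun p => dist p.1 p.2).sum

namespace SimplePolygon

variable (P : SimplePolygon)

/-- A polygonal path inside `P`: a nonempty list of points with each consecutive
segment contained in `P`. -/
def IsPolyPathIn (l : List E2) : Prop :=
  l ≠ [] ∧ List.Chain' (fun a b => segment ℝ a b ⊆ P.region) l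

/-- `l` is a shortest Euclidean (polygonal) path inside `P` from `x` to the set `S`. -/
def IsGeodesicTo (x : E2) (S : Set E2) (l : List E2) : Prop :=
  P.IsPolyPathIn l ∧ l.head? = some x ∧ (∃ y ∈ S, l.getLast? = some y) ∧
  ∀ m : List E2, P.IsPolyPathIn m → m.head? = some x →
    (∃ y ∈ S, m.getLast? = some y) → polyLength l ≤ polyLength m

/-- The subpolygon `Q` of `P` obtained by cutting `P` along all nonredundant cuts:
the closure of `P` minus the union of the pockets of all nonredundant cuts. -/
def core : Set E2 :=
  closure (P.region \ ⋃ C : {C : P.Cut // C.Nonredundant}, (C : P.Cut).pocket)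

end SimplePolygon

/-- The planar cross product. -/
def cross2 (a b : E2) : ℝ := a 0 * b 1 - a 1 * b 0

/-- A polygonal chain all of whose turns have the sign `s` (a convex chain bending
consistently to one side). -/
def ConvexChain (s : ℝ) (l : List E2) : Prop :=
  ∀ p q r : E2, [p, q, r] <:+: l → 0 ≤ s * cross2 (q - p) (r - q)

open Metric Topology Filter

section Cross

theorem cross2_add_right (a b c : E2) : cross2 a (b + c) = cross2 a b + cross2 a c := by
  simp [cross2]; ring

theorem cross2_smul_right (a b : E2) (s : ℝ) : cross2 a (s • b) = s * cross2 a b := by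
  simp [cross2]; ring

theorem cross2_neg_right (a b : E2) : cross2 a (-b) = -cross2 a b := by
  simp [cross2]; ring

theorem cross2_add_left (a b c : E2) : cross2 (a + b) c = cross2 a c + cross2 b c := by
  simp [cross2]; ring

theorem cross2_sub_left (a b c : E2) : cross2 (a - b) c = cross2 a c - cross2 b c := by
  simp [cross2]; ring

theorem cross2_smul_left (a b : E2) (s : ℝ) : cross2 (s • a) b = s * cross2 a b := by
  simp [cross2]; ring

theorem cross2_neg_left (a b : E2) : cross2 (-a) b = -cross2 a b := by
  simp [cross2]; ring

@[simp] theorem cross2_self (a : E2) : cross2 a a = 0 := by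
  simp [cross2]; ring

@[simp] theorem cross2_zero_right (a : E2) : cross2 a 0 = 0 := by
  simp [cross2]

theorem cross2_swap (a b : E2) : cross2 a b = -cross2 b a := by
  simp [cross2]; ring

theorem continuous_cross2_right (a : E2) : Continuous fun y => cross2 a y := by
  unfold cross2; fun_prop

theorem eq_smul_add_smul_of_cross2_ne_zero {a b : E2} (h : cross2 a b ≠ 0) (y : E2) :
    y = (cross2 y b / cross2 a b) • a + (cross2 a y / cross2 a b) • b := by
  ext i
  fin_cases i <;> simp <;> field_simp <;> simp [cross2] <;> ring

theorem exists_smul_of_cross2_eq_zero {a y : E2} (ha : a ≠ 0) (h : cross2 a y = 0) :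
    ∃ s : ℝ, y = s • a := by
  have h01 : a 0 ≠ 0 ∨ a 1 ≠ 0 := by
    by_contra! hc
    apply ha
    ext i
    fin_cases i <;> simp [hc.1, hc.2]
  simp only [cross2] at h
  rcases h01 with h0 | h1
  · refine ⟨y 0 / a 0, ?_⟩
    ext i
    fin_cases i <;> simp <;> field_simp
    linarith
  · refine ⟨y 1 / a 1, ?_⟩
    ext i
    fin_cases i <;> simp <;> field_simp
    linarith

theorem exists_cross2_pos {a : E2} (ha : a ≠ 0) : ∃ e : E2, 0 < cross2 a e := by
  by_contra! hc
  apply ha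
  have h := hc !₂[-a 1, a 0]
  simp [cross2] at h
  have h0 : a 0 = 0 := by nlinarith [sq_nonneg (a 0), sq_nonneg (a 1)]
  have h1 : a 1 = 0 := by nlinarith [sq_nonneg (a 0), sq_nonneg (a 1)]
  ext i
  fin_cases i <;> simp [h0, h1]

/-- Translates of open half-discs are convex. -/
theorem convex_ball_inter_cross2_pos (z : E2) (ε : ℝ) (a : E2) :
    Convex ℝ {p | ‖p - z‖ < ε ∧ 0 < cross2 a (p - z)} := by
  intro p hp q hq s t hs ht hst
  have hz : s • p + t • q - z = s • (p - z) + t • (q - z) := by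
    have : z = (s + t) • z := by simp [hst]
    nth_rw 1 [this]
    module
  refine ⟨?_, ?_⟩
  · have := (convex_ball (0 : E2) ε) (x := p - z) (by simpa using hp.1) (y := q - z)
      (by simpa using hq.1) hs ht hst
    rw [hz]
    simpa using this
  · show 0 < cross2 a (s • p + t • q - z)
    rw [hz, cross2_add_right, cross2_smul_right, cross2_smul_right]
    rcases hs.eq_or_lt with rfl | hs'
    · have : t = 1 := by linarith
      subst this
      simpa using hq.2
    · have := mul_pos hs' hp.2
      have := mul_nonneg ht hq.2.le
      linarith

theorem mem_segment_add_iff {z p y : E2} (hy : ‖y‖ < ‖p - z‖) :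
    z + y ∈ segment ℝ z p ↔ ∃ s : ℝ, 0 ≤ s ∧ y = s • (p - z) := by
  rw [segment_eq_image']
  constructor
  · rintro ⟨s, hs, h⟩
    exact ⟨s, hs.1, by simpa using h.symm⟩
  · rintro ⟨s, hs, rfl⟩
    refine ⟨s, ⟨hs, ?_⟩, rfl⟩
    have hpos : 0 < ‖p - z‖ := lt_of_le_of_lt (norm_nonneg _) hy
    rw [norm_smul, Real.norm_of_nonneg hs] at hy
    nlinarith

theorem segment_eq_union_of_mem {a b z : E2} (hz : z ∈ segment ℝ a b) :
    segment ℝ a b = segment ℝ z a ∪ segment ℝ z b := by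
  apply subset_antisymm
  · rw [segment_eq_image'] at hz
    obtain ⟨t, ⟨ht0, ht1⟩, rfl⟩ := hz
    intro y hy
    rw [segment_eq_image'] at hy
    obtain ⟨s, ⟨hs0, hs1⟩, rfl⟩ := hy
    rcases le_total s t with h | h
    · left
      rcases ht0.eq_or_lt with h0 | h0
      · have : s = t := by linarith
        subst this
        exact left_mem_segment ..
      · rw [segment_symm, segment_eq_image']
        refine ⟨s / t, ⟨by positivity, by rw [div_le_one h0]; exact h⟩, ?_⟩
        have : s = s / t * t := by field_simp
        simp only [add_sub_cancel_left, smul_smul, ← this]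
    · right
      rcases ht1.eq_or_lt with h1 | h1
      · have : s = t := by linarith
        subst this
        exact left_mem_segment ..
      · rw [segment_eq_image']
        refine ⟨(s - t) / (1 - t), ⟨div_nonneg (by linarith) (by linarith),
          by rw [div_le_one (by linarith)]; linarith⟩, ?_⟩
        have h2 : (s - t) / (1 - t) * (1 - t) = s - t := by
          field_simp [(by linarith : (1 - t) ≠ 0)]
        have h3 : b - (a + t • (b - a)) = (1 - t) • (b - a) := by module
        simp only [h3, smul_smul, h2]
        module
  · apply union_subset
    · exact (convex_segment a b).segment_subset hz (left_mem_segment ..)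
    · exact (convex_segment a b).segment_subset hz (right_mem_segment ..)

end Cross

/-- Near `z` the complement of `B` consists of two connected pieces, and every point of `B`
near `z` is adherent to both. -/
def TwoSided (B : Set E2) (z : E2) : Prop :=
  ∃ ε > 0, ∃ S₁ S₂ : Set E2, IsPreconnected S₁ ∧ IsPreconnected S₂ ∧
    ball z ε \ B = S₁ ∪ S₂ ∧ ball z ε ∩ B ⊆ closure S₁ ∧ ball z ε ∩ B ⊆ closure S₂

theorem mem_closure_of_forall_pos_add_smul_mem {S : Set E2} {y e : E2}
    (h : ∀ᶠ δ in 𝓝[>] (0 : ℝ), y + δ • e ∈ S) : y ∈ closure S := by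
  have hc : Tendsto (fun δ : ℝ => y + δ • e) (𝓝[>] 0) (𝓝 y) := by
    have : Tendsto (fun δ : ℝ => y + δ • e) (𝓝 0) (𝓝 (y + (0 : ℝ) • e)) := by
      apply Continuous.tendsto; fun_prop
    simp at this
    exact this.mono_left nhdsWithin_le_nhds
  exact mem_closure_of_tendsto hc h

theorem eventually_norm_add_smul_sub_lt {y z : E2} {ε : ℝ} (h : ‖y - z‖ < ε) (e : E2) :
    ∀ᶠ δ in 𝓝[>] (0 : ℝ), ‖y + δ • e - z‖ < ε := by
  have : Tendsto (fun δ : ℝ => ‖y + δ • e - z‖) (𝓝 0) (𝓝 (‖y + (0 : ℝ) • e - z‖)) := by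
    apply Continuous.tendsto; fun_prop
  simp only [zero_smul, add_zero] at this
  exact (this.mono_left nhdsWithin_le_nhds).eventually (gt_mem_nhds h)

theorem eventually_pos_nhdsGT : ∀ᶠ δ in 𝓝[>] (0 : ℝ), 0 < δ := self_mem_nhdsWithin

theorem twoSided_of_line {B : Set E2} {z a : E2} (ha : a ≠ 0) {ε : ℝ} (hε : 0 < ε)
    (h : ∀ p, ‖p - z‖ < ε → (p ∈ B ↔ cross2 a (p - z) = 0)) : TwoSided B z := by
  obtain ⟨e, he⟩ := exists_cross2_pos ha
  refine ⟨ε, hε, {p | ‖p - z‖ < ε ∧ 0 < cross2 a (p - z)},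
    {p | ‖p - z‖ < ε ∧ 0 < cross2 (-a) (p - z)},
    (convex_ball_inter_cross2_pos ..).isPreconnected,
    (convex_ball_inter_cross2_pos ..).isPreconnected, ?_, ?_, ?_⟩
  · ext p
    simp only [Set.mem_sdiff, mem_ball_iff_norm, mem_union, mem_ofPred_eq, cross2_neg_left]
    constructor
    · rintro ⟨h1, h2⟩
      rw [h p h1] at h2
      rcases lt_or_gt_of_ne h2 with h3 | h3
      · right; exact ⟨h1, by linarith⟩
      · left; exact ⟨h1, h3⟩
    · rintro (⟨h1, h2⟩ | ⟨h1, h2⟩) <;> refine ⟨h1, ?_⟩ <;> rw [h p h1] <;> intro h3 <;> linarith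
  · rintro p ⟨hp1, hp2⟩
    rw [mem_ball_iff_norm] at hp1
    rw [h p hp1] at hp2
    apply mem_closure_of_forall_pos_add_smul_mem (e := e)
    filter_upwards [eventually_norm_add_smul_sub_lt hp1 e, eventually_pos_nhdsGT] with δ h1 h2
    refine ⟨h1, ?_⟩
    rw [add_sub_right_comm, cross2_add_right, hp2, cross2_smul_right]
    positivity
  · rintro p ⟨hp1, hp2⟩
    rw [mem_ball_iff_norm] at hp1
    rw [h p hp1] at hp2
    apply mem_closure_of_forall_pos_add_smul_mem (e := -e)
    filter_upwards [eventually_norm_add_smul_sub_lt hp1 (-e), eventually_pos_nhdsGT] with δ h1 h2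
    refine ⟨h1, ?_⟩
    rw [add_sub_right_comm, cross2_neg_left, cross2_add_right, hp2, cross2_smul_right,
      cross2_neg_right]
    have := mul_pos h2 he
    linarith

/-- Membership in one of the two rays spanned by `a` and `b`, in the coordinates of the basis. -/
theorem mem_rays_iff {a b : E2} (h : cross2 a b ≠ 0) (y : E2) :
    ((∃ s : ℝ, 0 ≤ s ∧ y = s • a) ∨ (∃ s : ℝ, 0 ≤ s ∧ y = s • b)) ↔
      (0 ≤ cross2 a b * cross2 y b ∧ cross2 a y = 0) ∨
      (0 ≤ cross2 a b * cross2 a y ∧ cross2 y b = 0) := by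
  have hk : 0 < cross2 a b * cross2 a b := mul_self_pos.2 h
  constructor
  · rintro (⟨s, hs, rfl⟩ | ⟨s, hs, rfl⟩)
    · left
      simp only [cross2_smul_left, cross2_smul_right, cross2_self, mul_zero, and_true]
      nlinarith
    · right
      simp only [cross2_smul_left, cross2_smul_right, cross2_self, mul_zero, and_true]
      nlinarith
  · have hy := eq_smul_add_smul_of_cross2_ne_zero h y
    have key : ∀ c : ℝ, 0 ≤ cross2 a b * c → 0 ≤ c / cross2 a b := by
      intro c hc
      have : c / cross2 a b = cross2 a b * c / (cross2 a b * cross2 a b) := by field_simp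
      rw [this]; positivity
    rintro (⟨h1, h2⟩ | ⟨h1, h2⟩)
    · left
      exact ⟨_, key _ h1, by simpa [h2] using hy⟩
    · right
      exact ⟨_, key _ h1, by simpa [h2] using hy⟩

theorem twoSided_of_rays {B : Set E2} {z a b : E2} (hab : cross2 a b ≠ 0) {ε : ℝ} (hε : 0 < ε)
    (h : ∀ p, ‖p - z‖ < ε →
      (p ∈ B ↔ (∃ s : ℝ, 0 ≤ s ∧ p - z = s • a) ∨ (∃ s : ℝ, 0 ≤ s ∧ p - z = s • b))) :
    TwoSided B z := by
  set k := cross2 a b with hk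
  have hkk : 0 < k * k := mul_self_pos.2 hab
  have h' : ∀ p, ‖p - z‖ < ε → (p ∈ B ↔ (0 ≤ k * cross2 (p - z) b ∧ cross2 a (p - z) = 0) ∨
      (0 ≤ k * cross2 a (p - z) ∧ cross2 (p - z) b = 0)) := by
    intro p hp
    rw [h p hp, mem_rays_iff hab]
  have e1 : ∀ y : E2, cross2 (-(k • b)) y = k * cross2 y b := by
    intro y; rw [cross2_neg_left, cross2_smul_left, cross2_swap b y]; ring
  have e2 : ∀ y : E2, cross2 (k • a) y = k * cross2 a y := by
    intro y; rw [cross2_smul_left]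
  have e3 : ∀ y : E2, cross2 (k • b) y = -(k * cross2 y b) := by
    intro y; rw [cross2_smul_left, cross2_swap b y]; ring
  have e4 : ∀ y : E2, cross2 (-(k • a)) y = -(k * cross2 a y) := by
    intro y; rw [cross2_neg_left, cross2_smul_left]
  refine ⟨ε, hε, {p | ‖p - z‖ < ε ∧ 0 < cross2 (-(k • b)) (p - z)} ∩
      {p | ‖p - z‖ < ε ∧ 0 < cross2 (k • a) (p - z)},
    {p | ‖p - z‖ < ε ∧ 0 < cross2 (k • b) (p - z)} ∪
      {p | ‖p - z‖ < ε ∧ 0 < cross2 (-(k • a)) (p - z)},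
    ((convex_ball_inter_cross2_pos ..).inter (convex_ball_inter_cross2_pos ..)).isPreconnected,
    ?_, ?_, ?_, ?_⟩
  · have hmem : ∃ p, p ∈ {p | ‖p - z‖ < ε ∧ 0 < cross2 (k • b) (p - z)} ∩
      {p | ‖p - z‖ < ε ∧ 0 < cross2 (-(k • a)) (p - z)} := by
      have h0 : ‖z - z‖ < ε := by simpa using hε
      have := (eventually_norm_add_smul_sub_lt h0 (-(a + b))).and eventually_pos_nhdsGT
      obtain ⟨δ, h1, h2⟩ := this.exists
      have hp := mul_pos h2 hkk
      refine ⟨z + δ • (-(a + b)), ⟨h1, ?_⟩, ⟨h1, ?_⟩⟩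
      · rw [e3, add_sub_cancel_left]
        simp only [cross2_smul_left, cross2_neg_left, cross2_add_left, cross2_self, ← hk]
        linarith
      · rw [e4, add_sub_cancel_left]
        simp only [cross2_smul_right, cross2_neg_right, cross2_add_right, cross2_self, ← hk]
        linarith
    obtain ⟨p, hp1, hp2⟩ := hmem
    exact IsPreconnected.union p hp1 hp2 (convex_ball_inter_cross2_pos ..).isPreconnected
      (convex_ball_inter_cross2_pos ..).isPreconnected
  · ext p
    simp only [Set.mem_sdiff, mem_ball_iff_norm, mem_union, mem_inter_iff, mem_ofPred_eq,
      e1, e2, e3, e4]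
    have hk0 : ∀ c, k * c = 0 → c = 0 := fun c hc => (mul_eq_zero.1 hc).resolve_left hab
    constructor
    · rintro ⟨h1, h2⟩
      rw [h' p h1] at h2
      push Not at h2
      by_cases c1 : k * cross2 (p - z) b < 0
      · right; left; exact ⟨h1, by linarith⟩
      by_cases c2 : k * cross2 a (p - z) < 0
      · right; right; exact ⟨h1, by linarith⟩
      push Not at c1 c2
      left
      have d1 := h2.1 c1
      have d2 := h2.2 c2
      exact ⟨⟨h1, lt_of_le_of_ne c1 fun h => d2 (hk0 _ h.symm)⟩,
        ⟨h1, lt_of_le_of_ne c2 fun h => d1 (hk0 _ h.symm)⟩⟩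
    · intro h2
      have h1 : ‖p - z‖ < ε := by
        rcases h2 with h2 | h2 | h2
        exacts [h2.1.1, h2.1, h2.1]
      refine ⟨h1, ?_⟩
      rw [h' p h1]
      rintro (⟨h3, h4⟩ | ⟨h3, h4⟩)
      · rw [h4] at h2
        rcases h2 with ⟨-, -, h2⟩ | ⟨-, h2⟩ | ⟨-, h2⟩ <;> linarith
      · rw [h4] at h2
        rcases h2 with ⟨⟨-, h2⟩, -⟩ | ⟨-, h2⟩ | ⟨-, h2⟩ <;> linarith
  · rintro p ⟨hp1, hp2⟩
    rw [mem_ball_iff_norm] at hp1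
    rw [h' p hp1] at hp2
    apply mem_closure_of_forall_pos_add_smul_mem (e := a + b)
    filter_upwards [eventually_norm_add_smul_sub_lt hp1 (a + b), eventually_pos_nhdsGT] with δ h1 h2
    have hp := mul_pos h2 hkk
    have f1 : k * cross2 (p + δ • (a + b) - z) b = k * cross2 (p - z) b + δ * (k * k) := by
      rw [add_sub_right_comm]
      simp only [cross2_add_left, cross2_smul_left, cross2_self, ← hk]; ring
    have f2 : k * cross2 a (p + δ • (a + b) - z) = k * cross2 a (p - z) + δ * (k * k) := by
      rw [add_sub_right_comm]
      simp only [cross2_add_right, cross2_smul_right, cross2_self, ← hk]; ring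
    refine ⟨⟨h1, ?_⟩, ⟨h1, ?_⟩⟩
    · rw [e1, f1]
      rcases hp2 with ⟨h3, h4⟩ | ⟨h3, h4⟩
      · linarith
      · rw [h4]; linarith
    · rw [e2, f2]
      rcases hp2 with ⟨h3, h4⟩ | ⟨h3, h4⟩
      · rw [h4]; linarith
      · linarith
  · rintro p ⟨hp1, hp2⟩
    rw [mem_ball_iff_norm] at hp1
    rw [h' p hp1] at hp2
    apply mem_closure_of_forall_pos_add_smul_mem (e := -(a + b))
    filter_upwards [eventually_norm_add_smul_sub_lt hp1 (-(a + b)), eventually_pos_nhdsGT]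
      with δ h1 h2
    have hp := mul_pos h2 hkk
    have f1 : k * cross2 (p + δ • -(a + b) - z) b = k * cross2 (p - z) b - δ * (k * k) := by
      rw [add_sub_right_comm]
      simp only [cross2_add_left, cross2_smul_left, cross2_neg_left, cross2_self, ← hk]; ring
    have f2 : k * cross2 a (p + δ • -(a + b) - z) = k * cross2 a (p - z) - δ * (k * k) := by
      rw [add_sub_right_comm]
      simp only [cross2_add_right, cross2_smul_right, cross2_neg_right, cross2_self, ← hk]; ring
    rcases hp2 with ⟨h3, h4⟩ | ⟨h3, h4⟩
    · right
      refine ⟨h1, ?_⟩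
      rw [e4, f2, h4]; linarith
    · left
      refine ⟨h1, ?_⟩
      rw [e3, f1, h4]; linarith

namespace SimplePolygon

variable (P : SimplePolygon)

instance : NeZero P.n := ⟨by have := P.three_le; omega⟩

theorem one_ne_zero_zmod : (1 : ZMod P.n) ≠ 0 := by
  have h := P.three_le
  intro h1
  have := (ZMod.natCast_eq_zero_iff 1 P.n).1 (by exact_mod_cast h1)
  have := Nat.le_of_dvd (by norm_num) this
  omega

theorem two_ne_zero_zmod : (2 : ZMod P.n) ≠ 0 := by
  have h := P.three_le
  intro h1
  have := (ZMod.natCast_eq_zero_iff 2 P.n).1 (by exact_mod_cast h1)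
  have := Nat.le_of_dvd (by norm_num) this
  omega

/-- The closed edge from `vtx i` to `vtx (i + 1)`. -/
def edge (i : ZMod P.n) : Set E2 := segment ℝ (P.vtx i) (P.vtx (i + 1))

theorem boundary_eq : P.boundary = ⋃ i, P.edge i := rfl

theorem mem_boundary {z : E2} : z ∈ P.boundary ↔ ∃ i, z ∈ P.edge i := by
  simp [boundary_eq]

theorem isCompact_edge (i : ZMod P.n) : IsCompact (P.edge i) := by
  rw [edge, segment_eq_image']
  exact isCompact_Icc.image (by fun_prop)

theorem isCompact_boundary : IsCompact P.boundary :=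
  isCompact_iUnion fun i => P.isCompact_edge i

theorem isClosed_boundary : IsClosed P.boundary := P.isCompact_boundary.isClosed

theorem vtx_mem_edge (i : ZMod P.n) : P.vtx i ∈ P.edge i := left_mem_segment ..

theorem vtx_mem_boundary (i : ZMod P.n) : P.vtx i ∈ P.boundary :=
  P.mem_boundary.2 ⟨i, P.vtx_mem_edge i⟩

theorem vtx_succ_ne (i : ZMod P.n) : P.vtx (i + 1) ≠ P.vtx i := by
  intro h
  have := P.inj h
  exact P.one_ne_zero_zmod (by simpa using this)

theorem eq_of_mem_edge_of_mem_edge {i j : ZMod P.n} {z : E2} (hij : i ≠ j) (hi : z ∈ P.edge i)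
    (hj : z ∈ P.edge j) : (j = i + 1 ∧ z = P.vtx j) ∨ (i = j + 1 ∧ z = P.vtx i) := by
  by_cases h1 : i + 1 = j
  · left
    refine ⟨h1.symm, ?_⟩
    subst h1
    have := P.adj_edges i
    have hz : z ∈ ({P.vtx (i + 1)} : Set E2) := by
      rw [← this]
      refine ⟨hi, ?_⟩
      have h2 : i + 1 + 1 = i + 2 := by ring
      rw [← h2]; exact hj
    exact hz
  by_cases h2 : j + 1 = i
  · right
    refine ⟨h2.symm, ?_⟩
    subst h2
    have := P.adj_edges j
    have hz : z ∈ ({P.vtx (j + 1)} : Set E2) := by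
      rw [← this]
      refine ⟨hj, ?_⟩
      have h2 : j + 1 + 1 = j + 2 := by ring
      rw [← h2]; exact hi
    exact hz
  · have := P.nonadj_edges i j hij h1 h2
    exact absurd (show z ∈ (∅ : Set E2) from this ▸ ⟨hi, hj⟩) (notMem_empty z)

theorem isPreconnected_boundary : IsPreconnected P.boundary := by
  have h : P.boundary = ⋃ k : ℕ, P.edge (k : ZMod P.n) := by
    ext z
    simp only [mem_boundary, mem_iUnion]
    constructor
    · rintro ⟨i, hi⟩
      exact ⟨i.val, by simpa using hi⟩
    · rintro ⟨k, hk⟩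
      exact ⟨_, hk⟩
  rw [h]
  refine IsPreconnected.iUnion_of_chain (fun k => (convex_segment _ _).isPreconnected) fun k => ?_
  refine ⟨P.vtx (k + 1), right_mem_segment .., ?_⟩
  simpa [edge] using left_mem_segment ℝ (P.vtx (k + 1)) (P.vtx (k + 1 + 1))

/-- Away from the edges through `z`, a small ball around `z` misses the boundary. -/
theorem exists_ball_edges (z : E2) :
    ∃ ε > 0, ∀ p, ‖p - z‖ < ε → ∀ i, p ∈ P.edge i → z ∈ P.edge i := by
  have hc : IsClosed (⋃ i : {i : ZMod P.n // z ∉ P.edge i}, P.edge i) :=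
    isClosed_iUnion_of_finite fun i => (P.isCompact_edge i).isClosed
  have hz : z ∉ ⋃ i : {i : ZMod P.n // z ∉ P.edge i}, P.edge i := by
    simp only [mem_iUnion, not_exists]
    exact fun i => i.2
  obtain ⟨ε, hε, h⟩ := Metric.isOpen_iff.1 hc.isOpen_compl z hz
  refine ⟨ε, hε, fun p hp i hi => ?_⟩
  by_contra hzi
  exact h (mem_ball_iff_norm.2 hp) (mem_iUnion.2 ⟨⟨i, hzi⟩, hi⟩)

theorem local_vertex (i : ZMod P.n) : ∃ ε > 0, ∀ p, ‖p - P.vtx i‖ < ε →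
    (p ∈ P.boundary ↔ (∃ s : ℝ, 0 ≤ s ∧ p - P.vtx i = s • (P.vtx (i - 1) - P.vtx i)) ∨
      (∃ s : ℝ, 0 ≤ s ∧ p - P.vtx i = s • (P.vtx (i + 1) - P.vtx i))) := by
  obtain ⟨ε, hε, h⟩ := P.exists_ball_edges (P.vtx i)
  have h1 : 0 < ‖P.vtx (i + 1) - P.vtx i‖ := norm_pos_iff.2 (sub_ne_zero.2 (P.vtx_succ_ne i))
  have h2 : 0 < ‖P.vtx (i - 1) - P.vtx i‖ := by
    have := P.vtx_succ_ne (i - 1)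
    rw [sub_add_cancel] at this
    exact norm_pos_iff.2 (sub_ne_zero.2 this.symm)
  refine ⟨min ε (min ‖P.vtx (i + 1) - P.vtx i‖ ‖P.vtx (i - 1) - P.vtx i‖), by positivity, ?_⟩
  intro p hp
  simp only [lt_min_iff] at hp
  obtain ⟨hp0, hp1, hp2⟩ := hp
  have e1 := mem_segment_add_iff hp1
  have e2 := mem_segment_add_iff hp2
  rw [add_sub_cancel] at e1 e2
  rw [← e1, ← e2, mem_boundary]
  constructor
  · rintro ⟨j, hj⟩
    have hij := h p hp0 j hj
    by_cases hji : j = i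
    · subst hji; right; exact hj
    · rcases P.eq_of_mem_edge_of_mem_edge hji hij (P.vtx_mem_edge i) with ⟨h3, h4⟩ | ⟨h3, h4⟩
      · left
        have : j = i - 1 := by rw [h3]; ring
        subst this
        rw [segment_symm]
        simpa [edge] using hj
      · exact absurd (P.inj h4).symm hji
  · rintro (h3 | h3)
    · refine ⟨i - 1, ?_⟩
      rw [segment_symm] at h3
      simpa [edge] using h3
    · exact ⟨i, h3⟩

theorem local_edge {i : ZMod P.n} {z : E2} (hz : z ∈ P.edge i) (h0 : z ≠ P.vtx i)
    (h1 : z ≠ P.vtx (i + 1)) : ∃ ε > 0, ∀ p, ‖p - z‖ < ε →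
    (p ∈ P.boundary ↔ cross2 (P.vtx (i + 1) - P.vtx i) (p - z) = 0) := by
  obtain ⟨ε, hε, h⟩ := P.exists_ball_edges z
  have g1 : 0 < ‖P.vtx (i + 1) - z‖ := norm_pos_iff.2 (sub_ne_zero.2 h1.symm)
  have g2 : 0 < ‖P.vtx i - z‖ := norm_pos_iff.2 (sub_ne_zero.2 h0.symm)
  refine ⟨min ε (min ‖P.vtx (i + 1) - z‖ ‖P.vtx i - z‖), by positivity, ?_⟩
  intro p hp
  simp only [lt_min_iff] at hp
  obtain ⟨hp0, hp1, hp2⟩ := hp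
  have e1 := mem_segment_add_iff hp1
  have e2 := mem_segment_add_iff hp2
  rw [add_sub_cancel] at e1 e2
  have hb : p ∈ P.boundary ↔ p ∈ P.edge i := by
    rw [mem_boundary]
    refine ⟨?_, fun h => ⟨i, h⟩⟩
    rintro ⟨j, hj⟩
    by_cases hji : j = i
    · exact hji ▸ hj
    · rcases P.eq_of_mem_edge_of_mem_edge hji (h p hp0 j hj) hz with ⟨h3, h4⟩ | ⟨h3, h4⟩
      · exact absurd h4 h0
      · exact absurd (h3 ▸ h4) h1
  have hd : P.vtx (i + 1) - P.vtx i ≠ 0 := sub_ne_zero.2 (P.vtx_succ_ne i)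
  rw [hb, edge, segment_eq_union_of_mem hz, mem_union, e1, e2]
  rw [edge, segment_eq_image'] at hz
  obtain ⟨t, ⟨ht0, ht1⟩, rfl⟩ := hz
  have ht0 : 0 < t := lt_of_le_of_ne ht0 (by rintro rfl; simp at h0)
  have ht1 : t < 1 := lt_of_le_of_ne ht1 (by rintro rfl; simp at h1)
  have d1 : P.vtx i - (P.vtx i + t • (P.vtx (i + 1) - P.vtx i)) =
    (-t) • (P.vtx (i + 1) - P.vtx i) := by module
  have d2 : P.vtx (i + 1) - (P.vtx i + t • (P.vtx (i + 1) - P.vtx i)) =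
    (1 - t) • (P.vtx (i + 1) - P.vtx i) := by module
  simp only [d1, d2, smul_smul]
  constructor
  · rintro (⟨s, hs, h⟩ | ⟨s, hs, h⟩) <;> rw [h, cross2_smul_right, cross2_self, mul_zero]
  · intro hc
    obtain ⟨s, hs⟩ := exists_smul_of_cross2_eq_zero hd hc
    rcases le_total s 0 with h | h
    · left
      refine ⟨-s / t, div_nonneg (by linarith) ht0.le, ?_⟩
      rw [hs]
      congr 1
      field_simp
    · right
      have : 0 < 1 - t := by linarith
      refine ⟨s / (1 - t), by positivity, ?_⟩
      rw [hs]
      congr 1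
      field_simp

theorem pred_sub_ne_smul_succ_sub (i : ZMod P.n) {c : ℝ} (hc : 0 < c) :
    P.vtx (i - 1) - P.vtx i ≠ c • (P.vtx (i + 1) - P.vtx i) := by
  intro h
  have hne : i - 1 ≠ i := by
    intro h; exact P.one_ne_zero_zmod (by simpa using h)
  have hv : P.vtx (i - 1) ≠ P.vtx i := fun h => hne (P.inj h)
  have hedge : P.edge (i - 1) = segment ℝ (P.vtx i) (P.vtx (i - 1)) := by
    rw [edge, segment_symm, sub_add_cancel]
  have key : ∀ z, z ∈ P.edge (i - 1) → z ∈ P.edge i → z = P.vtx i := by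
    intro z h1 h2
    rcases P.eq_of_mem_edge_of_mem_edge hne h1 h2 with ⟨-, h3⟩ | ⟨h3, -⟩
    · exact h3
    · exfalso
      apply P.two_ne_zero_zmod
      have : (2 : ZMod P.n) = i + 1 - (i - 1) := by ring
      rw [this, ← h3]; ring
  rcases le_total c 1 with h1 | h1
  · refine hv (key _ (P.vtx_mem_edge _) ?_)
    rw [edge, segment_eq_image']
    exact ⟨c, ⟨hc.le, h1⟩, by simp [← h]⟩
  · refine P.vtx_succ_ne i (key _ ?_ (right_mem_segment ..))
    rw [hedge, segment_eq_image']
    refine ⟨c⁻¹, ⟨by positivity, inv_le_one_of_one_le₀ h1⟩, ?_⟩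
    simp only [h, smul_smul]
    rw [inv_mul_cancel₀ hc.ne']
    simp

/-- At a flat vertex the boundary is locally a line. -/
theorem local_flat_vertex {i : ZMod P.n}
    (hc : cross2 (P.vtx (i - 1) - P.vtx i) (P.vtx (i + 1) - P.vtx i) = 0) :
    ∃ ε > 0, ∀ p, ‖p - P.vtx i‖ < ε →
    (p ∈ P.boundary ↔ cross2 (P.vtx (i + 1) - P.vtx i) (p - P.vtx i) = 0) := by
  obtain ⟨ε, hε, h⟩ := P.local_vertex i
  refine ⟨ε, hε, fun p hp => ?_⟩
  have hd : P.vtx (i + 1) - P.vtx i ≠ 0 := sub_ne_zero.2 (P.vtx_succ_ne i)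
  rw [cross2_swap, neg_eq_zero] at hc
  obtain ⟨c, hc⟩ := exists_smul_of_cross2_eq_zero hd hc
  have hc0 : c < 0 := by
    by_contra! h0
    rcases h0.eq_or_lt with h0 | h0
    · rw [← h0, zero_smul, sub_eq_zero] at hc
      have := P.vtx_succ_ne (i - 1)
      rw [sub_add_cancel] at this
      exact this hc.symm
    · exact P.pred_sub_ne_smul_succ_sub i h0 hc
  rw [h p hp, hc]
  simp only [smul_smul]
  constructor
  · rintro (⟨s, hs, h⟩ | ⟨s, hs, h⟩) <;> rw [h, cross2_smul_right, cross2_self, mul_zero]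
  · intro hc
    obtain ⟨s, hs⟩ := exists_smul_of_cross2_eq_zero hd hc
    rcases le_total s 0 with h | h
    · left
      exact ⟨s / c, div_nonneg_of_nonpos h hc0.le, by rw [hs, div_mul_cancel₀ _ hc0.ne]⟩
    · right
      exact ⟨s, h, hs⟩

theorem twoSided_boundary {z : E2} (hz : z ∈ P.boundary) : TwoSided P.boundary z := by
  by_cases hv : ∃ i, P.vtx i = z
  · obtain ⟨i, rfl⟩ := hv
    by_cases hc : cross2 (P.vtx (i - 1) - P.vtx i) (P.vtx (i + 1) - P.vtx i) = 0
    · obtain ⟨ε, hε, h⟩ := P.local_flat_vertex hc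
      exact twoSided_of_line (sub_ne_zero.2 (P.vtx_succ_ne i)) hε h
    · obtain ⟨ε, hε, h⟩ := P.local_vertex i
      exact twoSided_of_rays hc hε h
  · push Not at hv
    obtain ⟨i, hi⟩ := P.mem_boundary.1 hz
    obtain ⟨ε, hε, h⟩ := P.local_edge hi (hv i).symm (hv (i + 1)).symm
    exact twoSided_of_line (sub_ne_zero.2 (P.vtx_succ_ne i)) hε h

end SimplePolygon

section Clopen

variable {B : Set E2}

theorem subset_of_isPreconnected_of_clopen {U S : Set E2} (hU : IsOpen U) (hU' : IsOpen (Bᶜ \ U))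
    (hS : IsPreconnected S) (hSB : S ⊆ Bᶜ) (h : (S ∩ U).Nonempty) : S ⊆ U :=
  hS.subset_left_of_subset_union hU hU' disjoint_sdiff_right
    (fun z hz => by by_cases hz' : z ∈ U; exacts [.inl hz', .inr ⟨hSB hz, hz'⟩]) h

/-- A nonempty relatively clopen subset of the complement of a connected two-sided set `B`
accumulates at every point of `B`. -/
theorem subset_closure_of_clopen (hB : IsPreconnected B) (hBne : B.Nonempty)
    (h2 : ∀ z ∈ B, TwoSided B z) {U : Set E2} (hU : IsOpen U) (hU' : IsOpen (Bᶜ \ U))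
    (hUB : U ⊆ Bᶜ) (hne : U.Nonempty) : B ⊆ closure U := by
  have hmeet : (B ∩ closure U).Nonempty := by
    by_contra hempty
    have hcl : IsClosed U := by
      rw [← closure_subset_iff_isClosed]
      intro z hz
      by_contra hzU
      by_cases hzB : z ∈ B
      · exact hempty ⟨z, hzB, hz⟩
      · obtain ⟨w, hw, hwU⟩ := mem_closure_iff.1 hz _ hU' ⟨hzB, hzU⟩
        exact hw.2 hwU
    rcases isClopen_iff.1 (⟨hcl, hU⟩ : IsClopen U) with h | h
    · exact hne.ne_empty h
    · obtain ⟨b, hb⟩ := hBne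
      exact hUB (h ▸ mem_univ b) hb
  have hloc : ∀ z ∈ B, z ∈ closure U → ∃ V, IsOpen V ∧ z ∈ V ∧ V ∩ B ⊆ closure U := by
    intro z hz hzU
    obtain ⟨ε, hε, S₁, S₂, hS₁, hS₂, hS, hc₁, hc₂⟩ := h2 z hz
    refine ⟨ball z ε, isOpen_ball, mem_ball_self hε, ?_⟩
    obtain ⟨w, hw, hwU⟩ := mem_closure_iff.1 hzU _ isOpen_ball (mem_ball_self hε)
    have hw' : w ∈ S₁ ∪ S₂ := hS ▸ ⟨hw, hUB hwU⟩
    have hsub : S₁ ∪ S₂ ⊆ Bᶜ := hS ▸ fun y hy => hy.2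
    rcases hw' with hw' | hw'
    · exact hc₁.trans (closure_mono (subset_of_isPreconnected_of_clopen hU hU' hS₁
        (subset_union_left.trans hsub) ⟨w, hw', hwU⟩))
    · exact hc₂.trans (closure_mono (subset_of_isPreconnected_of_clopen hU hU' hS₂
        (subset_union_right.trans hsub) ⟨w, hw', hwU⟩))
  by_contra hnot
  obtain ⟨q, hqB, hq⟩ := not_subset.1 hnot
  set V := ⋃₀ {V | IsOpen V ∧ V ∩ B ⊆ closure U} with hV
  obtain ⟨y, hyB, hyV, hyc⟩ := hB V (closure U)ᶜ (isOpen_sUnion fun W hW => hW.1)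
    isClosed_closure.isOpen_compl (fun z hz => by
      by_cases h : z ∈ closure U
      · obtain ⟨W, hW, hzW, hWB⟩ := hloc z hz h
        exact .inl ⟨W, ⟨hW, hWB⟩, hzW⟩
      · exact .inr h)
    (by
      obtain ⟨z, hz, hzU⟩ := hmeet
      obtain ⟨W, hW, hzW, hWB⟩ := hloc z hz hzU
      exact ⟨z, hz, W, ⟨hW, hWB⟩, hzW⟩) ⟨q, hqB, hq⟩
  obtain ⟨W, hW, hyW⟩ := hyV
  exact hyc (hW.2 ⟨hyW, hyB⟩)

/-- The complement of a connected two-sided set is not the disjoint union of three nonempty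
open sets. -/
theorem not_three_clopen (hB : IsPreconnected B) (hBne : B.Nonempty)
    (h2 : ∀ z ∈ B, TwoSided B z) {U₁ U₂ U₃ : Set E2} (h₁ : IsOpen U₁) (h₂ : IsOpen U₂)
    (h₃ : IsOpen U₃) (hU : U₁ ∪ U₂ ∪ U₃ = Bᶜ) (h12 : Disjoint U₁ U₂) (h13 : Disjoint U₁ U₃)
    (h23 : Disjoint U₂ U₃) (n₁ : U₁.Nonempty) (n₂ : U₂.Nonempty) (n₃ : U₃.Nonempty) : False := by
  have d1 : Bᶜ \ U₁ = U₂ ∪ U₃ := by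
    rw [← hU, union_assoc, union_sdiff_cancel_left]
    exact (disjoint_union_right.2 ⟨h12, h13⟩).le_bot
  have d2 : Bᶜ \ U₂ = U₁ ∪ U₃ := by
    rw [← hU, union_comm U₁ U₂, union_assoc, union_sdiff_cancel_left]
    exact (disjoint_union_right.2 ⟨h12.symm, h23⟩).le_bot
  have d3 : Bᶜ \ U₃ = U₁ ∪ U₂ := by
    rw [← hU, union_sdiff_cancel_right]
    exact (disjoint_union_left.2 ⟨h13, h23⟩).le_bot
  have o1 : IsOpen (Bᶜ \ U₁) := d1 ▸ h₂.union h₃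
  have o2 : IsOpen (Bᶜ \ U₂) := d2 ▸ h₁.union h₃
  have o3 : IsOpen (Bᶜ \ U₃) := d3 ▸ h₁.union h₂
  have s1 : U₁ ⊆ Bᶜ := hU ▸ fun z hz => .inl (.inl hz)
  have s2 : U₂ ⊆ Bᶜ := hU ▸ fun z hz => .inl (.inr hz)
  have s3 : U₃ ⊆ Bᶜ := hU ▸ fun z hz => .inr hz
  obtain ⟨z, hz⟩ := hBne
  have c1 := subset_closure_of_clopen hB ⟨z, hz⟩ h2 h₁ o1 s1 n₁ hz
  have c2 := subset_closure_of_clopen hB ⟨z, hz⟩ h2 h₂ o2 s2 n₂ hz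
  have c3 := subset_closure_of_clopen hB ⟨z, hz⟩ h2 h₃ o3 s3 n₃ hz
  obtain ⟨ε, hε, S₁, S₂, hS₁, hS₂, hS, hc₁, hc₂⟩ := h2 z hz
  have m1 : S₁.Nonempty := closure_nonempty_iff.1 ⟨z, hc₁ ⟨mem_ball_self hε, hz⟩⟩
  have m2 : S₂.Nonempty := closure_nonempty_iff.1 ⟨z, hc₂ ⟨mem_ball_self hε, hz⟩⟩
  have hsub : S₁ ∪ S₂ ⊆ Bᶜ := hS ▸ fun y hy => hy.2
  have key : ∀ U : Set E2, IsOpen U → IsOpen (Bᶜ \ U) → U ⊆ Bᶜ → z ∈ closure U →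
      S₁ ⊆ U ∨ S₂ ⊆ U := by
    intro U hU hU' hUB hzU
    obtain ⟨w, hw, hwU⟩ := mem_closure_iff.1 hzU _ isOpen_ball (mem_ball_self hε)
    have hw' : w ∈ S₁ ∪ S₂ := hS ▸ ⟨hw, hUB hwU⟩
    rcases hw' with hw' | hw'
    · exact .inl (subset_of_isPreconnected_of_clopen hU hU' hS₁
        (subset_union_left.trans hsub) ⟨w, hw', hwU⟩)
    · exact .inr (subset_of_isPreconnected_of_clopen hU hU' hS₂
        (subset_union_right.trans hsub) ⟨w, hw', hwU⟩)
  have no : ∀ {S U V : Set E2}, S.Nonempty → Disjoint U V → S ⊆ U → S ⊆ V → False :=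
    fun ⟨x, hx⟩ hd a b => Set.disjoint_left.1 hd (a hx) (b hx)
  rcases key U₁ h₁ o1 s1 c1 with k1 | k1 <;> rcases key U₂ h₂ o2 s2 c2 with k2 | k2 <;>
    rcases key U₃ h₃ o3 s3 c3 with k3 | k3
  · exact no m1 h12 k1 k2
  · exact no m1 h12 k1 k2
  · exact no m1 h13 k1 k3
  · exact no m2 h23 k2 k3
  · exact no m1 h23 k2 k3
  · exact no m2 h13 k1 k3
  · exact no m2 h12 k1 k2
  · exact no m2 h12 k1 k2

end Clopen

/-- The identification of the plane with `ℂ`. -/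
def toC (z : E2) : ℂ := (z 0 : ℂ) + (z 1 : ℂ) * Complex.I

@[simp] theorem toC_re (z : E2) : (toC z).re = z 0 := by simp [toC]

@[simp] theorem toC_im (z : E2) : (toC z).im = z 1 := by simp [toC]

theorem toC_ne_zero {a : E2} (h : a ≠ 0) : toC a ≠ 0 := by
  intro hc
  apply h
  have h0 : a 0 = 0 := by rw [← toC_re, hc]; simp
  have h1 : a 1 = 0 := by rw [← toC_im, hc]; simp
  ext i
  fin_cases i <;> simp [h0, h1]

theorem continuous_toC : Continuous toC := by
  unfold toC; fun_prop

/-- The oriented angle under which the segment from `a` to `b` is seen from `z`. -/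
def turn (a b z : E2) : ℝ := (toC (b - z) / toC (a - z)).arg

theorem toC_div_mem_slitPlane {a b z : E2} (hz : z ∉ segment ℝ a b) :
    toC (b - z) / toC (a - z) ∈ Complex.slitPlane := by
  by_contra hc
  rw [Complex.mem_slitPlane_iff] at hc
  push Not at hc
  obtain ⟨h1, h2⟩ := hc
  have ha : toC (a - z) ≠ 0 := by
    apply toC_ne_zero
    rw [sub_ne_zero]
    rintro rfl
    exact hz (left_mem_segment ..)
  set q := toC (b - z) / toC (a - z) with hq
  have hb : toC (b - z) = q * toC (a - z) := by rw [hq]; field_simp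
  have hb0 := congrArg Complex.re hb
  have hb1 := congrArg Complex.im hb
  simp [h2] at hb0 hb1
  apply hz
  have hp : 0 < 1 - q.re := by linarith
  refine ⟨-q.re / (1 - q.re), 1 / (1 - q.re), ?_, by positivity, by field_simp; ring, ?_⟩
  · apply div_nonneg <;> linarith
  · ext i
    fin_cases i <;> simp <;> field_simp <;> linarith

theorem continuousAt_turn {a b z : E2} (hz : z ∉ segment ℝ a b) :
    ContinuousAt (turn a b) z := by
  unfold turn
  refine ContinuousAt.comp (f := fun z => toC (b - z) / toC (a - z)) (g := Complex.arg)
    (Complex.continuousAt_arg (toC_div_mem_slitPlane hz)) ?_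
  have ha : toC (a - z) ≠ 0 := by
    apply toC_ne_zero
    rw [sub_ne_zero]
    rintro rfl
    exact hz (left_mem_segment ..)
  refine ContinuousAt.div ?_ ?_ ha
  · exact (continuous_toC.comp (continuous_const.sub continuous_id)).continuousAt
  · exact (continuous_toC.comp (continuous_const.sub continuous_id)).continuousAt

/-- Rotation by a right angle. -/
def rot (a : E2) : E2 := !₂[-a 1, a 0]

theorem turn_midpoint_quotient {a b : E2} (hab : a ≠ b) (τ : ℝ) :
    toC (b - (midpoint ℝ a b + τ • rot (b - a))) / toC (a - (midpoint ℝ a b + τ • rot (b - a))) =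
      ⟨(4 * τ ^ 2 - 1) / (1 + 4 * τ ^ 2), 4 * τ / (1 + 4 * τ ^ 2)⟩ := by
  have hp : (1 + 4 * τ ^ 2) ≠ 0 := by positivity
  have hd : toC (a - (midpoint ℝ a b + τ • rot (b - a))) ≠ 0 := by
    intro h
    have h0 := congrArg Complex.re h
    have h1 := congrArg Complex.im h
    simp [midpoint_eq_smul_add, rot] at h0 h1
    apply hab
    have e0 : (a 0 - b 0) * (1 + 4 * τ ^ 2) = 0 := by linear_combination 2 * h0 + 4 * τ * h1
    have e1 : (a 1 - b 1) * (1 + 4 * τ ^ 2) = 0 := by linear_combination 2 * h1 - 4 * τ * h0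
    ext i
    fin_cases i
    · simpa [hp, sub_eq_zero] using e0
    · simpa [hp, sub_eq_zero] using e1
  rw [div_eq_iff hd]
  apply Complex.ext
  · simp [midpoint_eq_smul_add, rot]
    field_simp
    ring
  · simp [midpoint_eq_smul_add, rot]
    field_simp
    ring

theorem turn_midpoint_pos {a b : E2} (hab : a ≠ b) {τ : ℝ} (h0 : 0 < τ) (h1 : τ < 1 / 2) :
    Real.pi / 2 < turn a b (midpoint ℝ a b + τ • rot (b - a)) ∧
    turn a b (midpoint ℝ a b - τ • rot (b - a)) < - (Real.pi / 2) := by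
  constructor
  · unfold turn
    rw [turn_midpoint_quotient hab]
    set q : ℂ := ⟨(4 * τ ^ 2 - 1) / (1 + 4 * τ ^ 2), 4 * τ / (1 + 4 * τ ^ 2)⟩
    have hre : ¬ 0 ≤ q.re := by
      have : 4 * τ ^ 2 - 1 < 0 := by nlinarith
      exact not_le.2 (div_neg_of_neg_of_pos this (by positivity))
    have him : 0 ≤ q.im := by
      show 0 ≤ 4 * τ / (1 + 4 * τ ^ 2); positivity
    rw [← Complex.abs_arg_le_pi_div_two_iff, not_le,
      abs_of_nonneg (Complex.arg_nonneg_iff.2 him)] at hre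
    exact hre
  · unfold turn
    rw [sub_eq_add_neg _ (τ • rot (b - a)), ← neg_smul, turn_midpoint_quotient hab]
    set q : ℂ := ⟨(4 * (-τ) ^ 2 - 1) / (1 + 4 * (-τ) ^ 2), 4 * (-τ) / (1 + 4 * (-τ) ^ 2)⟩
    have hre : ¬ 0 ≤ q.re := by
      have : 4 * (-τ) ^ 2 - 1 < 0 := by nlinarith
      exact not_le.2 (div_neg_of_neg_of_pos this (by positivity))
    have him : q.im < 0 := by
      show 4 * (-τ) / (1 + 4 * (-τ) ^ 2) < 0
      exact div_neg_of_neg_of_pos (by linarith) (by positivity)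
    rw [← Complex.abs_arg_le_pi_div_two_iff, not_le,
      abs_of_neg (Complex.arg_neg_iff.2 him)] at hre
    linarith

namespace SimplePolygon

variable (P : SimplePolygon)

/-- The total oriented angle (`2π` times the winding number) of the boundary around `z`. -/
def winding (z : E2) : ℝ := ∑ i, turn (P.vtx i) (P.vtx (i + 1)) z

theorem exists_winding_eq {z : E2} (hz : z ∉ P.boundary) :
    ∃ k : ℤ, P.winding z = k * (2 * Real.pi) := by
  have ha : ∀ i, toC (P.vtx i - z) ≠ 0 := by
    intro i
    apply toC_ne_zero
    rw [sub_ne_zero]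
    rintro rfl
    exact hz (P.vtx_mem_boundary i)
  have hprod : ∏ i, toC (P.vtx (i + 1) - z) / toC (P.vtx i - z) = 1 := by
    have hshift := Equiv.prod_comp (Equiv.addRight (1 : ZMod P.n)) (fun i => toC (P.vtx i - z))
    simp only [Equiv.coe_addRight] at hshift
    rw [Finset.prod_div_distrib, hshift]
    exact div_self (Finset.prod_ne_zero_iff.2 fun i _ => ha i)
  have hexp : Complex.exp (P.winding z * Complex.I) = 1 := by
    have hn : ∏ i, ((‖toC (P.vtx (i + 1) - z) / toC (P.vtx i - z)‖ : ℝ) : ℂ) = 1 := by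
      rw [← Complex.ofReal_prod, ← norm_prod, hprod]; simp
    have h2 : ∏ i, (((‖toC (P.vtx (i + 1) - z) / toC (P.vtx i - z)‖ : ℝ) : ℂ) *
        Complex.exp (turn (P.vtx i) (P.vtx (i + 1)) z * Complex.I)) = 1 := by
      rw [← hprod]
      exact Finset.prod_congr rfl fun i _ => Complex.norm_mul_exp_arg_mul_I _
    rw [Finset.prod_mul_distrib, hn, one_mul, ← Complex.exp_sum, ← Finset.sum_mul] at h2
    rw [winding, Complex.ofReal_sum]
    exact h2
  obtain ⟨k, hk⟩ := Complex.exp_eq_one_iff.1 hexp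
  refine ⟨k, ?_⟩
  have := congrArg Complex.im hk
  simpa using this

theorem continuousAt_winding {z : E2} (hz : z ∉ P.boundary) : ContinuousAt P.winding z := by
  unfold winding
  refine tendsto_finsetSum _ fun i _ => ?_
  exact continuousAt_turn fun h => hz (P.mem_boundary.2 ⟨i, h⟩)

theorem eventually_winding_eq {z : E2} (hz : z ∉ P.boundary) :
    ∀ᶠ p in 𝓝 z, p ∉ P.boundary ∧ P.winding p = P.winding z := by
  have h1 : ∀ᶠ p in 𝓝 z, p ∉ P.boundary := P.isClosed_boundary.isOpen_compl.mem_nhds hz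
  have h2 : ∀ᶠ p in 𝓝 z, dist (P.winding p) (P.winding z) < 1 :=
    (P.continuousAt_winding hz).eventually (ball_mem_nhds _ one_pos)
  filter_upwards [h1, h2] with p hp1 hp2
  refine ⟨hp1, ?_⟩
  obtain ⟨k, hk⟩ := P.exists_winding_eq hp1
  obtain ⟨l, hl⟩ := P.exists_winding_eq hz
  rw [hk, hl, Real.dist_eq, ← sub_mul, abs_mul] at hp2
  have hpi : (1 : ℝ) < |2 * Real.pi| := by
    rw [abs_of_pos (by positivity)]; linarith [Real.pi_gt_three]
  have hkl : |((k - l : ℤ) : ℝ)| < 1 := by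
    push_cast
    nlinarith [abs_nonneg ((k : ℝ) - l)]
  have : k = l := by
    rw [← Int.cast_abs] at hkl
    have : |k - l| < 1 := by exact_mod_cast hkl
    have := Int.abs_lt_one_iff.1 this
    omega
  rw [hk, hl, this]

theorem isOpen_setOf_winding (p : ℝ → Prop) : IsOpen {z | z ∉ P.boundary ∧ p (P.winding z)} := by
  rw [isOpen_iff_mem_nhds]
  rintro z ⟨hz, hp⟩
  filter_upwards [P.eventually_winding_eq hz] with y hy
  exact ⟨hy.1, hy.2 ▸ hp⟩

theorem midpoint_mem_edge (i : ZMod P.n) : midpoint ℝ (P.vtx i) (P.vtx (i + 1)) ∈ P.edge i :=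
  midpoint_mem_segment ..

/-- The total angle of the boundary is not constant off the boundary. -/
theorem exists_winding_ne (c : ℝ) : ∃ z, z ∉ P.boundary ∧ P.winding z ≠ c := by
  by_contra! hc
  set a := P.vtx 0 with ha
  set b := P.vtx (0 + 1) with hb
  have hab : a ≠ b := (P.vtx_succ_ne 0).symm
  set m := midpoint ℝ a b with hm
  have hm0 : m ≠ a := by rw [hm]; simpa using hab
  have hm1 : m ≠ b := by rw [hm]; simpa using hab
  have hmem : m ∈ P.edge 0 := P.midpoint_mem_edge 0
  obtain ⟨ε, hε, hloc⟩ := P.local_edge hmem hm0 hm1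
  set J := rot (b - a) with hJ
  have hcJ : cross2 (b - a) J ≠ 0 := by
    have h : cross2 (b - a) J = (b 0 - a 0) ^ 2 + (b 1 - a 1) ^ 2 := by
      simp [cross2, hJ, rot]; ring
    rw [h]
    intro h0
    apply hab
    ext i
    fin_cases i <;> simp <;> nlinarith [sq_nonneg (b 0 - a 0), sq_nonneg (b 1 - a 1)]
  set g : E2 → ℝ := fun z => ∑ i ∈ Finset.univ.erase (0 : ZMod P.n),
    turn (P.vtx i) (P.vtx (i + 1)) z with hg
  have hgc : ContinuousAt g m := by
    refine tendsto_finsetSum _ fun i hi => ?_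
    refine continuousAt_turn fun h => ?_
    rcases P.eq_of_mem_edge_of_mem_edge (Finset.ne_of_mem_erase hi) h hmem with h | ⟨h, h'⟩
    · exact hm0 h.2
    · subst h; exact hm1 h'
  have hsplit : ∀ z, P.winding z = turn a b z + g z := by
    intro z
    rw [winding, ← Finset.add_sum_erase _ _ (Finset.mem_univ (0 : ZMod P.n))]
  have hnear : ∀ᶠ z in 𝓝 m, dist (g z) (g m) < 1 := hgc.eventually (ball_mem_nhds _ one_pos)
  have key : ∀ e : E2, ∀ᶠ τ in 𝓝[>] (0 : ℝ),
      ‖m + τ • e - m‖ < ε ∧ dist (g (m + τ • e)) (g m) < 1 := by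
    intro e
    have : Tendsto (fun τ : ℝ => m + τ • e) (𝓝 0) (𝓝 (m + (0 : ℝ) • e)) := by
      apply Continuous.tendsto; fun_prop
    rw [zero_smul, add_zero] at this
    exact (eventually_norm_add_smul_sub_lt (by simpa using hε) e).and
      ((this.mono_left nhdsWithin_le_nhds).eventually hnear)
  have hlt : ∀ᶠ τ in 𝓝[>] (0 : ℝ), τ < 1 / 2 :=
    nhdsWithin_le_nhds (gt_mem_nhds (by norm_num))
  obtain ⟨τ, ⟨⟨h1, h2⟩, h3, h4⟩, h5, h6⟩ :=
    (((key J).and (key (-J))).and (eventually_pos_nhdsGT.and hlt)).exists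
  obtain ⟨t1, t2⟩ := turn_midpoint_pos hab h5 h6
  rw [smul_neg, ← sub_eq_add_neg] at h3 h4
  have n1 : m + τ • J ∉ P.boundary := by
    rw [hloc _ h1]; simp [cross2_smul_right, hcJ, h5.ne', ← ha, ← hb, -zero_add]
  have n2 : m - τ • J ∉ P.boundary := by
    rw [hloc _ h3]; simp [cross2_smul_right, cross2_neg_right, hcJ, h5.ne', ← ha, ← hb, -zero_add]
  have w1 := hc _ n1
  have w2 := hc _ n2
  rw [hsplit] at w1 w2
  rw [Real.dist_eq, abs_lt] at h2 h4
  linarith [Real.pi_gt_three, h2.1, h2.2, h4.1, h4.2]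

/-- The interior of the polygon: the bounded part of the complement of the boundary. -/
def inside : Set E2 :=
  {x | x ∉ P.boundary ∧ Bornology.IsBounded (connectedComponentIn P.boundaryᶜ x)}

theorem region_eq : P.region = P.boundary ∪ P.inside := rfl

theorem boundary_nonempty : P.boundary.Nonempty := ⟨_, P.vtx_mem_boundary 0⟩

theorem isPreconnected_of_clopen {U V : Set E2} (hU : IsOpen U) (hV : IsOpen V)
    (hUV : U ∪ V = P.boundaryᶜ) (hd : Disjoint U V) (hne : V.Nonempty) : IsPreconnected U := by
  rw [isPreconnected_iff_subset_of_disjoint]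
  intro u v hu hv huv h0
  by_contra! hcon
  obtain ⟨h1, h2⟩ := hcon
  rw [Set.not_subset] at h1 h2
  obtain ⟨x, hxU, hxu⟩ := h1
  obtain ⟨y, hyU, hyv⟩ := h2
  have hxv : x ∈ v := (huv hxU).resolve_left hxu
  have hyu : y ∈ u := (huv hyU).resolve_right hyv
  refine not_three_clopen P.isPreconnected_boundary P.boundary_nonempty
    (fun z hz => P.twoSided_boundary hz) (hU.inter hu) (hU.inter hv) hV ?_ ?_
    (hd.mono_left inter_subset_left) (hd.mono_left inter_subset_left)
    ⟨y, hyU, hyu⟩ ⟨x, hxU, hxv⟩ hne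
  · rw [← inter_union_distrib_left, inter_eq_left.2 huv, hUV]
  · rw [Set.disjoint_left]
    rintro z ⟨hz, hzu⟩ ⟨-, hzv⟩
    exact (h0 ▸ (⟨hz, hzu, hzv⟩ : z ∈ U ∩ (u ∩ v)) : z ∈ (∅ : Set E2))

theorem one_lt_rank_E2 : 1 < Module.rank ℝ E2 := by
  rw [← Module.finrank_eq_rank]
  simp

theorem isPreconnected_compl_closedBall {r : ℝ} (hr : 0 ≤ r) :
    IsPreconnected (closedBall (0 : E2) r)ᶜ := by
  have h : (closedBall (0 : E2) r)ᶜ = (fun x : E2 => x + (r / ‖x‖) • x) '' {0}ᶜ := by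
    ext y
    simp only [mem_compl_iff, mem_closedBall, dist_zero_right, not_le, mem_image,
      mem_singleton_iff]
    constructor
    · intro hy
      have hy0 : 0 < ‖y‖ := hr.trans_lt hy
      have hc : 0 < 1 - r / ‖y‖ := by rw [sub_pos, div_lt_one hy0]; exact hy
      refine ⟨(1 - r / ‖y‖) • y, ?_, ?_⟩
      · simp [hc.ne', norm_pos_iff.1 hy0]
      · rw [norm_smul, Real.norm_of_nonneg hc.le, smul_smul, ← add_smul]
        have : (1 - r / ‖y‖) + r / ((1 - r / ‖y‖) * ‖y‖) * (1 - r / ‖y‖) = 1 := by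
          have := hc.ne'
          field_simp
          ring
        rw [this, one_smul]
    · rintro ⟨x, hx, rfl⟩
      have hx0 : 0 < ‖x‖ := norm_pos_iff.2 hx
      have : x + (r / ‖x‖) • x = (1 + r / ‖x‖) • x := by module
      rw [this, norm_smul, Real.norm_of_nonneg (by positivity)]
      field_simp
      linarith
  rw [h]
  refine (isConnected_compl_singleton_of_one_lt_rank one_lt_rank_E2 0).isPreconnected.image _ ?_
  refine continuousOn_id.add (ContinuousOn.smul (continuousOn_const.div continuousOn_id.norm ?_)
    continuousOn_id)
  intro x hx
  exact norm_ne_zero_iff.2 hx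

/-- The polygonal Jordan curve theorem. -/
theorem jordan : ∃ O : Set E2, IsOpen P.inside ∧ IsOpen O ∧ IsPreconnected P.inside ∧
    IsPreconnected O ∧ P.inside.Nonempty ∧ O.Nonempty ∧ Disjoint P.inside O ∧
    P.inside ∪ O = P.boundaryᶜ ∧ Bornology.IsBounded P.inside ∧
    ¬ Bornology.IsBounded O := by
  obtain ⟨r, hr⟩ := P.isCompact_boundary.isBounded.subset_closedBall 0
  have hr0 : 0 ≤ r := by
    have := hr (P.vtx_mem_boundary 0)
    rw [mem_closedBall] at this
    exact dist_nonneg.trans this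
  have hK := isPreconnected_compl_closedBall hr0
  have hKB : (closedBall (0 : E2) r)ᶜ ⊆ P.boundaryᶜ := compl_subset_compl.2 hr
  have hKu : ¬ Bornology.IsBounded (closedBall (0 : E2) r)ᶜ := by
    intro h
    have h2 := h.union (isBounded_closedBall (x := (0 : E2)) (r := r))
    rw [compl_union_self] at h2
    exact NormedSpace.unbounded_univ ℝ E2 h2
  have hKne : ((closedBall (0 : E2) r)ᶜ).Nonempty := by
    by_contra h
    rw [not_nonempty_iff_eq_empty] at h
    rw [h] at hKu
    exact hKu Bornology.isBounded_empty
  obtain ⟨z₀, hz₀⟩ := hKne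
  set c := P.winding z₀
  set O : Set E2 := {z | z ∉ P.boundary ∧ P.winding z = c} with hO
  set I : Set E2 := {z | z ∉ P.boundary ∧ P.winding z ≠ c} with hI
  have oO : IsOpen O := P.isOpen_setOf_winding (· = c)
  have oI : IsOpen I := P.isOpen_setOf_winding (· ≠ c)
  have hd : Disjoint I O := by
    rw [Set.disjoint_left]; rintro z ⟨-, h⟩ ⟨-, h'⟩; exact h h'
  have hu : I ∪ O = P.boundaryᶜ := by
    ext z
    simp only [hI, hO, mem_union, mem_ofPred_eq, mem_compl_iff]
    tauto
  have hcompl : P.boundaryᶜ \ I = O := by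
    rw [← hu, union_sdiff_cancel_left hd.le_bot]
  have hOI : P.boundaryᶜ \ O = I := by
    rw [← hu, union_comm, union_sdiff_cancel_left hd.symm.le_bot]
  have hKO : (closedBall (0 : E2) r)ᶜ ⊆ O :=
    subset_of_isPreconnected_of_clopen oO (hOI ▸ oI) hK hKB ⟨z₀, hz₀, hKB hz₀, rfl⟩
  have nI : I.Nonempty := P.exists_winding_ne c
  have nO : O.Nonempty := ⟨z₀, hKO hz₀⟩
  have pI : IsPreconnected I := P.isPreconnected_of_clopen oI oO hu hd nO
  have pO : IsPreconnected O :=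
    P.isPreconnected_of_clopen oO oI (by rw [union_comm, hu]) hd.symm nI
  have bI : Bornology.IsBounded I := by
    refine isBounded_closedBall.subset (s := I) (t := closedBall (0 : E2) r) fun z hz => ?_
    by_contra hz'
    exact Set.disjoint_left.1 hd hz (hKO hz')
  have uO : ¬ Bornology.IsBounded O := fun h => hKu (h.subset hKO)
  have hin : P.inside = I := by
    ext z
    constructor
    · rintro ⟨hz, hb⟩
      by_contra hzI
      have hzO : z ∈ O := ((hu ▸ hz : z ∈ I ∪ O)).resolve_left hzI
      exact uO (hb.subset (pO.subset_connectedComponentIn hzO fun y hy => hy.1))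
    · intro hz
      refine ⟨hz.1, bI.subset ?_⟩
      exact subset_of_isPreconnected_of_clopen oI (hcompl ▸ oO) isPreconnected_connectedComponentIn
        (connectedComponentIn_subset ..) ⟨z, mem_connectedComponentIn hz.1, hz⟩
  rw [hin]
  exact ⟨O, oI, oO, pI, pO, nI, nO, hd, hu, bI, uO⟩

theorem inside_subset_compl_boundary : P.inside ⊆ P.boundaryᶜ := fun _ h => h.1

theorem compl_region_eq : P.regionᶜ = P.boundaryᶜ \ P.inside := by
  rw [region_eq, compl_union]; rfl

theorem exists_jordan : IsOpen P.inside ∧ IsOpen P.regionᶜ ∧ IsPreconnected P.inside ∧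
    IsPreconnected P.regionᶜ ∧ P.inside.Nonempty ∧ P.regionᶜ.Nonempty ∧
    Bornology.IsBounded P.inside ∧ ¬ Bornology.IsBounded P.regionᶜ := by
  obtain ⟨O, oI, oO, pI, pO, nI, nO, hd, hu, bI, uO⟩ := P.jordan
  have : P.regionᶜ = O := by
    rw [compl_region_eq, ← hu, union_sdiff_cancel_left hd.le_bot]
  rw [this]
  exact ⟨oI, oO, pI, pO, nI, nO, bI, uO⟩

theorem isOpen_inside : IsOpen P.inside := P.exists_jordan.1

theorem isOpen_compl_region : IsOpen P.regionᶜ := P.exists_jordan.2.1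

theorem isPreconnected_inside : IsPreconnected P.inside := P.exists_jordan.2.2.1

theorem isPreconnected_compl_region : IsPreconnected P.regionᶜ := P.exists_jordan.2.2.2.1

theorem inside_nonempty : P.inside.Nonempty := P.exists_jordan.2.2.2.2.1

theorem compl_region_nonempty : P.regionᶜ.Nonempty := P.exists_jordan.2.2.2.2.2.1

theorem isBounded_inside : Bornology.IsBounded P.inside := P.exists_jordan.2.2.2.2.2.2.1

theorem isClosed_region : IsClosed P.region := ⟨P.isOpen_compl_region⟩

theorem boundary_subset_region : P.boundary ⊆ P.region := subset_union_left

theorem inside_subset_region : P.inside ⊆ P.region := subset_union_right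

theorem isBounded_region : Bornology.IsBounded P.region :=
  P.isCompact_boundary.isBounded.union P.isBounded_inside

theorem compl_sdiff_compl_region : P.boundaryᶜ \ P.regionᶜ = P.inside := by
  ext z
  simp only [Set.mem_sdiff, mem_compl_iff, region_eq, mem_union, not_not]
  constructor
  · rintro ⟨h1, h2⟩; exact h2.resolve_left h1
  · intro h; exact ⟨h.1, .inr h⟩

theorem boundary_subset_closure_inside : P.boundary ⊆ closure P.inside :=
  subset_closure_of_clopen P.isPreconnected_boundary P.boundary_nonempty
    (fun _ hz => P.twoSided_boundary hz) P.isOpen_inside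
    (P.compl_region_eq ▸ P.isOpen_compl_region) P.inside_subset_compl_boundary P.inside_nonempty

theorem boundary_subset_closure_compl_region : P.boundary ⊆ closure P.regionᶜ :=
  subset_closure_of_clopen P.isPreconnected_boundary P.boundary_nonempty
    (fun _ hz => P.twoSided_boundary hz) P.isOpen_compl_region
    (P.compl_sdiff_compl_region ▸ P.isOpen_inside)
    (compl_subset_compl.2 P.boundary_subset_region) P.compl_region_nonempty

theorem region_eq_closure_inside : P.region = closure P.inside :=
  subset_antisymm (union_subset P.boundary_subset_closure_inside subset_closure)
    (P.isClosed_region.closure_subset_iff.2 P.inside_subset_region)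

theorem mem_inside_iff {z : E2} : z ∈ P.inside ↔ z ∈ P.region ∧ z ∉ P.boundary :=
  ⟨fun h => ⟨P.inside_subset_region h, h.1⟩, fun h => h.1.resolve_left h.2⟩

variable {P}

theorem subset_inside_of_isPreconnected {S : Set E2} (hS : IsPreconnected S)
    (hd : Disjoint S P.boundary) (h : (S ∩ P.inside).Nonempty) : S ⊆ P.inside :=
  subset_of_isPreconnected_of_clopen P.isOpen_inside (P.compl_region_eq ▸ P.isOpen_compl_region)
    hS (fun _ hz => Set.disjoint_left.1 hd hz) h

theorem disjoint_region_of_isPreconnected {S : Set E2} (hS : IsPreconnected S)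
    (hd : Disjoint S P.boundary) (h : (S ∩ P.regionᶜ).Nonempty) : S ⊆ P.regionᶜ :=
  subset_of_isPreconnected_of_clopen P.isOpen_compl_region
    (P.compl_sdiff_compl_region ▸ P.isOpen_inside)
    hS (fun _ hz => Set.disjoint_left.1 hd hz) h

end SimplePolygon

namespace SimplePolygon

variable {P : SimplePolygon}

/-- Where the boundary is locally a line, one open half-disc lies inside the polygon and the
other one outside. -/
theorem half_disc_sides {y d : E2} {ε : ℝ} (hε : 0 < ε)
    (h : ∀ p, ‖p - y‖ < ε → (p ∈ P.boundary ↔ cross2 d (p - y) = 0)) :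
    ((∀ p, ‖p - y‖ < ε → 0 < cross2 d (p - y) → p ∈ P.inside) ∧
      (∀ p, ‖p - y‖ < ε → cross2 d (p - y) < 0 → p ∉ P.region)) ∨
    ((∀ p, ‖p - y‖ < ε → 0 < cross2 d (p - y) → p ∉ P.region) ∧
      (∀ p, ‖p - y‖ < ε → cross2 d (p - y) < 0 → p ∈ P.inside)) := by
  have hy : y ∈ P.boundary := by rw [h y (by simpa using hε)]; simp
  have c1 := convex_ball_inter_cross2_pos y ε d
  have c2 := convex_ball_inter_cross2_pos y ε (-d)
  simp only [cross2_neg_left, neg_pos] at c2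
  have d1 : Disjoint {p | ‖p - y‖ < ε ∧ 0 < cross2 d (p - y)} P.boundary := by
    rw [Set.disjoint_left]
    rintro p ⟨hp, hp'⟩ hb
    exact hp'.ne' ((h p hp).1 hb)
  have d2 : Disjoint {p | ‖p - y‖ < ε ∧ cross2 d (p - y) < 0} P.boundary := by
    rw [Set.disjoint_left]
    rintro p ⟨hp, hp'⟩ hb
    exact hp'.ne ((h p hp).1 hb)
  have hin := P.boundary_subset_closure_inside hy
  have hout := P.boundary_subset_closure_compl_region hy
  obtain ⟨p, hp, hpI⟩ := Metric.mem_closure_iff.1 hin ε hε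
  obtain ⟨q, hq, hqI⟩ := Metric.mem_closure_iff.1 hout ε hε
  rw [dist_comm, dist_eq_norm] at hpI hqI
  have hpc : cross2 d (p - y) ≠ 0 := fun h0 => hp.1 ((h p hpI).2 h0)
  have hqc : cross2 d (q - y) ≠ 0 :=
    fun h0 => hq (P.boundary_subset_region ((h q hqI).2 h0))
  have A1 : 0 < cross2 d (p - y) → ∀ z, ‖z - y‖ < ε → 0 < cross2 d (z - y) → z ∈ P.inside :=
    fun hs z h1 h2 => subset_inside_of_isPreconnected c1.isPreconnected d1
      ⟨p, ⟨hpI, hs⟩, hp⟩ ⟨h1, h2⟩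
  have A2 : cross2 d (p - y) < 0 → ∀ z, ‖z - y‖ < ε → cross2 d (z - y) < 0 → z ∈ P.inside :=
    fun hs z h1 h2 => subset_inside_of_isPreconnected c2.isPreconnected d2
      ⟨p, ⟨hpI, hs⟩, hp⟩ ⟨h1, h2⟩
  have B1 : 0 < cross2 d (q - y) → ∀ z, ‖z - y‖ < ε → 0 < cross2 d (z - y) → z ∉ P.region :=
    fun hs z h1 h2 => disjoint_region_of_isPreconnected c1.isPreconnected d1
      ⟨q, ⟨hqI, hs⟩, hq⟩ ⟨h1, h2⟩
  have B2 : cross2 d (q - y) < 0 → ∀ z, ‖z - y‖ < ε → cross2 d (z - y) < 0 → z ∉ P.region :=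
    fun hs z h1 h2 => disjoint_region_of_isPreconnected c2.isPreconnected d2
      ⟨q, ⟨hqI, hs⟩, hq⟩ ⟨h1, h2⟩
  rcases lt_or_gt_of_ne hpc with hp' | hp' <;> rcases lt_or_gt_of_ne hqc with hq' | hq'
  · exact absurd (P.inside_subset_region (A2 hp' q hqI hq')) hq
  · exact .inr ⟨B1 hq', A2 hp'⟩
  · exact .inl ⟨A1 hp', B2 hq'⟩
  · exact absurd (P.inside_subset_region (A1 hp' q hqI hq')) hq

/-- The directional form of `half_disc_sides`. -/
theorem eventually_sides {y d e : E2} {ε : ℝ} (hε : 0 < ε)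
    (h : ∀ p, ‖p - y‖ < ε → (p ∈ P.boundary ↔ cross2 d (p - y) = 0)) (he : cross2 d e ≠ 0) :
    (∀ᶠ δ in 𝓝[>] (0 : ℝ), y + δ • e ∈ P.inside ∧ y - δ • e ∉ P.region) ∨
    (∀ᶠ δ in 𝓝[>] (0 : ℝ), y - δ • e ∈ P.inside ∧ y + δ • e ∉ P.region) := by
  have n1 : ∀ᶠ δ in 𝓝[>] (0 : ℝ), ‖y + δ • e - y‖ < ε :=
    eventually_norm_add_smul_sub_lt (by simpa using hε) e
  have n2 : ∀ᶠ δ in 𝓝[>] (0 : ℝ), ‖y - δ • e - y‖ < ε := by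
    filter_upwards [n1] with δ hδ
    simpa using hδ
  have v1 : ∀ δ : ℝ, cross2 d (y + δ • e - y) = δ * cross2 d e := by
    intro δ; rw [add_sub_cancel_left, cross2_smul_right]
  have v2 : ∀ δ : ℝ, cross2 d (y - δ • e - y) = -(δ * cross2 d e) := by
    intro δ; rw [sub_sub_cancel_left, cross2_neg_right, cross2_smul_right]
  rcases lt_or_gt_of_ne he with he | he <;> rcases half_disc_sides hε h with ⟨h1, h2⟩ | ⟨h1, h2⟩
  · right
    filter_upwards [n1, n2, eventually_pos_nhdsGT] with δ m1 m2 m3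
    have := mul_neg_of_pos_of_neg m3 he
    exact ⟨h1 _ m2 (by rw [v2]; linarith), h2 _ m1 (by rw [v1]; linarith)⟩
  · left
    filter_upwards [n1, n2, eventually_pos_nhdsGT] with δ m1 m2 m3
    have := mul_neg_of_pos_of_neg m3 he
    exact ⟨h2 _ m1 (by rw [v1]; linarith), h1 _ m2 (by rw [v2]; linarith)⟩
  · left
    filter_upwards [n1, n2, eventually_pos_nhdsGT] with δ m1 m2 m3
    have := mul_pos m3 he
    exact ⟨h1 _ m1 (by rw [v1]; linarith), h2 _ m2 (by rw [v2]; linarith)⟩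
  · right
    filter_upwards [n1, n2, eventually_pos_nhdsGT] with δ m1 m2 m3
    have := mul_pos m3 he
    exact ⟨h2 _ m2 (by rw [v2]; linarith), h1 _ m1 (by rw [v1]; linarith)⟩

/-- A ray entering the interior leaves it at a first boundary point. -/
theorem exists_first_hit {q d : E2} (hd : d ≠ 0)
    (h : ∀ᶠ δ in 𝓝[>] (0 : ℝ), q + δ • d ∈ P.inside) :
    ∃ t > 0, q + t • d ∈ P.boundary ∧ ∀ s ∈ Ioo (0 : ℝ) t, q + s • d ∈ P.inside := by
  obtain ⟨δ₀, hδ₀, hδ⟩ := mem_nhdsGT_iff_exists_Ioo_subset.1 h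
  have hδ₀ : 0 < δ₀ := hδ₀
  set T : Set ℝ := {s | δ₀ ≤ s ∧ q + s • d ∉ P.inside} with hT
  have hcont : Continuous fun s : ℝ => q + s • d := by fun_prop
  have hTc : IsClosed T :=
    isClosed_Ici.inter (P.isOpen_inside.isClosed_compl.preimage hcont)
  have hTb : BddBelow T := ⟨δ₀, fun s hs => hs.1⟩
  have hTn : T.Nonempty := by
    obtain ⟨r, hr⟩ := P.isBounded_inside.subset_closedBall q
    have hd0 : 0 < ‖d‖ := norm_pos_iff.2 hd
    refine ⟨max δ₀ ((r + 1) / ‖d‖), le_max_left .., fun hm => ?_⟩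
    have := hr hm
    rw [mem_closedBall, dist_eq_norm, add_sub_cancel_left, norm_smul] at this
    have h2 : (r + 1) / ‖d‖ ≤ |max δ₀ ((r + 1) / ‖d‖)| := (le_max_right ..).trans (le_abs_self _)
    rw [div_le_iff₀ hd0] at h2
    rw [Real.norm_eq_abs] at this
    linarith
  have hmem := hTc.csInf_mem hTn hTb
  set t := sInf T with ht
  have ht0 : 0 < t := hδ₀.trans_le hmem.1
  have hlt : ∀ s ∈ Ioo (0 : ℝ) t, q + s • d ∈ P.inside := by
    intro s hs
    by_cases hs' : s < δ₀
    · exact hδ ⟨hs.1, hs'⟩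
    · by_contra hc
      exact absurd (csInf_le hTb (⟨not_lt.1 hs', hc⟩ : s ∈ T)) (not_le.2 hs.2)
  refine ⟨t, ht0, ?_, hlt⟩
  have hcl : q + t • d ∈ P.region := by
    rw [region_eq_closure_inside]
    have htc : t ∈ closure (Ioo 0 t) := by
      rw [closure_Ioo ht0.ne]; exact ⟨ht0.le, le_rfl⟩
    exact map_mem_closure (f := fun s : ℝ => q + s • d) hcont htc hlt
  by_contra hb
  exact hmem.2 (P.mem_inside_iff.2 ⟨hcl, hb⟩)

end SimplePolygon

/-- The segment from `a` to `b` without its endpoint `b`. -/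
def halfOpen (a b : E2) : Set E2 := (fun s : ℝ => a + s • (b - a)) '' Ico 0 1

theorem left_mem_halfOpen (a b : E2) : a ∈ halfOpen a b := ⟨0, by simp, by simp⟩

theorem right_notMem_halfOpen {a b : E2} (h : a ≠ b) : b ∉ halfOpen a b := by
  rintro ⟨s, ⟨-, hs⟩, he⟩
  have : (1 - s) • (b - a) = 0 := by
    have he' : a + s • (b - a) = b := he
    have h2 : (1 - s) • (b - a) = b - (a + s • (b - a)) := by module
    rw [h2, he', sub_self]
  rcases smul_eq_zero.1 this with h1 | h1
  · linarith
  · exact h (sub_eq_zero.1 h1).symm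

theorem segment_eq_halfOpen_union (a b : E2) : segment ℝ a b = halfOpen a b ∪ {b} := by
  rw [segment_eq_image', halfOpen, ← Ico_union_right (zero_le_one' ℝ), image_union]
  simp

theorem halfOpen_subset_segment (a b : E2) : halfOpen a b ⊆ segment ℝ a b := by
  rw [segment_eq_halfOpen_union]; exact subset_union_left

theorem openSegment_subset_halfOpen (a b : E2) : openSegment ℝ a b ⊆ halfOpen a b := by
  rw [openSegment_eq_image', halfOpen]
  exact image_mono Ioo_subset_Ico_self

theorem halfOpen_eq_insert (a b : E2) : halfOpen a b = insert a (openSegment ℝ a b) := by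
  rw [openSegment_eq_image', halfOpen, ← Ioo_insert_left (zero_lt_one' ℝ), image_insert_eq]
  simp

theorem segment_eq_insert_insert (a b : E2) :
    segment ℝ a b = insert a (insert b (openSegment ℝ a b)) :=
  (insert_endpoints_openSegment ℝ a b).symm

theorem halfOpen_eq_union {a b c : E2} (h : b ∈ halfOpen a c) :
    halfOpen a c = halfOpen a b ∪ halfOpen b c := by
  obtain ⟨t, ⟨ht0, ht1⟩, rfl⟩ := h
  simp only
  ext z
  constructor
  · rintro ⟨s, ⟨hs0, hs1⟩, rfl⟩
    rcases lt_or_ge s t with h | h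
    · left
      have ht : 0 < t := hs0.trans_lt h
      refine ⟨s / t, ⟨by positivity, (div_lt_one ht).2 h⟩, ?_⟩
      simp only [add_sub_cancel_left, smul_smul, div_mul_cancel₀ _ ht.ne']
    · right
      have ht : 0 < 1 - t := by linarith
      refine ⟨(s - t) / (1 - t), ⟨div_nonneg (by linarith) ht.le, ?_⟩, ?_⟩
      · rw [div_lt_one ht]; linarith
      · have h2 : c - (a + t • (c - a)) = (1 - t) • (c - a) := by module
        simp only [h2, smul_smul, div_mul_cancel₀ _ ht.ne']
        module
  · rintro (⟨s, ⟨hs0, hs1⟩, rfl⟩ | ⟨s, ⟨hs0, hs1⟩, rfl⟩)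
    · refine ⟨s * t, ⟨by positivity, by nlinarith⟩, ?_⟩
      simp only; module
    · refine ⟨t + s * (1 - t), ⟨by nlinarith, by nlinarith⟩, ?_⟩
      simp only; module

theorem disjoint_halfOpen_halfOpen {a b c : E2} (h : b ∈ halfOpen a c) (hab : b ≠ a) :
    Disjoint (halfOpen a b) (halfOpen b c) := by
  obtain ⟨t, ⟨ht0, ht1⟩, rfl⟩ := h
  have hac : c - a ≠ 0 := by rintro h0; simp [h0] at hab
  have ht : 0 < t := by
    rcases ht0.lt_or_eq with h | rfl
    · exact h
    · simp at hab
  rw [Set.disjoint_left]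
  rintro z ⟨s, ⟨hs0, hs1⟩, rfl⟩ ⟨r, ⟨hr0, hr1⟩, he⟩
  have h2 : (t + r * (1 - t) - s * t) • (c - a) =
      (a + t • (c - a) + r • (c - (a + t • (c - a)))) - (a + s • (a + t • (c - a) - a)) := by
    module
  simp only at he
  rw [he, sub_self] at h2
  rcases smul_eq_zero.1 h2 with h3 | h3
  · nlinarith
  · exact hac h3

/-- The cyclic sequence of points `f 0, …, f (m - 1)` has pairwise disjoint half-open edges. -/
structure IsLoop (m : ℕ) (f : ℕ → E2) : Prop where
  three_le : 3 ≤ m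
  closed : f m = f 0
  disj : ∀ i < m, ∀ j < m, i ≠ j →
    Disjoint (halfOpen (f i) (f (i + 1))) (halfOpen (f j) (f (j + 1)))

theorem IsLoop.exists_polygon {m : ℕ} {f : ℕ → E2} (h : IsLoop m f) :
    ∃ P : SimplePolygon, (∀ z, z ∈ P.boundary ↔ ∃ i < m, z ∈ halfOpen (f i) (f (i + 1))) ∧
      ∀ i < m, f i ∈ range P.vtx := by
  have h3 := h.three_le
  have : NeZero m := ⟨by omega⟩
  have hsucc : ∀ i : ZMod m, f (i + 1).val = f (i.val + 1) := by
    intro i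
    have hi := i.val_lt
    by_cases hlt : i.val + 1 < m
    · have hv : (i + 1).val = i.val + 1 := by
        have : ((i.val + 1 : ℕ) : ZMod m) = i + 1 := by simp
        rw [← this, ZMod.val_natCast_of_lt hlt]
      rw [hv]
    · have he : i.val + 1 = m := by omega
      have : i + 1 = 0 := by
        have : ((i.val + 1 : ℕ) : ZMod m) = 0 := by rw [he]; simp
        simpa using this
      rw [this, he, h.closed]; simp
  have hdis : ∀ i j : ZMod m, i ≠ j →
      Disjoint (halfOpen (f i.val) (f (i.val + 1))) (halfOpen (f j.val) (f (j.val + 1))) :=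
    fun i j hij => h.disj _ i.val_lt _ j.val_lt fun he => hij (ZMod.val_injective _ he)
  have hinj : ∀ i j : ZMod m, f i.val = f j.val → i = j := by
    intro i j hij
    by_contra hne
    exact Set.disjoint_left.1 (hdis i j hne) (left_mem_halfOpen ..) (hij ▸ left_mem_halfOpen ..)
  have hmem : ∀ (i j : ZMod m) z, i ≠ j → z ∈ segment ℝ (f i.val) (f (i + 1).val) →
      z ∈ segment ℝ (f j.val) (f (j + 1).val) →
      (i = j + 1 ∨ j = i + 1 ∧ z = f (i + 1).val) := by
    intro i j z hij hi hj
    rw [segment_eq_halfOpen_union, hsucc] at hi hj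
    rcases hi with hi | hi <;> rcases hj with hj | hj
    · exact absurd hj (Set.disjoint_left.1 (hdis i j hij) hi)
    · left
      by_contra hne
      refine Set.disjoint_left.1 (hdis i (j + 1) hne) hi ?_
      rw [mem_singleton_iff] at hj
      rw [hj, ← hsucc j]; exact left_mem_halfOpen ..
    · right
      rw [mem_singleton_iff] at hi
      refine ⟨?_, by rw [hi, hsucc]⟩
      by_contra hne
      refine Set.disjoint_left.1 (hdis j (i + 1) hne) hj ?_
      rw [hi, ← hsucc i]; exact left_mem_halfOpen ..
    · rw [mem_singleton_iff] at hi hj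
      have := hinj (i + 1) (j + 1) (by rw [hsucc, hsucc, ← hi, ← hj])
      exact absurd (add_right_cancel this) hij
  have h2 : (2 : ZMod m) ≠ 0 := by
    intro h0
    have := (ZMod.natCast_eq_zero_iff 2 m).1 (by exact_mod_cast h0)
    have := Nat.le_of_dvd (by norm_num) this
    omega
  have h1 : (1 : ZMod m) ≠ 0 := by
    intro h0
    have := (ZMod.natCast_eq_zero_iff 1 m).1 (by exact_mod_cast h0)
    have := Nat.le_of_dvd (by norm_num) this
    omega
  let P : SimplePolygon :=
    { n := m
      three_le := h3
      vtx := fun i => f i.val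
      inj := fun i j hij => hinj i j hij
      adj_edges := by
        intro i
        apply subset_antisymm
        · rintro z ⟨hz1, hz2⟩
          have e : i + 2 = i + 1 + 1 := by ring
          rw [e] at hz2
          rcases hmem i (i + 1) z (fun he => h1 (by simpa using he.symm)) hz1 hz2 with h0 | h0
          · exfalso; apply h2
            have : i + 2 = i + 0 := by rw [e, ← h0, add_zero]
            exact add_left_cancel this
          · exact h0.2
        · rintro z rfl
          exact ⟨right_mem_segment .., left_mem_segment ..⟩
      nonadj_edges := by
        intro i j hij h1 h2
        rw [eq_empty_iff_forall_notMem]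
        rintro z ⟨hz1, hz2⟩
        rcases hmem i j z hij hz1 hz2 with h0 | h0
        · exact h2 h0.symm
        · exact h1 h0.1.symm }
  refine ⟨P, fun z => ?_, fun i hi => ⟨((i : ℕ) : ZMod m), ?_⟩⟩
  · rw [P.mem_boundary]
    constructor
    · rintro ⟨i, hi⟩
      change z ∈ segment ℝ (f (ZMod.val (n := m) i)) (f (ZMod.val (n := m) (i + 1))) at hi
      rw [segment_eq_halfOpen_union] at hi
      rcases hi with hi | hi
      · rw [hsucc] at hi
        exact ⟨_, ZMod.val_lt (n := m) i, hi⟩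
      · rw [mem_singleton_iff] at hi
        rw [hi]
        exact ⟨_, ZMod.val_lt (n := m) (i + 1), left_mem_halfOpen ..⟩
    · rintro ⟨i, hi, hz⟩
      refine ⟨((i : ℕ) : ZMod m), ?_⟩
      change z ∈ segment ℝ (f (ZMod.val (n := m) i)) (f (ZMod.val (n := m) (i + 1)))
      rw [segment_eq_halfOpen_union, hsucc, ZMod.val_natCast_of_lt hi]
      exact .inl hz
  · show f (ZMod.val (n := m) i) = f i
    rw [ZMod.val_natCast_of_lt hi]

namespace SimplePolygon

variable (P : SimplePolygon)

/-- The edge from `vtx i` to `vtx (i + 1)` without the endpoint `vtx (i + 1)`. -/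
def hedge (i : ZMod P.n) : Set E2 := halfOpen (P.vtx i) (P.vtx (i + 1))

theorem hedge_subset_edge (i : ZMod P.n) : P.hedge i ⊆ P.edge i := halfOpen_subset_segment ..

theorem vtx_mem_hedge (i : ZMod P.n) : P.vtx i ∈ P.hedge i := left_mem_halfOpen ..

theorem disjoint_hedge {i j : ZMod P.n} (hij : i ≠ j) : Disjoint (P.hedge i) (P.hedge j) := by
  rw [Set.disjoint_left]
  intro z hi hj
  rcases P.eq_of_mem_edge_of_mem_edge hij (P.hedge_subset_edge _ hi) (P.hedge_subset_edge _ hj)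
    with ⟨h1, h2⟩ | ⟨h1, h2⟩
  · subst h1 h2; exact right_notMem_halfOpen (P.vtx_succ_ne i).symm hi
  · subst h1 h2; exact right_notMem_halfOpen (P.vtx_succ_ne j).symm hj

theorem mem_boundary_iff_hedge {z : E2} : z ∈ P.boundary ↔ ∃ i, z ∈ P.hedge i := by
  rw [mem_boundary]
  constructor
  · rintro ⟨i, hi⟩
    rw [edge, segment_eq_halfOpen_union] at hi
    rcases hi with hi | hi
    · exact ⟨i, hi⟩
    · rw [mem_singleton_iff] at hi
      exact ⟨i + 1, hi ▸ left_mem_halfOpen ..⟩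
  · rintro ⟨i, hi⟩
    exact ⟨i, P.hedge_subset_edge i hi⟩

theorem exists_natCast (k i : ZMod P.n) : ∃ l < P.n, i = k + (l : ℕ) :=
  ⟨(i - k).val, ZMod.val_lt _, by simp⟩

theorem natCast_ne {l l' : ℕ} (k : ZMod P.n) (h : l < P.n) (h' : l' < P.n) (hne : l ≠ l') :
    k + (l : ZMod P.n) ≠ k + (l' : ZMod P.n) := by
  intro he
  apply hne
  have := congrArg ZMod.val (add_left_cancel he)
  rwa [ZMod.val_natCast_of_lt h, ZMod.val_natCast_of_lt h'] at this

theorem hedge_natCast (k : ZMod P.n) (l : ℕ) :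
    P.hedge (k + l) = halfOpen (P.vtx (k + l)) (P.vtx (k + (l + 1 : ℕ))) := by
  rw [hedge]; push_cast; rw [add_assoc]

/-- Any boundary point can be made a vertex. -/
theorem exists_insert_vertex {b : E2} (hb : b ∈ P.boundary) :
    ∃ Q : SimplePolygon, Q.boundary = P.boundary ∧ b ∈ range Q.vtx ∧
      range P.vtx ⊆ range Q.vtx := by
  by_cases hv : b ∈ range P.vtx
  · exact ⟨P, rfl, hv, subset_rfl⟩
  obtain ⟨i, hi⟩ := P.mem_boundary_iff_hedge.1 hb
  have hbne : b ≠ P.vtx i := fun h => hv ⟨i, h.symm⟩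
  obtain ⟨N, hN⟩ : ∃ N, P.n = N + 1 := ⟨P.n - 1, by have := P.three_le; omega⟩
  have h3 := P.three_le
  have hnz : ((N + 1 : ℕ) : ZMod P.n) = 0 := by rw [← hN]; simp
  set k : ZMod P.n := i + 1 with hk
  have hkN : k + (N : ZMod P.n) = i := by
    rw [hk, add_assoc, add_comm (1 : ZMod P.n)]
    push_cast at hnz
    rw [hnz, add_zero]
  set f : ℕ → E2 := fun l => P.vtx (k + l) with hf
  set g : ℕ → E2 := fun l => if l ≤ N then f l else if l = N + 1 then b else f 0 with hg
  have hf0 : f 0 = P.vtx (i + 1) := by simp [hf, hk]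
  have hfN : f N = P.vtx i := by simp only [hf, hkN]
  have g1 : ∀ l < N, halfOpen (g l) (g (l + 1)) = P.hedge (k + l) := by
    intro l hl
    rw [hedge_natCast]
    simp [hg, hf, hl.le, Nat.succ_le_of_lt hl]
  have g2 : halfOpen (g N) (g (N + 1)) = halfOpen (P.vtx i) b := by
    simp [hg, hfN]
  have g3 : halfOpen (g (N + 1)) (g (N + 1 + 1)) = halfOpen b (P.vtx (i + 1)) := by
    simp [hg, hf0]
  have hun : P.hedge i = halfOpen (P.vtx i) b ∪ halfOpen b (P.vtx (i + 1)) := halfOpen_eq_union hi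
  have hds := disjoint_halfOpen_halfOpen hi hbne
  have hne : ∀ l < N, k + (l : ZMod P.n) ≠ i := by
    intro l hl
    rw [← hkN]
    exact P.natCast_ne k (by omega) (by omega) (by omega)
  have key : ∀ l l', l < l' → l' < N + 2 →
      Disjoint (halfOpen (g l) (g (l + 1))) (halfOpen (g l') (g (l' + 1))) := by
    intro l l' hll hl'
    rcases lt_trichotomy l' N with h | h | h
    · rw [g1 l (by omega), g1 l' h]
      exact P.disjoint_hedge (P.natCast_ne k (by omega) (by omega) (by omega))
    · subst h
      rw [g1 l (by omega), g2]
      exact (P.disjoint_hedge (hne l hll)).mono_right (hun ▸ subset_union_left)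
    · obtain rfl : l' = N + 1 := by omega
      rw [g3]
      rcases Nat.lt_or_ge l N with h' | h'
      · rw [g1 l h']
        exact (P.disjoint_hedge (hne l h')).mono_right (hun ▸ subset_union_right)
      · obtain rfl : l = N := by omega
        rw [g2]; exact hds
  have hloop : IsLoop (N + 2) g := by
    refine ⟨by omega, by simp [hg], fun l hl l' hl' hne => ?_⟩
    rcases Nat.lt_or_gt_of_ne hne with h | h
    · exact key l l' h hl'
    · exact (key l' l h hl).symm
  obtain ⟨Q, hQb, hQv⟩ := hloop.exists_polygon
  refine ⟨Q, ?_, ?_, ?_⟩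
  · ext z
    rw [hQb, mem_boundary_iff_hedge]
    constructor
    · rintro ⟨l, hl, hz⟩
      rcases lt_trichotomy l N with h | h | h
      · rw [g1 l h] at hz; exact ⟨_, hz⟩
      · subst h; rw [g2] at hz; exact ⟨i, hun ▸ .inl hz⟩
      · obtain rfl : l = N + 1 := by omega
        rw [g3] at hz; exact ⟨i, hun ▸ .inr hz⟩
    · rintro ⟨j, hj⟩
      obtain ⟨l, hl, rfl⟩ := P.exists_natCast k j
      rcases Nat.lt_or_ge l N with h | h
      · exact ⟨l, by omega, by rwa [g1 l h]⟩
      · obtain rfl : l = N := by omega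
        rw [hkN, hun] at hj
        rcases hj with hj | hj
        · exact ⟨l, by omega, by rwa [g2]⟩
        · exact ⟨l + 1, by omega, by rwa [g3]⟩
  · have := hQv (N + 1) (by omega)
    simpa [hg] using this
  · rintro _ ⟨j, rfl⟩
    obtain ⟨l, hl, rfl⟩ := P.exists_natCast k j
    have := hQv l (by omega)
    have hlN : l ≤ N := by omega
    simpa [hg, hlN, hf] using this

/-- The polygon cut off by a chord between the vertices `vtx i₀` and `vtx (i₀ + k)`. -/
theorem exists_half (i₀ : ZMod P.n) {k : ℕ} (hk0 : 0 < k) (hkn : k < P.n)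
    (hd : Disjoint (openSegment ℝ (P.vtx i₀) (P.vtx (i₀ + k))) P.boundary) :
    ∃ Q : SimplePolygon, ∀ z, z ∈ Q.boundary ↔
      (∃ l < k, z ∈ P.hedge (i₀ + (l : ℕ))) ∨ z ∈ segment ℝ (P.vtx i₀) (P.vtx (i₀ + k)) := by
  have hk2 : 2 ≤ k := by
    by_contra hlt
    obtain rfl : k = 1 := by omega
    rw [Nat.cast_one] at hd
    obtain ⟨z, hz⟩ : (openSegment ℝ (P.vtx i₀) (P.vtx (i₀ + 1))).Nonempty :=
      ⟨_, midpoint_mem_openSegment ..⟩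
    exact Set.disjoint_left.1 hd hz (P.mem_boundary.2 ⟨i₀, openSegment_subset_segment _ _ _ hz⟩)
  set f : ℕ → E2 := fun l => P.vtx (i₀ + l) with hf
  set g : ℕ → E2 := fun l => if l ≤ k then f l else f 0 with hg
  have hf0 : f 0 = P.vtx i₀ := by simp [hf]
  have g1 : ∀ l < k, halfOpen (g l) (g (l + 1)) = P.hedge (i₀ + l) := by
    intro l hl
    rw [hedge_natCast]
    simp [hg, hf, hl.le, Nat.succ_le_of_lt hl]
  have g2 : halfOpen (g k) (g (k + 1)) = halfOpen (P.vtx (i₀ + k)) (P.vtx i₀) := by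
    simp [hg, hf]
  have hchord : ∀ l < k, Disjoint (P.hedge (i₀ + l)) (halfOpen (P.vtx (i₀ + k)) (P.vtx i₀)) := by
    intro l hl
    rw [halfOpen_eq_insert, openSegment_symm, Set.disjoint_right]
    rintro z (rfl | hz) hz'
    · exact Set.disjoint_left.1 (P.disjoint_hedge (P.natCast_ne i₀ (by omega) hkn hl.ne)) hz'
        (left_mem_halfOpen ..)
    · exact Set.disjoint_left.1 hd hz (P.mem_boundary_iff_hedge.2 ⟨_, hz'⟩)
  have key : ∀ l l', l < l' → l' < k + 1 →
      Disjoint (halfOpen (g l) (g (l + 1))) (halfOpen (g l') (g (l' + 1))) := by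
    intro l l' hll hl'
    rcases Nat.lt_or_ge l' k with h | h
    · rw [g1 l (by omega), g1 l' h]
      exact P.disjoint_hedge (P.natCast_ne i₀ (by omega) (by omega) (by omega))
    · obtain rfl : l' = k := by omega
      rw [g1 l hll, g2]
      exact hchord l hll
  have hloop : IsLoop (k + 1) g := by
    refine ⟨by omega, by simp [hg], fun l hl l' hl' hne => ?_⟩
    rcases Nat.lt_or_gt_of_ne hne with h | h
    · exact key l l' h hl'
    · exact (key l' l h hl).symm
  obtain ⟨Q, hQb, -⟩ := hloop.exists_polygon
  refine ⟨Q, fun z => ?_⟩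
  rw [hQb, segment_symm, segment_eq_halfOpen_union]
  constructor
  · rintro ⟨l, hl, hz⟩
    rcases Nat.lt_or_ge l k with h | h
    · exact .inl ⟨l, h, g1 l h ▸ hz⟩
    · obtain rfl : l = k := by omega
      exact .inr (.inl (g2 ▸ hz))
  · rintro (⟨l, hl, hz⟩ | hz | hz)
    · exact ⟨l, by omega, by rwa [g1 l hl]⟩
    · exact ⟨k, by omega, by rwa [g2]⟩
    · rw [mem_singleton_iff] at hz
      refine ⟨0, by omega, ?_⟩
      rw [g1 0 hk0, hz]
      simpa using P.vtx_mem_hedge i₀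

/-- A chord splits the boundary into two arcs, each of which forms, together with the chord, the
boundary of a simple polygon. -/
theorem exists_split_boundary {a b : E2} (ha : a ∈ P.boundary) (hb : b ∈ P.boundary)
    (hab : a ≠ b) (hd : Disjoint (openSegment ℝ a b) P.boundary) :
    ∃ (P₁ P₂ : SimplePolygon) (c₁ c₂ : Set E2), P.boundary = c₁ ∪ c₂ ∧ Disjoint c₁ c₂ ∧
      P₁.boundary = c₁ ∪ segment ℝ a b ∧ P₂.boundary = c₂ ∪ segment ℝ a b ∧
      (c₁ \ segment ℝ a b).Nonempty ∧ (c₂ \ segment ℝ a b).Nonempty := by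
  obtain ⟨Q', hQ', haQ', -⟩ := P.exists_insert_vertex ha
  obtain ⟨Q, hQ, ⟨j, rfl⟩, hsub⟩ := Q'.exists_insert_vertex (b := b) (hQ' ▸ hb)
  obtain ⟨i, rfl⟩ := hsub haQ'
  have hbd : Q.boundary = P.boundary := hQ.trans hQ'
  rw [← hbd] at hd ⊢
  have hij : i ≠ j := fun h => hab (h ▸ rfl)
  obtain ⟨k, hkn, hk⟩ := Q.exists_natCast i j
  have hk0 : 0 < k := by
    rcases Nat.eq_zero_or_pos k with rfl | h
    · simp at hk; exact absurd hk.symm hij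
    · exact h
  have hk' : i = j + ((Q.n - k : ℕ) : ZMod Q.n) := by
    rw [hk, Nat.cast_sub hkn.le]; simp
  obtain ⟨P₁, h₁⟩ := Q.exists_half i hk0 hkn (by rw [← hk]; exact hd)
  obtain ⟨P₂, h₂⟩ := Q.exists_half j (k := Q.n - k) (by omega) (by omega)
    (by rw [← hk', openSegment_symm]; exact hd)
  rw [← hk] at h₁
  rw [← hk', segment_symm] at h₂
  have hj : ∀ l : ℕ, j + (l : ZMod Q.n) = i + ((k + l : ℕ) : ZMod Q.n) := by
    intro l; rw [hk]; push_cast; ring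
  have hdis : Disjoint {z | ∃ l < k, z ∈ Q.hedge (i + (l : ℕ))}
      {z | ∃ l < Q.n - k, z ∈ Q.hedge (j + (l : ℕ))} := by
    rw [Set.disjoint_left]
    rintro z ⟨l, hl, hz⟩ ⟨l', hl', hz'⟩
    rw [hj] at hz'
    exact Set.disjoint_left.1
      (Q.disjoint_hedge (Q.natCast_ne i (by omega) (by omega) (by omega))) hz hz'
  have hun : Q.boundary = {z | ∃ l < k, z ∈ Q.hedge (i + (l : ℕ))} ∪
      {z | ∃ l < Q.n - k, z ∈ Q.hedge (j + (l : ℕ))} := by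
    ext z
    rw [mem_boundary_iff_hedge]
    constructor
    · rintro ⟨x, hx⟩
      obtain ⟨l, hl, rfl⟩ := Q.exists_natCast i x
      rcases Nat.lt_or_ge l k with h | h
      · exact .inl ⟨l, h, hx⟩
      · refine .inr ⟨l - k, by omega, ?_⟩
        rw [hj, Nat.add_sub_cancel' h]; exact hx
    · rintro (⟨l, -, h⟩ | ⟨l, -, h⟩) <;> exact ⟨_, h⟩
  have m1 : Q.vtx i ∈ {z | ∃ l < k, z ∈ Q.hedge (i + (l : ℕ))} :=
    ⟨0, hk0, by simpa using Q.vtx_mem_hedge i⟩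
  have m2 : Q.vtx j ∈ {z | ∃ l < Q.n - k, z ∈ Q.hedge (j + (l : ℕ))} :=
    ⟨0, by omega, by simpa using Q.vtx_mem_hedge j⟩
  have hmid : ∀ i, midpoint ℝ (Q.vtx i) (Q.vtx (i + 1)) ∈ Q.hedge i :=
    fun i => openSegment_subset_halfOpen _ _ (midpoint_mem_openSegment ..)
  have hmid' : ∀ i, midpoint ℝ (Q.vtx i) (Q.vtx (i + 1)) ≠ Q.vtx i := by
    intro i h
    exact (Q.vtx_succ_ne i).symm (by simpa using h)
  refine ⟨P₁, P₂, _, _, hun, hdis, ?_, ?_, ?_, ?_⟩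
  · ext z; exact h₁ z
  · ext z; exact h₂ z
  · have hm : midpoint ℝ (Q.vtx i) (Q.vtx (i + 1)) ∈
        {z | ∃ l < k, z ∈ Q.hedge (i + (l : ℕ))} := ⟨0, hk0, by simpa using hmid i⟩
    refine ⟨_, hm, ?_⟩
    rw [segment_eq_insert_insert]
    rintro (h | h | h)
    · exact hmid' i h
    · rw [h] at hm; exact Set.disjoint_left.1 hdis hm m2
    · exact Set.disjoint_left.1 hd h (hun ▸ .inl hm)
  · have hm : midpoint ℝ (Q.vtx j) (Q.vtx (j + 1)) ∈
        {z | ∃ l < Q.n - k, z ∈ Q.hedge (j + (l : ℕ))} := ⟨0, by omega, by simpa using hmid j⟩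
    refine ⟨_, hm, ?_⟩
    rw [segment_eq_insert_insert]
    rintro (h | h | h)
    · rw [h] at hm; exact Set.disjoint_left.1 hdis m1 hm
    · exact hmid' j h
    · exact Set.disjoint_left.1 hd h (hun ▸ .inr hm)

end SimplePolygon

theorem exists_ball_segment_iff {a b q : E2} (hq : q ∈ openSegment ℝ a b) (hab : a ≠ b) :
    ∃ ε > 0, ∀ p, ‖p - q‖ < ε → (p ∈ segment ℝ a b ↔ cross2 (b - a) (p - q) = 0) := by
  have hd : b - a ≠ 0 := sub_ne_zero.2 hab.symm
  have hn : 0 < ‖b - a‖ := norm_pos_iff.2 hd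
  rw [openSegment_eq_image'] at hq
  obtain ⟨t, ⟨ht0, ht1⟩, rfl⟩ := hq
  refine ⟨min t (1 - t) * ‖b - a‖, mul_pos (lt_min ht0 (by linarith)) hn, fun p hp => ?_⟩
  simp only at hp ⊢
  rw [segment_eq_image']
  constructor
  · rintro ⟨s, -, rfl⟩
    have : a + s • (b - a) - (a + t • (b - a)) = (s - t) • (b - a) := by module
    simp only [this, cross2_smul_right, cross2_self, mul_zero]
  · intro h
    obtain ⟨s, hs⟩ := exists_smul_of_cross2_eq_zero hd h
    rw [hs, norm_smul, mul_lt_mul_iff_left₀ hn, Real.norm_eq_abs, abs_lt] at hp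
    have h1 := min_le_left t (1 - t)
    have h2 := min_le_right t (1 - t)
    refine ⟨t + s, ⟨by linarith [hp.1], by linarith [hp.2]⟩, ?_⟩
    rw [sub_eq_iff_eq_add] at hs
    simp only [hs]
    module

namespace SimplePolygon

/-- The segment from `a` to `b` is a chord of `P`: its endpoints are distinct boundary points and
its relative interior lies inside `P`. -/
structure IsChord (P : SimplePolygon) (a b : E2) : Prop where
  left_mem : a ∈ P.boundary
  right_mem : b ∈ P.boundary
  ne : a ≠ b
  openSegment_subset : openSegment ℝ a b ⊆ P.inside

theorem IsChord.segment_subset {P : SimplePolygon} {a b : E2} (h : P.IsChord a b) :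
    segment ℝ a b ⊆ P.region := by
  rw [segment_eq_insert_insert]
  rintro z (rfl | rfl | hz)
  · exact P.boundary_subset_region h.left_mem
  · exact P.boundary_subset_region h.right_mem
  · exact P.inside_subset_region (h.openSegment_subset hz)

theorem IsChord.mem_openSegment {P : SimplePolygon} {a b z : E2} (h : P.IsChord a b)
    (hz : z ∈ segment ℝ a b) (hz' : z ∈ P.inside) : z ∈ openSegment ℝ a b := by
  rw [segment_eq_insert_insert] at hz
  rcases hz with rfl | rfl | hz
  · exact absurd h.left_mem hz'.1
  · exact absurd h.right_mem hz'.1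
  · exact hz

/-- The chord from `a` to `b` splits `P` into `P₁` and `P₂`. -/
structure IsSplit (P P₁ P₂ : SimplePolygon) (a b : E2) : Prop where
  chord : P.IsChord a b
  seg_left : segment ℝ a b ⊆ P₁.boundary
  seg_right : segment ℝ a b ⊆ P₂.boundary
  inside_eq : P.inside \ segment ℝ a b = P₁.inside ∪ P₂.inside
  disj : Disjoint P₁.inside P₂.inside
  region_eq : P.region = P₁.region ∪ P₂.region
  inter_eq : P₁.region ∩ P₂.region = segment ℝ a b
  sides : ∀ q ∈ openSegment ℝ a b, ∀ e, cross2 (b - a) e ≠ 0 →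
    (∀ᶠ δ in 𝓝[>] (0 : ℝ), q + δ • e ∈ P₁.inside ∧ q - δ • e ∈ P₂.inside) ∨
    (∀ᶠ δ in 𝓝[>] (0 : ℝ), q + δ • e ∈ P₂.inside ∧ q - δ • e ∈ P₁.inside)

theorem IsSplit.symm {P P₁ P₂ : SimplePolygon} {a b : E2} (h : IsSplit P P₁ P₂ a b) :
    IsSplit P P₂ P₁ a b where
  chord := h.chord
  seg_left := h.seg_right
  seg_right := h.seg_left
  inside_eq := by rw [h.inside_eq, union_comm]
  disj := h.disj.symm
  region_eq := by rw [h.region_eq, union_comm]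
  inter_eq := by rw [inter_comm, h.inter_eq]
  sides := fun q hq e he => (h.sides q hq e he).symm

theorem eventually_false {p : ℝ → Prop} (h : ∀ᶠ δ in 𝓝[>] (0 : ℝ), p δ) (h' : ∀ δ, ¬ p δ) :
    False := by
  obtain ⟨δ, hδ⟩ := h.exists
  exact h' δ hδ

/-- If `∂P₁` lies in the region of `P`, then the region of `P₁` does, and the inside of `P₁` avoids
the boundary of `P`. -/
theorem region_subset_of_boundary_subset {P P₁ : SimplePolygon} (h : P₁.boundary ⊆ P.region) :
    P₁.region ⊆ P.region ∧ Disjoint P₁.inside P.boundary := by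
  have hsub : P.regionᶜ ⊆ P₁.regionᶜ := by
    apply disjoint_region_of_isPreconnected P.isPreconnected_compl_region
    · exact Set.disjoint_left.2 fun z hz hz' => hz (h hz')
    · by_contra hne
      rw [not_nonempty_iff_eq_empty, ← compl_union, compl_empty_iff] at hne
      apply NormedSpace.unbounded_univ ℝ E2
      rw [← hne]
      exact P.isBounded_region.union P₁.isBounded_region
  refine ⟨compl_subset_compl.1 hsub, ?_⟩
  rw [Set.disjoint_left]
  intro z hz hzb
  obtain ⟨y, hy, hy'⟩ := mem_closure_iff.1 (P.boundary_subset_closure_compl_region hzb) _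
    P₁.isOpen_inside hz
  exact hsub hy' (P₁.inside_subset_region hy)

/-- Every chord splits the polygon into two polygons. -/
theorem IsChord.exists_isSplit {P : SimplePolygon} {a b : E2} (h : P.IsChord a b) :
    ∃ P₁ P₂, IsSplit P P₁ P₂ a b := by
  have hdo : Disjoint (openSegment ℝ a b) P.boundary :=
    Set.disjoint_left.2 fun z hz => (h.openSegment_subset hz).1
  obtain ⟨P₁, P₂, c₁, c₂, hc, hcd, hb₁, hb₂, hn₁, hn₂⟩ :=
    P.exists_split_boundary h.left_mem h.right_mem h.ne hdo
  set S := segment ℝ a b with hS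
  have hSr : S ⊆ P.region := h.segment_subset
  have hbs₁ : P₁.boundary ⊆ P.boundary ∪ S := by
    rw [hb₁, hc]; exact union_subset_union_left _ subset_union_left
  have hbs₂ : P₂.boundary ⊆ P.boundary ∪ S := by
    rw [hb₂, hc]; exact union_subset_union_left _ subset_union_right
  have hBSr : P.boundary ∪ S ⊆ P.region := union_subset P.boundary_subset_region hSr
  obtain ⟨hr₁, hd₁⟩ := region_subset_of_boundary_subset (hbs₁.trans hBSr)
  obtain ⟨hr₂, hd₂⟩ := region_subset_of_boundary_subset (hbs₂.trans hBSr)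
  have hS₁ : S ⊆ P₁.boundary := hb₁ ▸ subset_union_right
  have hS₂ : S ⊆ P₂.boundary := hb₂ ▸ subset_union_right
  have hdBS₁ : Disjoint P₁.inside (P.boundary ∪ S) :=
    disjoint_union_right.2 ⟨hd₁, Set.disjoint_left.2 fun z hz hz' => hz.1 (hS₁ hz')⟩
  have hdBS₂ : Disjoint P₂.inside (P.boundary ∪ S) :=
    disjoint_union_right.2 ⟨hd₂, Set.disjoint_left.2 fun z hz hz' => hz.1 (hS₂ hz')⟩
  have hin₁ : P₁.inside ⊆ P.inside := fun z hz =>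
    P.mem_inside_iff.2 ⟨hr₁ (P₁.inside_subset_region hz), fun h => Set.disjoint_left.1 hd₁ hz h⟩
  have hin₂ : P₂.inside ⊆ P.inside := fun z hz =>
    P.mem_inside_iff.2 ⟨hr₂ (P₂.inside_subset_region hz), fun h => Set.disjoint_left.1 hd₂ hz h⟩
  have hdisj : Disjoint P₁.inside P₂.inside := by
    rw [Set.disjoint_iff_inter_eq_empty, ← not_nonempty_iff_eq_empty]
    intro hne
    have e1 : P₁.inside ⊆ P₂.inside :=
      subset_inside_of_isPreconnected P₁.isPreconnected_inside (hdBS₁.mono_right hbs₂) hne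
    have e2 : P₂.inside ⊆ P₁.inside :=
      subset_inside_of_isPreconnected P₂.isPreconnected_inside (hdBS₂.mono_right hbs₁)
        (by rwa [inter_comm])
    have e := e1.antisymm e2
    obtain ⟨z, hz, hzS⟩ := hn₁
    have hz1 : z ∈ P₁.boundary := hb₁ ▸ .inl hz
    have hz2 : z ∈ P₂.region := by
      rw [region_eq_closure_inside, ← e]
      exact P₁.boundary_subset_closure_inside hz1
    rcases hz2 with hz2 | hz2
    · rw [hb₂] at hz2
      exact hz2.elim (fun h => Set.disjoint_left.1 hcd hz h) hzS
    · have : z ∈ P₁.inside := e ▸ hz2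
      exact this.1 hz1
  have hline : ∀ q ∈ openSegment ℝ a b, ∃ ε > 0, ∀ p, ‖p - q‖ < ε →
      (p ∈ S ↔ cross2 (b - a) (p - q) = 0) ∧
      (p ∈ P₁.boundary ↔ cross2 (b - a) (p - q) = 0) ∧
      (p ∈ P₂.boundary ↔ cross2 (b - a) (p - q) = 0) := by
    intro q hq
    obtain ⟨ε, hε, hs⟩ := exists_ball_segment_iff hq h.ne
    obtain ⟨ε', hε', hs'⟩ := Metric.isOpen_iff.1 P.isOpen_inside q (h.openSegment_subset hq)
    refine ⟨min ε ε', lt_min hε hε', fun p hp => ?_⟩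
    have hp1 := hs p (hp.trans_le (min_le_left ..))
    have hp2 : p ∈ P.inside := hs' (by
      rw [mem_ball, dist_eq_norm]; exact hp.trans_le (min_le_right ..))
    refine ⟨hp1, ?_, ?_⟩
    · rw [← hp1]
      exact ⟨fun h => (hbs₁ h).resolve_left hp2.1, fun h => hS₁ h⟩
    · rw [← hp1]
      exact ⟨fun h => (hbs₂ h).resolve_left hp2.1, fun h => hS₂ h⟩
  have hcover : P.inside ⊆ P₁.region ∪ P₂.region := by
    set U := P.inside \ (P₁.region ∪ P₂.region) with hU
    have hUo : IsOpen U :=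
      P.isOpen_inside.sdiff (P₁.isClosed_region.union P₂.isClosed_region)
    have hcl : P.inside ⊆ U ∪ (closure U)ᶜ := by
      intro z hz
      by_contra hcon
      rw [mem_union, not_or, notMem_compl_iff] at hcon
      obtain ⟨hzU, hzc⟩ := hcon
      have no : ∀ V : Set E2, IsOpen V → z ∈ V → V ⊆ P₁.region ∪ P₂.region → False := by
        intro V hV hzV hVsub
        obtain ⟨y, hy, hy'⟩ := mem_closure_iff.1 hzc V hV hzV
        exact hy'.2 (hVsub hy)
      have n1 : z ∉ P₁.inside := fun h => no _ P₁.isOpen_inside h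
        (P₁.inside_subset_region.trans subset_union_left)
      have n2 : z ∉ P₂.inside := fun h => no _ P₂.isOpen_inside h
        (P₂.inside_subset_region.trans subset_union_right)
      have hzBS : z ∈ P.boundary ∪ S := by
        have : z ∈ P₁.region ∪ P₂.region := by
          by_contra h; exact hzU ⟨hz, h⟩
        rcases this with (h | h) | (h | h)
        · exact hbs₁ h
        · exact absurd h n1
        · exact hbs₂ h
        · exact absurd h n2
      have hzS : z ∈ S := hzBS.resolve_left hz.1
      obtain ⟨ε, hε, hl⟩ := hline z (h.mem_openSegment hzS hz)
      refine no (ball z ε) isOpen_ball (mem_ball_self hε) fun p hp => ?_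
      rw [mem_ball, dist_eq_norm] at hp
      have A1 := half_disc_sides hε fun p hp => (hl p hp).2.1
      have A2 := half_disc_sides hε fun p hp => (hl p hp).2.2
      obtain ⟨e, he⟩ := exists_cross2_pos (sub_ne_zero.2 h.ne.symm)
      have hev : ∀ᶠ δ in 𝓝[>] (0 : ℝ), ‖z + δ • e - z‖ < ε :=
        eventually_norm_add_smul_sub_lt (by simpa using hε) e
      obtain ⟨δ, hδ, hδ0⟩ := (hev.and eventually_pos_nhdsGT).exists
      have hδp : 0 < cross2 (b - a) (z + δ • e - z) := by
        rw [add_sub_cancel_left, cross2_smul_right]; positivity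
      have hδm : cross2 (b - a) (z - δ • e - z) < 0 := by
        rw [sub_sub_cancel_left, cross2_neg_right, cross2_smul_right, neg_lt_zero]; positivity
      have hδ' : ‖z - δ • e - z‖ < ε := by simpa using hδ
      rcases lt_trichotomy (cross2 (b - a) (p - z)) 0 with h0 | h0 | h0
      · rcases A1 with A1 | A1
        · rcases A2 with A2 | A2
          · exact (Set.disjoint_left.1 hdisj (A1.1 _ hδ hδp) (A2.1 _ hδ hδp)).elim
          · exact .inr (P₂.inside_subset_region (A2.2 p hp h0))
        · exact .inl (P₁.inside_subset_region (A1.2 p hp h0))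
      · exact .inl (P₁.boundary_subset_region ((hl p hp).2.1.2 h0))
      · rcases A1 with A1 | A1
        · exact .inl (P₁.inside_subset_region (A1.1 p hp h0))
        · rcases A2 with A2 | A2
          · exact .inr (P₂.inside_subset_region (A2.1 p hp h0))
          · exact (Set.disjoint_left.1 hdisj (A1.2 _ hδ' hδm) (A2.2 _ hδ' hδm)).elim
    obtain ⟨y, hy⟩ := P₁.inside_nonempty
    have hsub := P.isPreconnected_inside.subset_right_of_subset_union hUo
      isClosed_closure.isOpen_compl
      (Set.disjoint_left.2 fun z hz hz' => hz' (subset_closure hz)) hcl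
      ⟨y, hin₁ hy, fun hyc => by
        obtain ⟨x, hx, hx'⟩ := mem_closure_iff.1 hyc _ P₁.isOpen_inside hy
        exact hx'.2 (.inl (P₁.inside_subset_region hx))⟩
    intro z hz
    by_contra hc
    exact hsub hz (subset_closure ⟨hz, hc⟩)
  refine ⟨P₁, P₂, h, hS₁, hS₂, ?_, hdisj, ?_, ?_, ?_⟩
  · apply subset_antisymm
    · rintro z ⟨hz, hzS⟩
      rcases hcover hz with (h | h) | (h | h)
      · exact ((hbs₁ h).elim hz.1 hzS).elim
      · exact .inl h
      · exact ((hbs₂ h).elim hz.1 hzS).elim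
      · exact .inr h
    · rintro z (hz | hz)
      · exact ⟨hin₁ hz, fun h => hz.1 (hS₁ h)⟩
      · exact ⟨hin₂ hz, fun h => hz.1 (hS₂ h)⟩
  · apply subset_antisymm
    · rw [region_eq_closure_inside]
      exact closure_minimal hcover (P₁.isClosed_region.union P₂.isClosed_region)
    · exact union_subset hr₁ hr₂
  · apply subset_antisymm
    · have no : ∀ {A B : SimplePolygon} {z}, Disjoint A.inside B.inside → z ∈ A.inside →
          z ∈ B.region → False := by
        intro A B z hAB hz hz'
        rw [region_eq_closure_inside] at hz'
        obtain ⟨x, hx, hx'⟩ := mem_closure_iff.1 hz' _ A.isOpen_inside hz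
        exact Set.disjoint_left.1 hAB hx hx'
      rintro z ⟨h1, h2⟩
      have k1 : z ∈ P₁.boundary := h1.resolve_right fun h => no hdisj h h2
      have k2 : z ∈ P₂.boundary := h2.resolve_right fun h => no hdisj.symm h h1
      rw [hb₁] at k1
      rw [hb₂] at k2
      rcases k1 with k1 | k1
      · exact k2.resolve_left fun k => Set.disjoint_left.1 hcd k1 k
      · exact k1
    · exact fun z hz => ⟨P₁.boundary_subset_region (hS₁ hz), P₂.boundary_subset_region (hS₂ hz)⟩
  · intro q hq e he
    obtain ⟨ε, hε, hl⟩ := hline q hq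
    rcases eventually_sides hε (fun p hp => (hl p hp).2.1) he with A1 | A1 <;>
      rcases eventually_sides hε (fun p hp => (hl p hp).2.2) he with A2 | A2
    · exact (eventually_false (A1.and A2)
        fun δ hδ => Set.disjoint_left.1 hdisj hδ.1.1 hδ.2.1).elim
    · left
      filter_upwards [A1, A2] with δ h1 h2
      exact ⟨h1.1, h2.1⟩
    · right
      filter_upwards [A1, A2] with δ h1 h2
      exact ⟨h2.1, h1.1⟩
    · exact (eventually_false (A1.and A2)
        fun δ hδ => Set.disjoint_left.1 hdisj hδ.1.1 hδ.2.1).elim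

namespace IsSplit

variable {P P₁ P₂ : SimplePolygon} {a b : E2}

theorem subset_left (h : IsSplit P P₁ P₂ a b) {T : Set E2} (hT : IsPreconnected T)
    (hTr : T ⊆ P.region) (hd : Disjoint T (segment ℝ a b)) (hm : (T ∩ P₁.region).Nonempty) :
    T ⊆ P₁.region := by
  rw [h.region_eq] at hTr
  have hemp : T ∩ (P₁.region ∩ P₂.region) = ∅ := by
    rw [h.inter_eq]; exact Set.disjoint_iff_inter_eq_empty.1 hd
  rcases isPreconnected_iff_subset_of_disjoint_closed.1 hT _ _ P₁.isClosed_region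
    P₂.isClosed_region hTr hemp with h1 | h1
  · exact h1
  · obtain ⟨x, hx, hx'⟩ := hm
    exact absurd (h.inter_eq ▸ (⟨hx', h1 hx⟩ : x ∈ P₁.region ∩ P₂.region))
      (Set.disjoint_left.1 hd hx)

theorem subset_inside_left (h : IsSplit P P₁ P₂ a b) {T : Set E2} (hT : IsPreconnected T)
    (hTr : T ⊆ P.inside) (hd : Disjoint T (segment ℝ a b)) (hm : (T ∩ P₁.region).Nonempty) :
    T ⊆ P₁.inside := by
  intro z hz
  have h1 := h.subset_left hT (hTr.trans P.inside_subset_region) hd hm hz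
  have h2 : z ∈ P₁.inside ∪ P₂.inside := by
    rw [← h.inside_eq]; exact ⟨hTr hz, Set.disjoint_left.1 hd hz⟩
  rcases h2 with h2 | h2
  · exact h2
  · exact absurd (h.inter_eq ▸ (⟨h1, P₂.inside_subset_region h2⟩ : z ∈ P₁.region ∩ P₂.region))
      (Set.disjoint_left.1 hd hz)

theorem inside_left_subset (h : IsSplit P P₁ P₂ a b) : P₁.inside ⊆ P.inside := fun z hz =>
  ((h.inside_eq ▸ .inl hz : z ∈ P.inside \ segment ℝ a b)).1

theorem inside_right_subset (h : IsSplit P P₁ P₂ a b) : P₂.inside ⊆ P.inside :=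
  h.symm.inside_left_subset

theorem region_left_subset (h : IsSplit P P₁ P₂ a b) : P₁.region ⊆ P.region :=
  h.region_eq ▸ subset_union_left

theorem disjoint_inside_left_segment (h : IsSplit P P₁ P₂ a b) :
    Disjoint P₁.inside (segment ℝ a b) :=
  Set.disjoint_left.2 fun _ hz hz' => hz.1 (h.seg_left hz')

theorem notMem_left_of_mem_right (h : IsSplit P P₁ P₂ a b) {z : E2} (hz : z ∈ P₂.region)
    (hz' : z ∉ segment ℝ a b) : z ∉ P₁.region := fun hz1 =>
  hz' (h.inter_eq ▸ ⟨hz1, hz⟩)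

end IsSplit

end SimplePolygon

theorem convex_line_preimage {S : Set E2} (hS : Convex ℝ S) (p e : E2) :
    Convex ℝ {s : ℝ | p + s • e ∈ S} := by
  intro x hx y hy u v hu hv huv
  have := hS hx hy hu hv huv
  have he : u • (p + x • e) + v • (p + y • e) = p + (u • x + v • y) • e := by
    have : p = (u + v) • p := by rw [huv, one_smul]
    nth_rw 3 [this]
    simp only [smul_eq_mul]
    module
  rw [he] at this
  exact this

theorem isPreconnected_line_image (p e : E2) {I : Set ℝ} (hI : IsPreconnected I) :
    IsPreconnected ((fun s : ℝ => p + s • e) '' I) :=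
  hI.image _ (by fun_prop)

theorem openSegment_line (p e : E2) {s t : ℝ} (hst : s < t) :
    openSegment ℝ (p + s • e) (p + t • e) = (fun r : ℝ => p + r • e) '' Ioo s t := by
  have h : p + t • e - (p + s • e) = (t - s) • e := by module
  rw [openSegment_eq_image', h]
  ext z
  constructor
  · rintro ⟨r, ⟨h0, h1⟩, rfl⟩
    refine ⟨s + r * (t - s), ⟨by nlinarith, by nlinarith⟩, ?_⟩
    simp only; module
  · rintro ⟨r, ⟨h0, h1⟩, rfl⟩
    have hts : 0 < t - s := by linarith
    refine ⟨(r - s) / (t - s), ⟨div_pos (by linarith) hts, ?_⟩, ?_⟩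
    · rw [div_lt_one hts]; linarith
    · simp only [smul_smul, div_mul_cancel₀ _ hts.ne']; module

namespace SimplePolygon

namespace IsSplit

variable {P P₁ P₂ : SimplePolygon} {a b : E2}

theorem notMem_left_of_between (h : IsSplit P P₁ P₂ a b) {p e : E2} {α β γ : ℝ}
    (hα : α ≤ γ) (hβ : γ ≤ β) (hs : ∀ s ∈ Icc α β, p + s • e ∈ P.inside)
    (h1 : p + α • e ∈ P₂.inside) (h2 : p + β • e ∈ P₂.inside) : p + γ • e ∉ P₁.inside := by
  intro hγ
  have key : ∀ x y, x ≤ y → α ≤ x → y ≤ β →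
      ((x = γ ∧ p + y • e ∈ P₂.inside) ∨ (y = γ ∧ p + x • e ∈ P₂.inside)) →
      ∃ s ∈ Icc x y, p + s • e ∈ segment ℝ a b := by
    intro x y hxy hx hy hor
    by_contra! hcon
    have hsub := h.subset_inside_left (isPreconnected_line_image p e (isPreconnected_Icc (a := x)
      (b := y))) (by rintro _ ⟨s, hs', rfl⟩; exact hs s ⟨hx.trans hs'.1, hs'.2.trans hy⟩)
      (Set.disjoint_left.2 (by rintro _ ⟨s, hs', rfl⟩; exact hcon s hs'))
    rcases hor with ⟨rfl, h2⟩ | ⟨rfl, h2⟩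
    · exact Set.disjoint_left.1 h.disj (hsub ⟨_, ⟨x, ⟨le_rfl, hxy⟩, rfl⟩,
        P₁.inside_subset_region hγ⟩ ⟨y, ⟨hxy, le_rfl⟩, rfl⟩) h2
    · exact Set.disjoint_left.1 h.disj (hsub ⟨_, ⟨y, ⟨hxy, le_rfl⟩, rfl⟩,
        P₁.inside_subset_region hγ⟩ ⟨x, ⟨le_rfl, hxy⟩, rfl⟩) h2
  obtain ⟨s, hs1, hs2⟩ := key α γ hα le_rfl hβ (.inr ⟨rfl, h1⟩)
  obtain ⟨t, ht1, ht2⟩ := key γ β hβ hα le_rfl (.inl ⟨rfl, h2⟩)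
  have := (convex_line_preimage (convex_segment a b) p e).ordConnected.out hs2 ht2
    ⟨hs1.2, ht1.1⟩
  exact hγ.1 (h.seg_left this)

/-- Each side of a split is convex along lines inside `P`. -/
theorem mem_right_of_between (h : IsSplit P P₁ P₂ a b) {p e : E2} {α β γ : ℝ}
    (hα : α ≤ γ) (hβ : γ ≤ β) (hs : ∀ s ∈ Icc α β, p + s • e ∈ P.inside)
    (h1 : p + α • e ∈ P₂.inside) (h2 : p + β • e ∈ P₂.inside) : p + γ • e ∈ P₂.inside := by
  by_contra hcon
  have hγ : p + γ • e ∈ P.inside := hs γ ⟨hα, hβ⟩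
  have hseg : p + γ • e ∈ segment ℝ a b := by
    by_contra hns
    have h3 : p + γ • e ∈ P₁.inside ∪ P₂.inside := by rw [← h.inside_eq]; exact ⟨hγ, hns⟩
    exact h.notMem_left_of_between hα hβ hs h1 h2 (h3.resolve_right hcon)
  have hop := h.chord.mem_openSegment hseg hγ
  have hlt1 : α < γ := lt_of_le_of_ne hα fun h0 => hcon (h0 ▸ h1)
  have hlt2 : γ < β := lt_of_le_of_ne hβ fun h0 => hcon (h0 ▸ h2)
  have hba : b - a ≠ 0 := sub_ne_zero.2 h.chord.ne.symm
  by_cases hc : cross2 (b - a) e = 0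
  · obtain ⟨r, hr⟩ := exists_smul_of_cross2_eq_zero hba hc
    have hr0 : r ≠ 0 := by
      rintro rfl
      rw [zero_smul] at hr
      subst hr
      apply hcon
      simpa using h1
    -- the endpoints of the chord are not on the part of the line between the two points
    have hend : ∀ v, v ∈ P.boundary → ∀ s ∈ Icc α β, v ≠ p + s • e := by
      rintro v hv s hs' rfl
      exact (hs s hs').1 hv
    rw [openSegment_eq_image'] at hop
    obtain ⟨t, ⟨ht0, ht1⟩, ht⟩ := hop
    simp only at ht
    have hgen : ∀ s, p + s • e = a + (t + (s - γ) * r) • (b - a) := by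
      intro s
      have : p + s • e = (p + γ • e) + (s - γ) • e := by module
      rw [this, ← ht, hr]; module
    have hA : ∀ s, t + (s - γ) * r = 0 → a = p + s • e := by
      intro s h0; rw [hgen, h0]; simp
    have hB : ∀ s, t + (s - γ) * r = 1 → b = p + s • e := by
      intro s h0; rw [hgen, h0]; simp
    have hsegα : t + (α - γ) * r < 0 ∨ 1 < t + (α - γ) * r := by
      by_contra! hcc
      apply h1.1
      apply h.seg_right
      rw [segment_eq_image']
      exact ⟨_, ⟨hcc.1, hcc.2⟩, (hgen α).symm⟩
    have hab : ∀ s, (α - γ) * r ≤ (s - γ) * r ∧ (s - γ) * r ≤ 0 ∨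
        0 ≤ (s - γ) * r ∧ (s - γ) * r ≤ (α - γ) * r → s ∈ Icc α β := by
      intro s hs'
      rcases lt_or_gt_of_ne hr0 with hr0 | hr0
      · rcases hs' with ⟨u, v⟩ | ⟨u, v⟩
        · have : (α - γ) * r > 0 := mul_pos_of_neg_of_neg (by linarith) hr0
          linarith
        · constructor
          · nlinarith
          · nlinarith
      · rcases hs' with ⟨u, v⟩ | ⟨u, v⟩
        · constructor
          · nlinarith
          · nlinarith
        · have : (α - γ) * r < 0 := mul_neg_of_neg_of_pos (by linarith) hr0
          linarith
    rcases hsegα with hh | hh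
    · have e0 : t + ((γ - t / r) - γ) * r = 0 := by field_simp; ring
      refine hend a h.chord.left_mem _ (hab _ ?_) (hA (γ - t / r) e0)
      left
      constructor <;> linarith
    · have e0 : t + ((γ + (1 - t) / r) - γ) * r = 1 := by field_simp; ring
      refine hend b h.chord.right_mem _ (hab _ ?_) (hB (γ + (1 - t) / r) e0)
      right
      constructor <;> linarith
  · have hev1 : ∀ᶠ δ in 𝓝[>] (0 : ℝ), δ < β - γ :=
      nhdsWithin_le_nhds (gt_mem_nhds (by linarith))
    have hev2 : ∀ᶠ δ in 𝓝[>] (0 : ℝ), δ < γ - α :=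
      nhdsWithin_le_nhds (gt_mem_nhds (by linarith))
    rcases h.sides _ hop e hc with hsd | hsd
    · obtain ⟨δ, ⟨hδ, hδ1⟩, hδ0⟩ := ((hsd.and hev1).and eventually_pos_nhdsGT).exists
      have he : p + γ • e + δ • e = p + (γ + δ) • e := by module
      rw [he] at hδ
      exact h.notMem_left_of_between (by linarith) (by linarith) hs h1 h2 hδ.1
    · obtain ⟨δ, ⟨hδ, hδ1⟩, hδ0⟩ := ((hsd.and hev2).and eventually_pos_nhdsGT).exists
      have he : p + γ • e - δ • e = p + (γ - δ) • e := by module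
      rw [he] at hδ
      exact h.notMem_left_of_between (by linarith) (by linarith) hs h1 h2 hδ.2

/-- Cutting a polygon `R` inside `P` by a chord of `P` which meets the inside of `R` in a convex
set. -/
theorem exists_inter_right (h : IsSplit P P₁ P₂ a b) {R : SimplePolygon}
    (hR : R.inside ⊆ P.inside)
    (hconv : {s : ℝ | s ∈ Ioo (0 : ℝ) 1 ∧ a + s • (b - a) ∈ R.inside}.OrdConnected) :
    R.inside ∩ P₂.inside = ∅ ∨ ∃ Q : SimplePolygon, Q.inside = R.inside ∩ P₂.inside := by
  set J := {s : ℝ | s ∈ Ioo (0 : ℝ) 1 ∧ a + s • (b - a) ∈ R.inside} with hJ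
  have hcont : Continuous fun s : ℝ => a + s • (b - a) := by fun_prop
  have hba : b - a ≠ 0 := sub_ne_zero.2 h.chord.ne.symm
  have hmemJ : ∀ z ∈ segment ℝ a b, z ∈ R.inside → ∃ s ∈ J, z = a + s • (b - a) := by
    intro z hz hzR
    have := h.chord.mem_openSegment hz (hR hzR)
    rw [openSegment_eq_image'] at this
    obtain ⟨s, hs, rfl⟩ := this
    exact ⟨s, ⟨hs, hzR⟩, rfl⟩
  have hcases : ∀ T : Set E2, IsPreconnected T → T ⊆ R.inside → T.Nonempty →
      Disjoint T (segment ℝ a b) → T ⊆ P₁.inside ∨ T ⊆ P₂.inside := by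
    intro T hT hTR ⟨x, hx⟩ hTd
    have hxr : x ∈ P₁.region ∪ P₂.region := by
      rw [← h.region_eq]; exact P.inside_subset_region (hR (hTR hx))
    rcases hxr with hxr | hxr
    · exact .inl (h.subset_inside_left hT (hTR.trans hR) hTd ⟨x, hx, hxr⟩)
    · exact .inr (h.symm.subset_inside_left hT (hTR.trans hR) hTd ⟨x, hx, hxr⟩)
  by_cases hJne : J.Nonempty
  swap
  · have hd : Disjoint R.inside (segment ℝ a b) := by
      rw [Set.disjoint_left]
      intro z hz hz'
      obtain ⟨s, hs, -⟩ := hmemJ z hz' hz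
      exact hJne ⟨s, hs⟩
    rcases hcases _ R.isPreconnected_inside subset_rfl R.inside_nonempty hd with h1 | h1
    · left
      rw [← Set.disjoint_iff_inter_eq_empty]
      exact h.disj.mono_left h1
    · right
      exact ⟨R, (inter_eq_left.2 h1).symm⟩
  have hJo : IsOpen J := isOpen_Ioo.inter (R.isOpen_inside.preimage hcont)
  have hJb : BddBelow J := ⟨0, fun s hs => hs.1.1.le⟩
  have hJa : BddAbove J := ⟨1, fun s hs => hs.1.2.le⟩
  set α := sInf J with hα
  set β := sSup J with hβ
  have hαJ : α ∉ J := by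
    intro hm
    obtain ⟨l, hl, hl'⟩ := exists_Ioc_subset_of_mem_nhds (hJo.mem_nhds hm) ⟨α - 1, by linarith⟩
    have : (l + α) / 2 ∈ J := hl' ⟨by linarith, by linarith⟩
    linarith [csInf_le hJb this]
  have hβJ : β ∉ J := by
    intro hm
    obtain ⟨l, hl, hl'⟩ := exists_Ico_subset_of_mem_nhds (hJo.mem_nhds hm) ⟨β + 1, by linarith⟩
    have : (l + β) / 2 ∈ J := hl' ⟨by linarith, by linarith⟩
    linarith [le_csSup hJa this]
  have hJeq : J = Ioo α β := by
    apply subset_antisymm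
    · intro s hs
      exact ⟨lt_of_le_of_ne (csInf_le hJb hs) fun h0 => hαJ (h0 ▸ hs),
        lt_of_le_of_ne (le_csSup hJa hs) fun h0 => hβJ (h0 ▸ hs)⟩
    · exact IsConnected.Ioo_csInf_csSup_subset ⟨hJne, hconv.isPreconnected⟩ hJb hJa
  have hαβ : α < β := by
    obtain ⟨s, hs⟩ := hJne
    rw [hJeq] at hs
    exact hs.1.trans hs.2
  have hend : ∀ s ∈ closure J, s ∉ J → a + s • (b - a) ∈ R.boundary := by
    intro s hs hsJ
    have hreg : a + s • (b - a) ∈ R.region := by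
      rw [region_eq_closure_inside]
      exact map_mem_closure (f := fun s : ℝ => a + s • (b - a)) hcont hs fun t ht => ht.2
    have hs01 : s ∈ Icc (0 : ℝ) 1 :=
      closure_minimal (fun t ht => Ioo_subset_Icc_self ht.1) isClosed_Icc hs
    by_contra hb
    have hin : a + s • (b - a) ∈ R.inside := R.mem_inside_iff.2 ⟨hreg, hb⟩
    obtain ⟨t, ht, hte⟩ := hmemJ _ (by rw [segment_eq_image']; exact ⟨s, hs01, rfl⟩) hin
    have : (s - t) • (b - a) = 0 := by
      rw [sub_smul, sub_eq_zero]; exact add_left_cancel hte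
    rcases smul_eq_zero.1 this with h0 | h0
    · exact hsJ ((sub_eq_zero.1 h0) ▸ ht)
    · exact hba h0
  have hopen := openSegment_line a (b - a) hαβ
  have hchord : R.IsChord (a + α • (b - a)) (a + β • (b - a)) := by
    refine ⟨hend α (csInf_mem_closure hJne hJb) hαJ, hend β (csSup_mem_closure hJne hJa) hβJ,
      ?_, ?_⟩
    · intro he
      have : (β - α) • (b - a) = 0 := by
        rw [sub_smul, sub_eq_zero]; exact (add_left_cancel he).symm
      rcases smul_eq_zero.1 this with h0 | h0
      · linarith
      · exact hba h0
    · rw [hopen]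
      rintro _ ⟨s, hs, rfl⟩
      rw [← hJeq] at hs
      exact hs.2
  obtain ⟨R₁, R₂, hsp⟩ := hchord.exists_isSplit
  obtain ⟨e, he⟩ := exists_cross2_pos hba
  have hdir : a + β • (b - a) - (a + α • (b - a)) = (β - α) • (b - a) := by module
  have he' : cross2 (a + β • (b - a) - (a + α • (b - a))) e ≠ 0 := by
    rw [hdir, cross2_smul_left]
    exact mul_ne_zero (by linarith) he.ne'
  obtain ⟨s, hs⟩ := hJne
  set q := a + s • (b - a) with hq
  have hqR : q ∈ openSegment ℝ (a + α • (b - a)) (a + β • (b - a)) := by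
    rw [hopen]; exact ⟨s, hJeq ▸ hs, rfl⟩
  have hqP : q ∈ openSegment ℝ a b := by
    rw [openSegment_eq_image']; exact ⟨s, hs.1, rfl⟩
  have hdis : ∀ {T : Set E2}, T ⊆ R.inside →
      Disjoint T (segment ℝ (a + α • (b - a)) (a + β • (b - a))) → Disjoint T (segment ℝ a b) := by
    intro T hT hTd
    rw [Set.disjoint_left]
    intro z hz hz'
    obtain ⟨r, hr, rfl⟩ := hmemJ z hz' (hT hz)
    refine Set.disjoint_left.1 hTd hz (openSegment_subset_segment _ _ _ ?_)
    rw [hopen]; exact ⟨r, hJeq ▸ hr, rfl⟩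
  have hfin : ∀ {R₁ R₂ : SimplePolygon},
      IsSplit R R₁ R₂ (a + α • (b - a)) (a + β • (b - a)) →
      (R₁.inside ∩ P₁.inside).Nonempty → (R₂.inside ∩ P₂.inside).Nonempty →
      R₂.inside = R.inside ∩ P₂.inside := by
    intro R₁ R₂ hsp ⟨x, hx, hx'⟩ ⟨y, hy, hy'⟩
    have i1 : R₁.inside ⊆ P₁.inside := h.subset_inside_left R₁.isPreconnected_inside
      (hsp.inside_left_subset.trans hR)
      (hdis hsp.inside_left_subset hsp.disjoint_inside_left_segment)
      ⟨x, hx, P₁.inside_subset_region hx'⟩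
    have i2 : R₂.inside ⊆ P₂.inside := h.symm.subset_inside_left R₂.isPreconnected_inside
      (hsp.inside_right_subset.trans hR)
      (hdis hsp.inside_right_subset hsp.symm.disjoint_inside_left_segment)
      ⟨y, hy, P₂.inside_subset_region hy'⟩
    apply subset_antisymm
    · exact fun z hz => ⟨hsp.inside_right_subset hz, i2 hz⟩
    · rintro z ⟨hz, hz'⟩
      have hzn : z ∉ segment ℝ (a + α • (b - a)) (a + β • (b - a)) := by
        intro hzs
        have := hchord.mem_openSegment hzs hz
        rw [hopen] at this
        obtain ⟨r, hr, rfl⟩ := this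
        rw [← hJeq] at hr
        refine hz'.1 (h.seg_right (openSegment_subset_segment _ _ _ ?_))
        rw [openSegment_eq_image']; exact ⟨r, hr.1, rfl⟩
      have : z ∈ R₁.inside ∪ R₂.inside := by rw [← hsp.inside_eq]; exact ⟨hz, hzn⟩
      exact this.resolve_left fun hz1 => Set.disjoint_left.1 h.disj (i1 hz1) hz'
  right
  rcases hsp.sides q hqR e he' with s1 | s1 <;> rcases h.sides q hqP e he.ne' with s2 | s2 <;>
    obtain ⟨δ, ⟨x1, x2⟩, ⟨y1, y2⟩⟩ := (s1.and s2).exists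
  · exact ⟨R₂, hfin hsp ⟨_, x1, y1⟩ ⟨_, x2, y2⟩⟩
  · exact ⟨R₁, hfin hsp.symm ⟨_, x2, y2⟩ ⟨_, x1, y1⟩⟩
  · exact ⟨R₁, hfin hsp.symm ⟨_, x1, y1⟩ ⟨_, x2, y2⟩⟩
  · exact ⟨R₂, hfin hsp ⟨_, x2, y2⟩ ⟨_, x1, y1⟩⟩

end IsSplit

/-- Cutting a polygon along finitely many chords leaves a polygon or nothing. -/
theorem exists_inside_eq_iInter {ι : Type*} {P : SimplePolygon} {P₁ P₂ : ι → SimplePolygon}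
    {a b : ι → E2} (h : ∀ i, IsSplit P (P₁ i) (P₂ i) (a i) (b i)) (s : Finset ι) :
    P.inside ∩ ⋂ i ∈ s, (P₂ i).inside = ∅ ∨
      ∃ R : SimplePolygon, R.inside = P.inside ∩ ⋂ i ∈ s, (P₂ i).inside := by
  classical
  induction s using Finset.induction_on with
  | empty => right; exact ⟨P, by simp⟩
  | insert c s hc ih =>
    have heq : P.inside ∩ ⋂ i ∈ insert c s, (P₂ i).inside =
        (P.inside ∩ ⋂ i ∈ s, (P₂ i).inside) ∩ (P₂ c).inside := by
      rw [Finset.set_biInter_insert, inter_assoc, inter_comm (P₂ c).inside]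
    rw [heq]
    rcases ih with ih | ⟨R, hR⟩
    · left; rw [ih, empty_inter]
    · rw [← hR]
      refine (h c).exists_inter_right (hR ▸ inter_subset_left) ?_
      refine ⟨fun x hx y hy z hz => ?_⟩
      have h01 : ∀ t ∈ Icc x y, t ∈ Ioo (0 : ℝ) 1 :=
        fun t ht => ⟨hx.1.1.trans_le ht.1, ht.2.trans_lt hy.1.2⟩
      have hP : ∀ t ∈ Icc x y, a c + t • (b c - a c) ∈ P.inside := by
        intro t ht
        apply (h c).chord.openSegment_subset
        rw [openSegment_eq_image']
        exact ⟨t, h01 t ht, rfl⟩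
      refine ⟨h01 z hz, ?_⟩
      have hx2 := hx.2
      have hy2 := hy.2
      rw [hR] at hx2 hy2 ⊢
      refine ⟨hP z hz, ?_⟩
      simp only [mem_inter_iff, mem_iInter] at hx2 hy2 ⊢
      exact fun i hi => (h i).mem_right_of_between hz.1 hz.2 hP (hx2.2 i hi) (hy2.2 i hi)

end SimplePolygon

namespace SimplePolygon

theorem IsSplit.pocketOfSeg_eq {P P₁ P₂ : SimplePolygon} {a b u : E2} (h : IsSplit P P₁ P₂ a b)
    (hu : u ∈ P₁.region) (hus : u ∉ segment ℝ a b) :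
    P.pocketOfSeg (segment ℝ a b) u = P₁.region := by
  have hum : u ∈ P.region \ segment ℝ a b := ⟨h.region_left_subset hu, hus⟩
  unfold pocketOfSeg
  apply subset_antisymm
  · refine union_subset (closure_minimal ?_ P₁.isClosed_region)
      (h.seg_left.trans P₁.boundary_subset_region)
    refine h.subset_left isPreconnected_connectedComponentIn
      ((connectedComponentIn_subset _ _).trans sdiff_subset)
      (disjoint_sdiff_left.mono_left (connectedComponentIn_subset _ _))
      ⟨u, mem_connectedComponentIn hum, hu⟩
  · refine subset_union_of_subset_left ?_ _
    rw [P₁.region_eq_closure_inside]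
    apply closure_mono
    have hpre : IsPreconnected (insert u P₁.inside) := by
      refine P₁.isPreconnected_inside.subset_closure (subset_insert _ _) ?_
      exact insert_subset (P₁.region_eq_closure_inside ▸ hu) subset_closure
    refine (subset_insert u _).trans
      (hpre.subset_connectedComponentIn (mem_insert _ _) (insert_subset hum ?_))
    exact fun z hz => ⟨P.inside_subset_region (h.inside_left_subset hz),
      Set.disjoint_left.1 h.disjoint_inside_left_segment hz⟩

namespace Cut

variable {P : SimplePolygon} (C : P.Cut)

theorem u_ne_v : C.u ≠ C.v := by
  intro h
  have h1 := P.inj h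
  have h0 := P.one_ne_zero_zmod
  rcases C.adj with h2 | h2
  · rw [h2] at h1
    exact h0 (by simpa using h1)
  · rw [h2] at h1
    exact h0 (by simpa using h1)

theorem w_eq : C.w = C.v + C.t • (C.v - C.u) := rfl

theorem isChord : P.IsChord C.v C.w where
  left_mem := P.vtx_mem_boundary _
  right_mem := C.hits
  ne := by
    rw [w_eq]
    intro h
    have h1 : C.t • (C.v - C.u) = 0 := by simpa using h
    rcases smul_eq_zero.1 h1 with h1 | h1
    · exact C.t_pos.ne' h1
    · exact C.u_ne_v (sub_eq_zero.1 h1).symm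
  openSegment_subset := by
    intro z hz
    refine P.mem_inside_iff.2 ⟨C.inside (openSegment_subset_segment _ _ _ hz), ?_⟩
    rw [openSegment_eq_image'] at hz
    obtain ⟨s, ⟨hs0, hs1⟩, rfl⟩ := hz
    have h1 := C.first_hit (s * C.t) ⟨mul_pos hs0 C.t_pos, by nlinarith [C.t_pos]⟩
    simpa [w_eq, smul_smul, v, u] using h1

theorem u_notMem_seg : C.u ∉ C.seg := by
  intro h
  unfold seg at h
  rw [segment_eq_image'] at h
  obtain ⟨s, ⟨hs0, hs1⟩, h⟩ := h
  have h1 : (1 + s * C.t) • (C.v - C.u) = 0 := by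
    have h2 : C.v + s • (C.v + C.t • (C.v - C.u) - C.v) - C.u = 0 := sub_eq_zero.2 h
    rw [← h2]
    module
  rcases smul_eq_zero.1 h1 with h1 | h1
  · have := mul_nonneg hs0 C.t_pos.le
    linarith
  · exact C.u_ne_v (sub_eq_zero.1 h1).symm

theorem exists_isSplit :
    ∃ P₁ P₂, IsSplit P P₁ P₂ C.v C.w ∧ C.u ∈ P₁.region ∧ C.pocket = P₁.region := by
  obtain ⟨P₁, P₂, h⟩ := C.isChord.exists_isSplit
  have hu : C.u ∈ P₁.region ∪ P₂.region :=
    h.region_eq ▸ P.boundary_subset_region (P.vtx_mem_boundary _)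
  rcases hu with hu | hu
  · exact ⟨P₁, P₂, h, hu, h.pocketOfSeg_eq hu C.u_notMem_seg⟩
  · exact ⟨P₂, P₁, h.symm, hu, h.symm.pocketOfSeg_eq hu C.u_notMem_seg⟩

theorem seg_subset_pocket : C.seg ⊆ C.pocket := subset_union_right

instance : Finite P.Cut := by
  refine Finite.of_injective (fun C : P.Cut => (C.i, C.j)) fun C C' h => ?_
  obtain ⟨i, j, adj, reflex, t, t_pos, hits, first_hit, inside⟩ := C
  obtain ⟨i', j', adj', reflex', t', t_pos', hits', first_hit', inside'⟩ := C'
  simp only [Prod.mk.injEq] at h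
  obtain ⟨rfl, rfl⟩ := h
  have : t = t' := by
    rcases lt_trichotomy t t' with h | h | h
    · exact absurd hits (first_hit' t ⟨t_pos, h⟩)
    · exact h
    · exact absurd hits' (first_hit t' ⟨t_pos', h⟩)
  subst this
  rfl

theorem exists_nonredundant_subset : ∃ C' : P.Cut, C'.Nonredundant ∧ C'.pocket ⊆ C.pocket := by
  obtain ⟨S, hS, hmin⟩ := (Set.toFinite {C' : P.Cut | C'.pocket ⊆ C.pocket}).exists_minimalFor
    (fun C' => C'.pocket) _ ⟨C, Subset.rfl⟩
  exact ⟨S, fun ⟨C', h⟩ => h.2 (hmin (h.1.trans hS) h.1), hS⟩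

end Cut

theorem exists_region_eq_core (P : SimplePolygon) (hne : P.core.Nonempty) :
    ∃ R : SimplePolygon, R.region = P.core := by
  classical
  have := Fintype.ofFinite {C : P.Cut // C.Nonredundant}
  choose P₁ P₂ hsplit _ hpocket using
    fun C : {C : P.Cut // C.Nonredundant} => C.1.exists_isSplit
  set O : Set E2 := (⋃ C : {C : P.Cut // C.Nonredundant}, (C : P.Cut).pocket)ᶜ with hO
  have hOo : IsOpen O := by
    rw [hO, isOpen_compl_iff]
    exact isClosed_iUnion_of_finite fun C => hpocket C ▸ (P₁ C).isClosed_region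
  have hcore : P.core = closure (O ∩ P.inside) := by
    have h1 : P.core = closure (O ∩ P.region) := by
      rw [core, sdiff_eq, inter_comm]
    rw [h1]
    apply subset_antisymm
    · rw [P.region_eq_closure_inside]
      exact closure_minimal hOo.inter_closure isClosed_closure
    · exact closure_mono (inter_subset_inter_right _ P.inside_subset_region)
  have hT : O ∩ P.inside = P.inside ∩ ⋂ C ∈ (Finset.univ : Finset _), (P₂ C).inside := by
    rw [inter_comm]
    ext z
    simp only [mem_inter_iff, and_congr_right_iff, hO, mem_compl_iff, mem_iUnion, not_exists,
      mem_iInter, Finset.mem_univ, true_implies, hpocket]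
    refine fun hz => forall_congr' fun C => ⟨fun h => ?_, fun h => ?_⟩
    · have hzs : z ∉ segment ℝ C.1.v C.1.w := fun hm =>
        h ((P₁ C).boundary_subset_region ((hsplit C).seg_left hm))
      have h2 : z ∈ (P₁ C).inside ∪ (P₂ C).inside := (hsplit C).inside_eq ▸ ⟨hz, hzs⟩
      exact h2.resolve_left fun h2 => h ((P₁ C).inside_subset_region h2)
    · exact (hsplit C).notMem_left_of_mem_right ((P₂ C).inside_subset_region h)
        (Set.disjoint_left.1 (hsplit C).symm.disjoint_inside_left_segment h)
  rcases exists_inside_eq_iInter hsplit Finset.univ with h | ⟨R, hR⟩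
  · rw [hcore, hT, h, closure_empty] at hne
    exact absurd hne not_nonempty_empty
  · exact ⟨R, by rw [R.region_eq_closure_inside, hR, hcore, hT]⟩

end SimplePolygon

namespace SimplePolygon

variable (P : SimplePolygon)

/-- Near one of its points, the boundary is a cone. -/
theorem local_cone {z : E2} (hz : z ∈ P.boundary) : ∃ ε > 0, ∀ y, ‖y - z‖ < ε →
    ∀ s ∈ Ioc (0 : ℝ) 1, (z + s • (y - z) ∈ P.boundary ↔ y ∈ P.boundary) := by
  have hnear : ∀ {ε : ℝ} {y : E2} {s : ℝ}, ‖y - z‖ < ε → s ∈ Ioc (0 : ℝ) 1 →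
      ‖z + s • (y - z) - z‖ < ε := by
    intro ε y s hy hs
    rw [add_sub_cancel_left, norm_smul, Real.norm_of_nonneg hs.1.le]
    exact (mul_le_of_le_one_left (norm_nonneg _) hs.2).trans_lt hy
  have hray : ∀ {a y : E2} {s : ℝ}, s ∈ Ioc (0 : ℝ) 1 →
      ((∃ r : ℝ, 0 ≤ r ∧ z + s • (y - z) - z = r • a) ↔ ∃ r : ℝ, 0 ≤ r ∧ y - z = r • a) := by
    intro a y s hs
    rw [add_sub_cancel_left]
    constructor
    · rintro ⟨r, hr, h⟩
      refine ⟨s⁻¹ * r, mul_nonneg (inv_nonneg.2 hs.1.le) hr, ?_⟩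
      rw [mul_smul, ← h, smul_smul, inv_mul_cancel₀ hs.1.ne', one_smul]
    · rintro ⟨r, hr, h⟩
      exact ⟨s * r, mul_nonneg hs.1.le hr, by rw [h, smul_smul]⟩
  by_cases hv : ∃ i, z = P.vtx i
  · obtain ⟨i, rfl⟩ := hv
    obtain ⟨ε, hε, h⟩ := P.local_vertex i
    refine ⟨ε, hε, fun y hy s hs => ?_⟩
    rw [h _ (hnear hy hs), h y hy, hray hs, hray hs]
  · push Not at hv
    obtain ⟨i, hi⟩ := P.mem_boundary.1 hz
    obtain ⟨ε, hε, h⟩ := P.local_edge hi (hv _) (hv _)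
    refine ⟨ε, hε, fun y hy s hs => ?_⟩
    rw [h _ (hnear hy hs), h y hy, add_sub_cancel_left, cross2_smul_right, mul_eq_zero,
      or_iff_right hs.1.ne']

theorem visible_iff {x y : E2} :
    P.Visible x y ↔ ∀ s ∈ Icc (0 : ℝ) 1, x + s • (y - x) ∈ P.region := by
  rw [Visible, segment_eq_image']
  exact image_subset_iff

/-- The region is locally star-shaped. -/
theorem exists_ball_visible {z : E2} (hz : z ∈ P.region) :
    ∃ ε > 0, ∀ y ∈ P.region, ‖y - z‖ < ε → P.Visible z y := by
  by_cases hzb : z ∈ P.boundary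
  · obtain ⟨ε, hε, h⟩ := P.local_cone hzb
    refine ⟨ε, hε, fun y hy hyz => P.visible_iff.2 fun s hs => ?_⟩
    rcases hs.1.eq_or_lt with rfl | hs0
    · simpa using hz
    by_cases hyb : y ∈ P.boundary
    · exact P.boundary_subset_region ((h y hyz s ⟨hs0, hs.2⟩).2 hyb)
    · apply P.inside_subset_region
      refine subset_inside_of_isPreconnected
        (isPreconnected_line_image z (y - z) (isPreconnected_Ioc (a := 0) (b := 1))) ?_
        ⟨y, ⟨1, by simp, by simp⟩, P.mem_inside_iff.2 ⟨hy, hyb⟩⟩ ⟨s, ⟨hs0, hs.2⟩, rfl⟩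
      rw [Set.disjoint_left]
      rintro _ ⟨r, hr, rfl⟩ hb
      exact hyb ((h y hyz r hr).1 hb)
  · obtain ⟨ε, hε, h⟩ := Metric.isOpen_iff.1 P.isOpen_inside z (P.mem_inside_iff.2 ⟨hz, hzb⟩)
    refine ⟨ε, hε, fun y _ hyz => ?_⟩
    exact ((convex_ball z ε).segment_subset (mem_ball_self hε)
      (mem_ball_iff_norm.2 hyz)).trans (h.trans P.inside_subset_region)

theorem isClosed_visible : IsClosed {p : E2 × E2 | P.Visible p.1 p.2} := by
  simp only [visible_iff, ofPred_forall]
  refine isClosed_biInter fun s _ => P.isClosed_region.preimage (f := fun p : E2 × E2 =>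
    p.1 + s • (p.2 - p.1)) (by fun_prop)

theorem isClosed_visible_left (x : E2) : IsClosed {y | P.Visible x y} :=
  P.isClosed_visible.preimage (f := fun y => (x, y)) (by fun_prop)

/-- Finitely many points of a connected set in the region lie on a compact connected set that
stays in the region and in a given neighbourhood of the set. -/
theorem exists_isCompact_isPreconnected {S O : Set E2} (hS : IsPreconnected S)
    (hSr : S ⊆ P.region) (hSO : S ⊆ O) (hO : IsOpen O) {p₀ : E2} (hp₀ : p₀ ∈ S)
    {ι : Type*} [Finite ι] {p : ι → E2} (hp : ∀ i, p i ∈ S) :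
    ∃ K, IsCompact K ∧ IsPreconnected K ∧ K ⊆ P.region ∧ K ⊆ O ∧ p₀ ∈ K ∧ ∀ i, p i ∈ K := by
  have key : ∀ q ∈ S, ∃ K, IsCompact K ∧ IsPreconnected K ∧ K ⊆ P.region ∧ K ⊆ O ∧
      p₀ ∈ K ∧ q ∈ K := by
    intro q hq
    refine hS.induction₂ (fun a b => ∃ K, IsCompact K ∧ IsPreconnected K ∧ K ⊆ P.region ∧
      K ⊆ O ∧ a ∈ K ∧ b ∈ K) ?_ ?_ ?_ hp₀ hq
    · intro z hz
      obtain ⟨ε, hε, h⟩ := P.exists_ball_visible (hSr hz)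
      obtain ⟨ε', hε', h'⟩ := Metric.isOpen_iff.1 hO z (hSO hz)
      filter_upwards [self_mem_nhdsWithin,
        mem_nhdsWithin_of_mem_nhds (ball_mem_nhds z (lt_min hε hε'))] with y hy hyz
      rw [mem_ball_iff_norm, lt_min_iff] at hyz
      refine ⟨segment ℝ z y, ?_, (convex_segment z y).isPreconnected,
        h y (hSr hy) hyz.1, ?_, left_mem_segment _ _ _, right_mem_segment _ _ _⟩
      · rw [segment_eq_image']
        exact isCompact_Icc.image (by fun_prop)
      · exact ((convex_ball z ε').segment_subset (mem_ball_self hε')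
          (mem_ball_iff_norm.2 hyz.2)).trans h'
    · rintro a b c _ _ _ ⟨K, k1, k2, k3, k4, k5, k6⟩ ⟨L, l1, l2, l3, l4, l5, l6⟩
      exact ⟨K ∪ L, k1.union l1, k2.union b k6 l5 l2, union_subset k3 l3, union_subset k4 l4,
        .inl k5, .inr l6⟩
    · rintro a b _ _ ⟨K, k1, k2, k3, k4, k5, k6⟩
      exact ⟨K, k1, k2, k3, k4, k6, k5⟩
  choose! K k1 k2 k3 k4 k5 k6 using key
  let q : Option ι → E2 := fun o => o.elim p₀ p
  have hq : ∀ o, q o ∈ S := fun o => by cases o; exacts [hp₀, hp _]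
  refine ⟨⋃ o, K (q o), isCompact_iUnion fun o => k1 _ (hq o),
    isPreconnected_iUnion ⟨p₀, mem_iInter.2 fun o => k5 _ (hq o)⟩ fun o => k2 _ (hq o),
    iUnion_subset fun o => k3 _ (hq o), iUnion_subset fun o => k4 _ (hq o),
    mem_iUnion.2 ⟨none, k5 _ (hq none)⟩, fun i => mem_iUnion.2 ⟨some i, k6 _ (hq (some i))⟩⟩

/-- No line through two vertices passes through `x`. -/
def IsGeneric (x : E2) : Prop :=
  ∀ i j, i ≠ j → cross2 (P.vtx j - P.vtx i) (x - P.vtx i) ≠ 0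

theorem dense_isGeneric : Dense {x | P.IsGeneric x} := by
  have : {x | P.IsGeneric x} = ⋂ p : {p : ZMod P.n × ZMod P.n // p.1 ≠ p.2},
      {x | cross2 (P.vtx p.1.2 - P.vtx p.1.1) (x - P.vtx p.1.1) ≠ 0} := by
    ext x
    simp [IsGeneric]
  rw [this]
  have hc : ∀ a b : E2, Continuous fun x => cross2 a (x - b) := fun a b =>
    (continuous_cross2_right a).comp (by fun_prop : Continuous fun x : E2 => x - b)
  refine dense_iInter_of_isOpen (fun p => isOpen_ne_fun (hc _ _) continuous_const) ?_
  rintro ⟨⟨i, j⟩, hij⟩ x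
  have hne : P.vtx j - P.vtx i ≠ 0 := sub_ne_zero.2 fun h => hij (P.inj h).symm
  obtain ⟨e, he⟩ := exists_cross2_pos hne
  by_cases hx : cross2 (P.vtx j - P.vtx i) (x - P.vtx i) = 0
  · apply mem_closure_of_forall_pos_add_smul_mem (e := e)
    filter_upwards [eventually_pos_nhdsGT] with δ hδ
    have : x + δ • e - P.vtx i = (x - P.vtx i) + δ • e := by module
    simp only [this, cross2_add_right, hx, cross2_smul_right, zero_add]
    exact (mul_pos hδ he).ne'
  · exact subset_closure hx

theorem exists_isGeneric_not_visible {x : E2} {K : Set E2} (hx : x ∈ P.region) (hK : IsCompact K)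
    (h : ∀ k ∈ K, ¬ P.Visible x k) :
    ∃ x' ∈ P.inside, P.IsGeneric x' ∧ ∀ k ∈ K, ¬ P.Visible x' k := by
  have h1 : ∀ᶠ x' in 𝓝 x, ∀ k ∈ K, ¬ P.Visible x' k :=
    hK.eventually_forall_of_forall_eventually fun k hk =>
      P.isClosed_visible.isOpen_compl.mem_nhds (h k hk)
  obtain ⟨U, hU, hUo, hxU⟩ := _root_.eventually_nhds_iff.1 h1
  rw [P.region_eq_closure_inside] at hx
  obtain ⟨x', hx', hx''⟩ := P.dense_isGeneric.exists_mem_open (hUo.inter P.isOpen_inside)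
    (mem_closure_iff.1 hx U hUo hxU)
  exact ⟨x', hx''.2, hx', hU x' hx''.1⟩

end SimplePolygon

namespace SimplePolygon

variable {P : SimplePolygon}

theorem false_of_both_sides_mem_region {y d e : E2} {ε : ℝ} (hε : 0 < ε)
    (h : ∀ p, ‖p - y‖ < ε → (p ∈ P.boundary ↔ cross2 d (p - y) = 0)) (he : cross2 d e ≠ 0)
    (h' : ∀ᶠ δ in 𝓝[>] (0 : ℝ), y + δ • e ∈ P.region ∧ y - δ • e ∈ P.region) : False := by
  rcases P.eventually_sides hε h he with h1 | h1
  · exact eventually_false (h1.and h') fun δ hδ => hδ.1.2 hδ.2.2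
  · exact eventually_false (h1.and h') fun δ hδ => hδ.1.2 hδ.2.1

theorem cross2_eq_zero_of_mem_segment {a b q : E2} (h : q ∈ segment ℝ a b) :
    cross2 (b - a) (q - a) = 0 := by
  rw [segment_eq_image'] at h
  obtain ⟨s, -, rfl⟩ := h
  simp only [add_sub_cancel_left, cross2_smul_right, cross2_self, mul_zero]

/-- A line of sight of a generic point meets the boundary only at vertices. -/
theorem IsGeneric.exists_eq_vtx {x z : E2} (hx : P.IsGeneric x) (hz : P.Visible x z) {s : ℝ}
    (hs : s ∈ Ioo (0 : ℝ) 1) (hq : x + s • (z - x) ∈ P.boundary) :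
    ∃ i, x + s • (z - x) = P.vtx i := by
  by_contra hv
  push Not at hv
  obtain ⟨i, hi⟩ := P.mem_boundary.1 hq
  obtain ⟨ε, hε, h⟩ := P.local_edge hi (hv _) (hv _)
  have hne : cross2 (P.vtx (i + 1) - P.vtx i) (z - x) ≠ 0 := by
    intro h0
    apply hx i (i + 1) (by simpa using P.one_ne_zero_zmod)
    have h1 := cross2_eq_zero_of_mem_segment hi
    have h2 : x + s • (z - x) - P.vtx i = (x - P.vtx i) + s • (z - x) := by module
    rwa [h2, cross2_add_right, cross2_smul_right, h0, mul_zero, add_zero] at h1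
  refine false_of_both_sides_mem_region hε h hne ?_
  have hm : Ioo (0 : ℝ) (min s (1 - s)) ∈ 𝓝[>] (0 : ℝ) :=
    Ioo_mem_nhdsGT (lt_min hs.1 (by linarith [hs.2]))
  filter_upwards [hm] with δ hδ
  have h1 := hδ.2.trans_le (min_le_left _ _)
  have h2 := hδ.2.trans_le (min_le_right _ _)
  have e1 : x + s • (z - x) + δ • (z - x) = x + (s + δ) • (z - x) := by module
  have e2 : x + s • (z - x) - δ • (z - x) = x + (s - δ) • (z - x) := by module
  rw [e1, e2]
  have hz' := P.visible_iff.1 hz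
  exact ⟨hz' _ ⟨by linarith [hs.1, hδ.1], by linarith⟩,
    hz' _ ⟨by linarith, by linarith [hs.2, hδ.1]⟩⟩

theorem IsGeneric.eq_of_vtx {x w : E2} (hx : P.IsGeneric x) {s s' : ℝ} {i j : ZMod P.n}
    (hi : x + s • w = P.vtx i) (hj : x + s' • w = P.vtx j) : i = j := by
  by_contra hij
  apply hx i j hij
  have e1 : P.vtx j - P.vtx i = (s' - s) • w := by rw [← hi, ← hj]; module
  have e2 : x - P.vtx i = (-s) • w := by rw [← hi]; module
  rw [e1, e2, cross2_smul_left, cross2_smul_right, cross2_self, mul_zero, mul_zero]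

/-- The chord from the vertex `vtx i` to `e` is a window of `x`: it prolongs the line of sight from
`x` to `vtx i`. -/
structure IsWindow (P : SimplePolygon) (x : E2) (i : ZMod P.n) (e : E2) : Prop where
  openSegment_subset : openSegment ℝ x (P.vtx i) ⊆ P.inside
  chord : P.IsChord (P.vtx i) e
  exists_eq : ∃ c : ℝ, 0 < c ∧ e = P.vtx i + c • (P.vtx i - x)

theorem IsChord.le_of_ray {r d : E2} {c c' : ℝ} (hc : 0 < c)
    (h : r + c • d ∈ P.boundary) (h' : P.IsChord r (r + c' • d)) : c' ≤ c := by
  by_contra hlt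
  push Not at hlt
  have h1 := openSegment_line r d (hc.trans hlt)
  rw [zero_smul, add_zero] at h1
  exact (h'.openSegment_subset (h1 ▸ ⟨c, ⟨hc, hlt⟩, rfl⟩)).1 h

namespace IsWindow

variable {x e : E2} {i : ZMod P.n}

theorem unique {e' : E2} (h : P.IsWindow x i e) (h' : P.IsWindow x i e') : e = e' := by
  obtain ⟨c, hc, he⟩ := h.exists_eq
  obtain ⟨c', hc', he'⟩ := h'.exists_eq
  have h1 := h.chord
  have h2 := h'.chord
  rw [he] at h1 ⊢
  rw [he'] at h2 ⊢
  rw [le_antisymm (h1.le_of_ray hc' h2.right_mem) (h2.le_of_ray hc h1.right_mem)]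

theorem ne (h : P.IsWindow x i e) : P.vtx i ≠ x := by
  intro heq
  have hx : x ∈ P.inside := h.openSegment_subset (by rw [heq]; simp)
  exact hx.1 (heq ▸ P.vtx_mem_boundary i)

theorem notMem_segment (h : P.IsWindow x i e) : x ∉ segment ℝ (P.vtx i) e := by
  obtain ⟨c, hc, he⟩ := h.exists_eq
  intro hx
  rw [segment_eq_image'] at hx
  obtain ⟨s, hs, hx⟩ := hx
  have h1 : (1 + s * c) • (P.vtx i - x) = 0 := by
    have h2 : P.vtx i + s • (P.vtx i + c • (P.vtx i - x) - P.vtx i) - x = 0 := by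
      rw [← he]; exact sub_eq_zero.2 hx
    rw [← h2]; module
  rcases smul_eq_zero.1 h1 with h1 | h1
  · have := mul_nonneg hs.1 hc.le
    linarith
  · exact h.ne (sub_eq_zero.1 h1)

theorem exists_isSplit (h : P.IsWindow x i e) (hx : x ∈ P.inside) :
    ∃ P₁ P₂, IsSplit P P₁ P₂ (P.vtx i) e ∧ x ∈ P₂.inside := by
  obtain ⟨P₁, P₂, hs⟩ := h.chord.exists_isSplit
  have hx' : x ∈ P₁.inside ∪ P₂.inside := hs.inside_eq ▸ ⟨hx, h.notMem_segment⟩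
  rcases hx' with hx' | hx'
  · exact ⟨P₂, P₁, hs.symm, hx'⟩
  · exact ⟨P₁, P₂, hs, hx'⟩

theorem visible (h : P.IsWindow x i e) (hx : x ∈ P.inside) {z : E2}
    (hz : z ∈ segment ℝ (P.vtx i) e) : P.Visible x z := by
  obtain ⟨c, hc, he⟩ := h.exists_eq
  have h1 : segment ℝ x (P.vtx i) ⊆ P.region := by
    rw [segment_eq_insert_insert]
    rintro y (rfl | rfl | hy)
    · exact P.inside_subset_region hx
    · exact P.boundary_subset_region (P.vtx_mem_boundary i)
    · exact P.inside_subset_region (h.openSegment_subset hy)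
  have h2 : segment ℝ (P.vtx i) z ⊆ P.region :=
    ((convex_segment _ _).segment_subset (left_mem_segment _ _ _) hz).trans h.chord.segment_subset
  have h3 : P.vtx i ∈ segment ℝ x z := by
    rw [segment_eq_image'] at hz
    obtain ⟨s, hs, rfl⟩ := hz
    have hsc : 0 ≤ s * c := mul_nonneg hs.1 hc.le
    rw [segment_eq_image']
    refine ⟨(1 + s * c)⁻¹, ⟨by positivity, inv_le_one_of_one_le₀ (by linarith)⟩, ?_⟩
    have e1 : P.vtx i + s • (P.vtx i + c • (P.vtx i - x) - P.vtx i) - x =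
        (1 + s * c) • (P.vtx i - x) := by module
    simp only [he, e1, smul_smul]
    rw [inv_mul_cancel₀ (by linarith), one_smul, add_sub_cancel]
  rw [Visible, segment_eq_union_of_mem h3, segment_symm]
  exact union_subset h1 h2

end IsWindow

theorem IsGeneric.visible_cases {x z : E2} (hx : P.IsGeneric x) (hxi : x ∈ P.inside)
    (hzi : z ∈ P.inside) (hz : P.Visible x z) :
    segment ℝ x z ⊆ P.inside ∨ ∃ i e, P.IsWindow x i e ∧ z ∈ segment ℝ (P.vtx i) e := by
  have hz' := P.visible_iff.1 hz
  by_cases hb : ∀ s ∈ Ioo (0 : ℝ) 1, x + s • (z - x) ∉ P.boundary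
  · left
    rw [segment_eq_insert_insert, openSegment_eq_image']
    rintro y (rfl | rfl | ⟨s, hs, rfl⟩)
    · exact hxi
    · exact hzi
    · exact P.mem_inside_iff.2 ⟨hz' s (Ioo_subset_Icc_self hs), hb s hs⟩
  · right
    push Not at hb
    obtain ⟨s, hs, hsb⟩ := hb
    obtain ⟨i, hi⟩ := hx.exists_eq_vtx hz hs hsb
    have hw : z - x ≠ 0 := by
      intro h0
      rw [h0, smul_zero, add_zero] at hsb
      exact hxi.1 hsb
    have hin : ∀ σ ∈ Ioc (0 : ℝ) 1, σ ≠ s → x + σ • (z - x) ∈ P.inside := by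
      intro σ hσ hσs
      rcases hσ.2.eq_or_lt with rfl | hσ1
      · simpa using hzi
      refine P.mem_inside_iff.2 ⟨hz' σ (Ioc_subset_Icc_self hσ), fun hσb => hσs ?_⟩
      obtain ⟨j, hj⟩ := hx.exists_eq_vtx hz ⟨hσ.1, hσ1⟩ hσb
      have hij := hx.eq_of_vtx hi hj
      have h0 : (σ - s) • (z - x) = 0 := by
        rw [sub_smul, sub_eq_zero, ← add_right_inj x, hj, hi, hij]
      exact sub_eq_zero.1 ((smul_eq_zero.1 h0).resolve_right hw)
    have hray : ∀ σ : ℝ, P.vtx i + σ • (z - x) = x + (s + σ) • (z - x) := by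
      intro σ; rw [← hi]; module
    obtain ⟨t, ht, htb, hti⟩ := P.exists_first_hit (q := P.vtx i) hw (by
      filter_upwards [Ioo_mem_nhdsGT (by linarith [hs.2] : (0 : ℝ) < 1 - s)] with δ hδ
      rw [hray]
      exact hin _ ⟨by linarith [hs.1, hδ.1], by linarith [hδ.2]⟩ (by linarith [hδ.1]))
    have ht1 : 1 - s ≤ t := by
      by_contra hlt
      push Not at hlt
      rw [hray] at htb
      exact (hin (s + t) ⟨by linarith [hs.1], by linarith⟩ (by linarith)).1 htb
    have hxs : x = x + (0 : ℝ) • (z - x) := by simp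
    refine ⟨i, P.vtx i + t • (z - x), ⟨?_, ⟨P.vtx_mem_boundary i, htb, ?_, ?_⟩, t / s,
      div_pos ht hs.1, ?_⟩, ?_⟩
    · rw [← hi]
      nth_rw 1 [hxs]
      rw [openSegment_line x _ hs.1]
      rintro _ ⟨σ, hσ, rfl⟩
      exact hin σ ⟨hσ.1, by linarith [hσ.2, hs.2]⟩ hσ.2.ne
    · intro h0
      have h1 : t • (z - x) = 0 := by simpa using h0
      rcases smul_eq_zero.1 h1 with h1 | h1
      exacts [ht.ne' h1, hw h1]
    · have h1 := openSegment_line (P.vtx i) (z - x) ht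
      rw [zero_smul, add_zero] at h1
      rw [h1]
      rintro _ ⟨σ, hσ, rfl⟩
      exact hti σ hσ
    · have h1 : P.vtx i - x = s • (z - x) := by rw [← hi]; module
      rw [h1, smul_smul, div_mul_cancel₀ _ hs.1.ne']
    · rw [segment_eq_image']
      refine ⟨(1 - s) / t, ⟨div_nonneg (by linarith [hs.2]) ht.le, (div_le_one ht).2 ht1⟩, ?_⟩
      simp only [add_sub_cancel_left, smul_smul, div_mul_cancel₀ _ ht.ne']
      rw [hray]
      simp

/-- A connected set that a generic point does not see lies behind one of its windows. -/
theorem IsGeneric.exists_isWindow {x : E2} {K : Set E2} (hx : P.IsGeneric x) (hxi : x ∈ P.inside)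
    (hK : IsPreconnected K) (hKne : K.Nonempty) (hKr : K ⊆ P.region)
    (hKv : ∀ k ∈ K, ¬ P.Visible x k) :
    ∃ i e P₁ P₂, P.IsWindow x i e ∧ IsSplit P P₁ P₂ (P.vtx i) e ∧ x ∈ P₂.inside ∧
      K ⊆ P₁.region \ segment ℝ (P.vtx i) e := by
  classical
  have := Fintype.ofFinite {i : ZMod P.n // ∃ e, P.IsWindow x i e}
  choose e hw using fun i : {i : ZMod P.n // ∃ e, P.IsWindow x i e} => i.2
  choose P₁ P₂ hs hx₂ using fun i => (hw i).exists_isSplit hxi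
  set V : Set E2 := {y | P.Visible x y} with hV
  have hVc : IsClosed V := P.isClosed_visible_left x
  have hT : P.inside ∩ ⋂ i ∈ (Finset.univ : Finset _), (P₂ i).inside ⊆ V := by
    rcases exists_inside_eq_iInter hs Finset.univ with h | ⟨R, hR⟩
    · rw [h]; exact empty_subset _
    have hsub : ∀ z ∈ P.inside ∩ ⋂ i ∈ (Finset.univ : Finset _), (P₂ i).inside, z ∈ V →
        z ∈ interior V := by
      intro z hz hzV
      rw [mem_interior_iff_mem_nhds]
      rcases hx.visible_cases hxi hz.1 hzV with h | ⟨i, e', hw', hze⟩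
      · have h1 : ∀ᶠ z' in 𝓝 z, ∀ s ∈ Icc (0 : ℝ) 1, x + s • (z' - x) ∈ P.inside := by
          refine isCompact_Icc.eventually_forall_of_forall_eventually fun s hs => ?_
          have hc : Continuous fun p : E2 × ℝ => x + p.2 • (p.1 - x) := by fun_prop
          apply hc.continuousAt.preimage_mem_nhds
          rw [segment_eq_image'] at h
          exact P.isOpen_inside.mem_nhds (h ⟨s, hs, rfl⟩)
        filter_upwards [h1] with z' hz'
        exact P.visible_iff.2 fun s hs => P.inside_subset_region (hz' s hs)
      · exfalso
        have hz2 : z ∈ (P₂ ⟨i, e', hw'⟩).inside :=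
          mem_iInter₂.1 hz.2 ⟨i, e', hw'⟩ (Finset.mem_univ _)
        rw [hw'.unique (hw ⟨i, e', hw'⟩)] at hze
        exact hz2.1 ((hs _).seg_right hze)
    have hxT : x ∈ P.inside ∩ ⋂ i ∈ (Finset.univ : Finset _), (P₂ i).inside :=
      ⟨hxi, mem_iInter₂.2 fun i _ => hx₂ i⟩
    have hxV : x ∈ V := by
      rw [hV, mem_ofPred_eq, Visible, segment_same, singleton_subset_iff]
      exact P.inside_subset_region hxi
    refine (IsPreconnected.subset_left_of_subset_union isOpen_interior hVc.isOpen_compl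
      (Set.disjoint_left.2 fun z hz hz' => hz' (interior_subset hz)) ?_
      ⟨x, hxT, hsub x hxT hxV⟩ (hR ▸ R.isPreconnected_inside)).trans interior_subset
    intro z hz
    by_cases hzV : z ∈ V
    exacts [.inl (hsub z hz hzV), .inr hzV]
  have hcover : P.region ⊆ (⋃ i, (P₁ i).region) ∪ V := by
    rw [P.region_eq_closure_inside]
    refine closure_minimal (fun z hz => ?_)
      ((isClosed_iUnion_of_finite fun i => (P₁ i).isClosed_region).union hVc)
    by_cases hall : ∀ i, z ∈ (P₂ i).inside
    · exact .inr (hT ⟨hz, mem_iInter₂.2 fun i _ => hall i⟩)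
    · push Not at hall
      obtain ⟨i, hi⟩ := hall
      refine .inl (mem_iUnion.2 ⟨i, ?_⟩)
      by_cases hzs : z ∈ segment ℝ (P.vtx i) (e i)
      · exact (P₁ i).boundary_subset_region ((hs i).seg_left hzs)
      · have h2 : z ∈ (P₁ i).inside ∪ (P₂ i).inside := (hs i).inside_eq ▸ ⟨hz, hzs⟩
        exact (P₁ i).inside_subset_region (h2.resolve_right hi)
  obtain ⟨k, hk⟩ := hKne
  obtain ⟨i, hi⟩ := mem_iUnion.1 ((hcover (hKr hk)).resolve_right (hKv k hk))
  have hd : Disjoint K (segment ℝ (P.vtx i) (e i)) :=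
    Set.disjoint_left.2 fun z hz hz' => hKv z hz ((hw i).visible hxi hz')
  exact ⟨i, e i, P₁ i, P₂ i, hw i, hs i, hx₂ i, fun z hz =>
    ⟨(hs i).subset_left hK hKr hd ⟨k, hk, hi⟩ hz, Set.disjoint_left.1 hd hz⟩⟩

end SimplePolygon

theorem exists_dual_basis {a b : E2} (h : cross2 a b ≠ 0) : ∃ α β : E2,
    cross2 α a = 0 ∧ cross2 α b = 1 ∧ cross2 β a = 1 ∧ cross2 β b = 0 ∧
    ∀ y, y = cross2 β y • a + cross2 α y • b := by
  refine ⟨(cross2 a b)⁻¹ • a, (-(cross2 a b)⁻¹) • b, ?_, ?_, ?_, ?_, fun y => ?_⟩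
  · rw [cross2_smul_left, cross2_self, mul_zero]
  · rw [cross2_smul_left, inv_mul_cancel₀ h]
  · rw [cross2_smul_left, cross2_swap b a, neg_mul_neg, inv_mul_cancel₀ h]
  · rw [cross2_smul_left, cross2_self, mul_zero]
  · have h1 := eq_smul_add_smul_of_cross2_ne_zero h y
    rw [cross2_smul_left, cross2_smul_left, cross2_swap b y, neg_mul_neg, mul_comm,
      mul_comm _ (cross2 a y), ← div_eq_mul_inv, ← div_eq_mul_inv]
    exact h1

theorem convex_ball_inter_cross2_neg (z : E2) (ε : ℝ) (a : E2) :
    Convex ℝ {p | ‖p - z‖ < ε ∧ cross2 a (p - z) < 0} := by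
  have h := convex_ball_inter_cross2_pos z ε (-a)
  simpa only [cross2_neg_left, neg_pos] using h

namespace SimplePolygon

variable {P : SimplePolygon}

theorem IsWindow.eventually_mem_openSegment {x e : E2} {i : ZMod P.n} (h : P.IsWindow x i e) :
    ∀ᶠ δ in 𝓝[>] (0 : ℝ), P.vtx i + δ • (P.vtx i - x) ∈ openSegment ℝ (P.vtx i) e := by
  obtain ⟨c, hc, he⟩ := h.exists_eq
  have h1 := openSegment_line (P.vtx i) (P.vtx i - x) hc
  rw [zero_smul, add_zero, ← he] at h1
  filter_upwards [Ioo_mem_nhdsGT hc] with δ hδ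
  rw [h1]
  exact ⟨δ, hδ, rfl⟩

theorem eventually_sub_smul_mem_openSegment (x r : E2) :
    ∀ᶠ δ in 𝓝[>] (0 : ℝ), r - δ • (r - x) ∈ openSegment ℝ x r := by
  filter_upwards [Ioo_mem_nhdsGT one_pos] with δ hδ
  rw [openSegment_symm, openSegment_eq_image']
  exact ⟨δ, hδ, by simp only; module⟩

theorem eventually_near (r y : E2) {ε : ℝ} (hε : 0 < ε) :
    ∀ᶠ δ in 𝓝[>] (0 : ℝ), ‖r + δ • y - r‖ < ε :=
  eventually_norm_add_smul_sub_lt (by simpa using hε) y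

/-- If the vertex of a window is reflex and its edge `a` lies on the far side, then the pocket of
the cut extending this edge does not reach behind the window. -/
theorem IsWindow.exists_cut_of_corner {x e a b α β : E2} {i j : ZMod P.n} {P₁ P₂ : SimplePolygon}
    {ε : ℝ} (hw : P.IsWindow x i e) (h : IsSplit P P₁ P₂ (P.vtx i) e) (hx : x ∈ P₂.inside)
    (hadj : j = i + 1 ∨ j = i - 1) (ha : a = P.vtx j - P.vtx i)
    (hedge : segment ℝ (P.vtx i) (P.vtx j) ⊆ P.boundary) (hrefl : P.IsReflex i)
    (hαa : cross2 α a = 0) (hαb : cross2 α b = 1) (hβa : cross2 β a = 1) (hβb : cross2 β b = 0)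
    (hε : 0 < ε)
    (hS : ∀ p, ‖p - P.vtx i‖ < ε → cross2 β (p - P.vtx i) < 0 → p ∈ P.inside)
    (hT : ∀ p, ‖p - P.vtx i‖ < ε → cross2 α (p - P.vtx i) < 0 → p ∈ P.inside)
    (hs : cross2 β (P.vtx i - x) < 0) (ht : 0 < cross2 α (P.vtx i - x)) :
    ∃ C : P.Cut, Disjoint C.pocket (P₁.region \ segment ℝ (P.vtx i) e) := by
  obtain ⟨c, hc, he⟩ := hw.exists_eq
  set r := P.vtx i with hr
  set d := r - x with hd
  have ha0 : -a ≠ 0 := by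
    intro h0
    rw [neg_eq_zero.1 h0, cross2_zero_right] at hβa
    exact zero_ne_one hβa
  -- the cut
  obtain ⟨t, ht0, htb, hti⟩ := P.exists_first_hit (q := r) ha0 (by
    filter_upwards [eventually_near r (-a) hε, eventually_pos_nhdsGT] with δ hδ hδ0
    refine hS _ hδ ?_
    rw [add_sub_cancel_left, cross2_smul_right, cross2_neg_right, hβa]
    linarith)
  have hneg : -a = P.vtx i - P.vtx j := by rw [ha]; abel
  have hopen : openSegment ℝ r (r + t • -a) ⊆ P.inside := by
    have h1 := openSegment_line r (-a) ht0
    rw [zero_smul, add_zero] at h1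
    rw [h1]
    rintro _ ⟨σ, hσ, rfl⟩
    exact hti σ hσ
  let C : P.Cut :=
    { i := i, j := j, adj := hadj, reflex := hrefl, t := t, t_pos := ht0
      hits := hneg ▸ htb
      first_hit := fun s hs => (hneg ▸ hti s hs : _ ∈ P.inside).1
      inside := by
        rw [← hneg, segment_eq_insert_insert]
        rintro y (rfl | rfl | hy)
        · exact P.boundary_subset_region (P.vtx_mem_boundary i)
        · exact P.boundary_subset_region htb
        · exact P.inside_subset_region (hopen hy) }
  obtain ⟨Q₁, Q₂, g, gu, gp⟩ := C.exists_isSplit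
  have hCv : C.v = r := rfl
  have hCw : C.w = r + t • -a := by rw [hneg]; rfl
  have hCu : C.u = r + a := by rw [ha, add_sub_cancel]; rfl
  rw [hCv, hCw] at g
  rw [hCu] at gu
  -- coordinates on the two segments
  have hD : ∀ z ∈ segment ℝ r e, ∃ σ : ℝ, 0 ≤ σ ∧ z = r + σ • d := by
    intro z hz
    rw [segment_eq_image', he] at hz
    obtain ⟨σ, hσ, rfl⟩ := hz
    exact ⟨σ * c, mul_nonneg hσ.1 hc.le, by simp only; module⟩
  have hC : ∀ z ∈ segment ℝ r (r + t • -a), ∃ σ ∈ Icc (0 : ℝ) t, z = r + σ • -a := by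
    intro z hz
    rw [segment_eq_image'] at hz
    obtain ⟨σ, hσ, rfl⟩ := hz
    exact ⟨σ * t, ⟨mul_nonneg hσ.1 ht0.le, mul_le_of_le_one_left ht0.le hσ.2⟩,
      by simp only; module⟩
  -- the half disc beside the edge `a` on the side of `x`
  set M : Set E2 := {p | ‖p - r‖ < ε ∧ cross2 α (p - r) < 0} with hM
  have hMpre : IsPreconnected M := (convex_ball_inter_cross2_neg r ε α).isPreconnected
  have hMin : M ⊆ P.inside := fun p hp => hT p hp.1 hp.2
  have hMD : Disjoint M (segment ℝ r e) := by
    rw [Set.disjoint_left]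
    rintro p ⟨-, hp⟩ hpD
    obtain ⟨σ, hσ, rfl⟩ := hD p hpD
    rw [add_sub_cancel_left, cross2_smul_right] at hp
    nlinarith
  have hMC : Disjoint M (segment ℝ r (r + t • -a)) := by
    rw [Set.disjoint_left]
    rintro p ⟨-, hp⟩ hpC
    obtain ⟨σ, hσ, rfl⟩ := hC p hpC
    rw [add_sub_cancel_left, cross2_smul_right, cross2_neg_right, hαa] at hp
    linarith
  have hM₂ : M ⊆ P₂.inside := by
    refine h.symm.subset_inside_left hMpre hMin hMD ?_
    have hsight : insert x (openSegment ℝ x r) ⊆ P₂.inside := by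
      have hxD := hw.notMem_segment
      refine h.symm.subset_inside_left ?_ ?_ ?_ ⟨x, mem_insert _ _, P₂.inside_subset_region hx⟩
      · refine (convex_openSegment x r).isPreconnected.subset_closure (subset_insert _ _) ?_
        rw [closure_openSegment]
        exact insert_subset (left_mem_segment _ _ _) (openSegment_subset_segment _ _ _)
      · exact insert_subset (h.inside_right_subset hx) hw.openSegment_subset
      · rw [Set.disjoint_left]
        rintro p (rfl | hp) hpD
        · exact hxD hpD
        · obtain ⟨σ, hσ, rfl⟩ := hD p hpD
          rw [openSegment_symm, openSegment_eq_image'] at hp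
          obtain ⟨τ, hτ, hp⟩ := hp
          have h1 := congrArg (fun p => cross2 α (p - r)) hp
          simp only [add_sub_cancel_left, cross2_smul_right] at h1
          have h2 : cross2 α (x - r) = -cross2 α d := by
            rw [← cross2_neg_right, hd, neg_sub]
          rw [h2] at h1
          nlinarith [hτ.1, mul_pos hτ.1 ht, mul_nonneg hσ ht.le]
    obtain ⟨δ, hδ1, hδ2, hδ3⟩ := ((eventually_sub_smul_mem_openSegment x r).and
      ((eventually_near r (-d) hε).and eventually_pos_nhdsGT)).exists
    refine ⟨r + δ • -d, ⟨hδ2, ?_⟩, P₂.inside_subset_region (hsight (.inr ?_))⟩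
    · rw [add_sub_cancel_left, cross2_smul_right, cross2_neg_right]
      nlinarith
    · rw [smul_neg, ← sub_eq_add_neg]; exact hδ1
  -- the half disc beside the window on the side of the cut
  set γ : E2 := cross2 β d • α - cross2 α d • β with hγ
  have hγe : ∀ y, cross2 γ y = cross2 β d * cross2 α y - cross2 α d * cross2 β y := fun y => by
    rw [hγ, cross2_sub_left, cross2_smul_left, cross2_smul_left]
  have hγd : cross2 γ d = 0 := by rw [hγe]; ring
  set H : Set E2 := {p | ‖p - r‖ < ε ∧ 0 < cross2 γ (p - r)} with hH
  have hHin : H ⊆ P.inside := by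
    rintro p ⟨hp, hp'⟩
    by_cases hp0 : cross2 α (p - r) < 0
    · exact hT p hp hp0
    · push Not at hp0
      rw [hγe] at hp'
      refine hS p hp ?_
      by_contra hp1
      push Not at hp1
      nlinarith [mul_nonneg ht.le hp1, mul_nonneg (neg_nonneg.2 hs.le) hp0]
  have hH₂ : H ⊆ P₂.inside := by
    refine h.symm.subset_inside_left (convex_ball_inter_cross2_pos r ε γ).isPreconnected hHin ?_ ?_
    · rw [Set.disjoint_left]
      rintro p ⟨-, hp⟩ hpD
      obtain ⟨σ, hσ, rfl⟩ := hD p hpD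
      rw [add_sub_cancel_left, cross2_smul_right, hγd, mul_zero] at hp
      exact lt_irrefl _ hp
    · obtain ⟨δ, hδ1, hδ2⟩ := ((eventually_near r (-(a + b)) hε).and eventually_pos_nhdsGT).exists
      refine ⟨r + δ • -(a + b), ⟨hδ1, ?_⟩, P₂.inside_subset_region (hM₂ ⟨hδ1, ?_⟩)⟩
      · rw [add_sub_cancel_left, cross2_smul_right, hγe]
        simp only [cross2_neg_right, cross2_add_right, hαa, hαb, hβa, hβb]
        apply mul_pos hδ2
        linarith
      · rw [add_sub_cancel_left, cross2_smul_right]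
        simp only [cross2_neg_right, cross2_add_right, hαa, hαb]
        linarith
  -- the cut lies on the near side of the window
  have hCD : ∀ σ ∈ Ioc (0 : ℝ) t, r + σ • -a ∉ segment ℝ r e := by
    intro σ hσ hm
    obtain ⟨τ, hτ, hm⟩ := hD _ hm
    have h1 := congrArg (fun p => cross2 γ (p - r)) hm
    simp only [add_sub_cancel_left, cross2_smul_right, hγd, hγe (-a), cross2_neg_right, hαa,
      hβa] at h1
    nlinarith [mul_pos hσ.1 ht]
  have hC₂ : (fun σ : ℝ => r + σ • -a) '' Ioc 0 t ⊆ P₂.region := by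
    refine h.symm.subset_left (isPreconnected_line_image r (-a) isPreconnected_Ioc) ?_ ?_ ?_
    · rintro _ ⟨σ, hσ, rfl⟩
      rcases hσ.2.eq_or_lt with rfl | hσt
      · exact P.boundary_subset_region htb
      · exact P.inside_subset_region (hti σ ⟨hσ.1, hσt⟩)
    · rw [Set.disjoint_left]
      rintro _ ⟨σ, hσ, rfl⟩
      exact hCD σ hσ
    · obtain ⟨δ, hδ1, hδ2⟩ := ((eventually_near r (-a) hε).and (Ioo_mem_nhdsGT ht0)).exists
      refine ⟨r + δ • -a, ⟨δ, Ioo_subset_Ioc_self hδ2, rfl⟩,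
        P₂.inside_subset_region (hH₂ ⟨hδ1, ?_⟩)⟩
      rw [add_sub_cancel_left, cross2_smul_right, hγe, cross2_neg_right, cross2_neg_right, hαa, hβa]
      apply mul_pos hδ2.1
      linarith
  have hdisj : Disjoint (P₁.region \ {r}) (segment ℝ r (r + t • -a)) := by
    rw [Set.disjoint_left]
    rintro z ⟨hz, hzr⟩ hzC
    obtain ⟨σ, hσ, rfl⟩ := hC z hzC
    have hσ0 : 0 < σ := by
      refine lt_of_le_of_ne hσ.1 fun h0 => hzr ?_
      rw [← h0, zero_smul, add_zero]
      exact mem_singleton r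
    have hσ' : σ ∈ Ioc 0 t := ⟨hσ0, hσ.2⟩
    exact h.notMem_left_of_mem_right (hC₂ ⟨σ, hσ', rfl⟩) (hCD σ hσ') hz
  -- the half disc `M` lies in the pocket, the opposite quadrant does not
  have hM₁ : M ⊆ Q₁.inside := by
    refine g.subset_inside_left hMpre hMin hMC ?_
    have hE : (fun σ : ℝ => r + σ • a) '' Ioc 0 1 ⊆ Q₁.region := by
      refine g.subset_left (isPreconnected_line_image r a isPreconnected_Ioc) ?_ ?_
        ⟨r + a, ⟨1, by simp, by simp⟩, gu⟩
      · rintro _ ⟨σ, hσ, rfl⟩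
        refine P.boundary_subset_region (hedge ?_)
        rw [segment_eq_image']
        exact ⟨σ, Ioc_subset_Icc_self hσ, by rw [ha]⟩
      · rw [Set.disjoint_left]
        rintro _ ⟨σ, hσ, rfl⟩ hm
        obtain ⟨τ, hτ, hm⟩ := hC _ hm
        have h1 := congrArg (fun p => cross2 β (p - r)) hm
        simp only [add_sub_cancel_left, cross2_smul_right, cross2_neg_right, hβa] at h1
        linarith [hσ.1, hτ.1]
    obtain ⟨δ, hδ1, hδ2⟩ := ((eventually_near r a hε).and
      (Ioo_mem_nhdsGT (zero_lt_one' ℝ))).exists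
    have hy₁ : r + δ • a ∈ Q₁.region := hE ⟨δ, Ioo_subset_Ioc_self hδ2, rfl⟩
    have hy₂ : r + δ • a ∉ Q₂.region := by
      refine g.symm.notMem_left_of_mem_right hy₁ fun hm => ?_
      obtain ⟨τ, hτ, hm⟩ := hC _ hm
      have h1 := congrArg (fun p => cross2 β (p - r)) hm
      simp only [add_sub_cancel_left, cross2_smul_right, cross2_neg_right, hβa] at h1
      linarith [hδ2.1, hτ.1]
    have hev : ∀ᶠ η in 𝓝[>] (0 : ℝ), r + δ • a + η • -b ∈ Q₂.regionᶜ := by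
      have hc : Continuous fun η : ℝ => r + δ • a + η • -b := by fun_prop
      refine nhdsWithin_le_nhds (hc.continuousAt.preimage_mem_nhds
        (Q₂.isClosed_region.isOpen_compl.mem_nhds ?_))
      simpa using hy₂
    obtain ⟨η, hη1, hη2, hη3⟩ := (hev.and ((eventually_norm_add_smul_sub_lt hδ1 (-b)).and
      eventually_pos_nhdsGT)).exists
    have hηM : r + δ • a + η • -b ∈ M := by
      refine ⟨hη2, ?_⟩
      rw [add_assoc, add_sub_cancel_left, cross2_add_right, cross2_smul_right, cross2_smul_right,
        cross2_neg_right, hαa, hαb]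
      linarith
    have hr' : r + δ • a + η • -b ∈ Q₁.region ∪ Q₂.region :=
      g.region_eq ▸ P.inside_subset_region (hMin hηM)
    exact ⟨_, hηM, hr'.resolve_right hη1⟩
  set N : Set E2 := {p | ‖p - r‖ < ε ∧ cross2 β (p - r) < 0} ∩
    {p | ‖p - r‖ < ε ∧ 0 < cross2 α (p - r)} with hN
  have hN₂ : N ⊆ Q₂.inside := by
    refine g.symm.subset_inside_left ((convex_ball_inter_cross2_neg r ε β).inter
      (convex_ball_inter_cross2_pos r ε α)).isPreconnected (fun p hp => hS p hp.1.1 hp.1.2) ?_ ?_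
    · rw [Set.disjoint_left]
      rintro p ⟨-, -, hp⟩ hpC
      obtain ⟨σ, hσ, rfl⟩ := hC p hpC
      rw [add_sub_cancel_left, cross2_smul_right, cross2_neg_right, hαa] at hp
      linarith
    · obtain ⟨δ, hδ1, hδ2⟩ := ((eventually_near r (-a) hε).and (Ioo_mem_nhdsGT ht0)).exists
      have hq : r + δ • -a ∈ openSegment ℝ r (r + t • -a) := by
        have h1 := openSegment_line r (-a) ht0
        rw [zero_smul, add_zero] at h1
        rw [h1]
        exact ⟨δ, hδ2, rfl⟩
      have hab : cross2 a b ≠ 0 := by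
        intro h0
        obtain ⟨σ, hσ⟩ := exists_smul_of_cross2_eq_zero (neg_ne_zero.1 ha0) h0
        rw [hσ, cross2_smul_right, hαa, mul_zero] at hαb
        exact zero_ne_one hαb
      have hne : cross2 (r + t • -a - r) b ≠ 0 := by
        rw [add_sub_cancel_left, cross2_smul_left, cross2_neg_left]
        exact mul_ne_zero ht0.ne' (neg_ne_zero.2 hab)
      have n1 := eventually_norm_add_smul_sub_lt hδ1 b
      have n2 := eventually_norm_add_smul_sub_lt hδ1 (-b)
      rcases g.sides _ hq b hne with hsd | hsd
      · obtain ⟨η, hη1, hη2, hη3⟩ := (hsd.and (n2.and eventually_pos_nhdsGT)).exists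
        exfalso
        refine Set.disjoint_left.1 g.disj (hM₁ ⟨hη2, ?_⟩) ?_
        · rw [add_assoc, add_sub_cancel_left, cross2_add_right, cross2_smul_right,
            cross2_smul_right, cross2_neg_right, cross2_neg_right, hαa, hαb]
          linarith
        · rw [smul_neg η b, ← sub_eq_add_neg]; exact hη1.2
      · obtain ⟨η, hη1, hη2, hη3⟩ := (hsd.and (n1.and eventually_pos_nhdsGT)).exists
        refine ⟨_, ⟨⟨hη2, ?_⟩, ⟨hη2, ?_⟩⟩, Q₂.inside_subset_region hη1.1⟩
        · rw [add_assoc, add_sub_cancel_left, cross2_add_right, cross2_smul_right,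
            cross2_smul_right, cross2_neg_right, hβa, hβb]
          linarith [hδ2.1]
        · rw [add_assoc, add_sub_cancel_left, cross2_add_right, cross2_smul_right,
            cross2_smul_right, cross2_neg_right, hαa, hαb]
          linarith
  -- a point behind the window and outside the pocket
  have hmeet : (P₁.inside ∩ N).Nonempty := by
    obtain ⟨δ, hδ1, hδ2, hδ3⟩ := (hw.eventually_mem_openSegment.and
      ((eventually_near r d hε).and eventually_pos_nhdsGT)).exists
    have hdb : cross2 d b ≠ 0 := by
      intro h0
      have hd0 : d ≠ 0 := by
        intro h1
        rw [h1, cross2_zero_right] at hs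
        exact lt_irrefl _ hs
      obtain ⟨σ, hσ⟩ := exists_smul_of_cross2_eq_zero hd0 h0
      have h1 : σ * cross2 β d = 0 := by rw [← cross2_smul_right, ← hσ, hβb]
      have h2 : σ * cross2 α d = 1 := by rw [← cross2_smul_right, ← hσ, hαb]
      rcases mul_eq_zero.1 h1 with h1 | h1
      · rw [h1, zero_mul] at h2
        exact zero_ne_one h2
      · exact hs.ne h1
    have hne : cross2 (e - r) b ≠ 0 := by
      rw [he, add_sub_cancel_left, cross2_smul_left]
      exact mul_ne_zero hc.ne' hdb
    have n1 := eventually_norm_add_smul_sub_lt hδ2 b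
    have n2 := eventually_norm_add_smul_sub_lt hδ2 (-b)
    rcases h.sides _ hδ1 b hne with hsd | hsd
    · obtain ⟨η, hη1, hη2, hη3⟩ := (hsd.and (n1.and eventually_pos_nhdsGT)).exists
      refine ⟨_, hη1.1, ⟨hη2, ?_⟩, ⟨hη2, ?_⟩⟩
      · rw [add_assoc, add_sub_cancel_left, cross2_add_right, cross2_smul_right,
          cross2_smul_right, hβb]
        nlinarith
      · rw [add_assoc, add_sub_cancel_left, cross2_add_right, cross2_smul_right,
          cross2_smul_right, hαb]
        nlinarith [mul_pos hδ3 ht]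
    · obtain ⟨η, hη1, hη2, hη3⟩ := (hsd.and (n2.and eventually_pos_nhdsGT)).exists
      exfalso
      refine Set.disjoint_left.1 h.disj hη1.2 ?_
      rw [sub_eq_add_neg, ← smul_neg]
      refine hH₂ ⟨hη2, ?_⟩
      rw [add_assoc, add_sub_cancel_left, cross2_add_right, cross2_smul_right,
        cross2_smul_right, hγd, hγe, cross2_neg_right, cross2_neg_right, hαb, hβb]
      nlinarith
  refine ⟨C, ?_⟩
  rw [gp, Set.disjoint_left]
  rintro z hz ⟨hz₁, hzD⟩
  have hzr : z ∈ P₁.region \ {r} := ⟨hz₁, fun h0 => hzD (h0 ▸ left_mem_segment ℝ r e)⟩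
  have hpre : IsPreconnected (P₁.region \ {r}) := by
    refine P₁.isPreconnected_inside.subset_closure (fun y hy => ⟨P₁.inside_subset_region hy, ?_⟩) ?_
    · rintro rfl
      exact hy.1 (h.seg_left (left_mem_segment _ _ _))
    · rw [← P₁.region_eq_closure_inside]
      exact sdiff_subset
  obtain ⟨y, hy₁, hyN⟩ := hmeet
  have hsub : P₁.region \ {r} ⊆ Q₂.region := by
    refine g.symm.subset_left hpre (sdiff_subset.trans h.region_left_subset) hdisj
      ⟨y, ⟨P₁.inside_subset_region hy₁, ?_⟩, Q₂.inside_subset_region (hN₂ hyN)⟩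
    rintro rfl
    exact hy₁.1 (h.seg_left (left_mem_segment _ _ _))
  exact g.notMem_left_of_mem_right (hsub hzr) (Set.disjoint_left.1 hdisj hzr) hz

end SimplePolygon

namespace SimplePolygon

variable {P : SimplePolygon}

theorem IsWindow.exists_cut {x e : E2} {i : ZMod P.n} {P₁ P₂ : SimplePolygon}
    (hw : P.IsWindow x i e) (hx : P.IsGeneric x) (h : IsSplit P P₁ P₂ (P.vtx i) e)
    (hx₂ : x ∈ P₂.inside) :
    ∃ C : P.Cut, Disjoint C.pocket (P₁.region \ segment ℝ (P.vtx i) e) := by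
  have hsucc : cross2 (P.vtx (i + 1) - P.vtx i) (x - P.vtx i) ≠ 0 :=
    hx i (i + 1) (by simpa using P.one_ne_zero_zmod)
  have hpred : cross2 (P.vtx (i - 1) - P.vtx i) (x - P.vtx i) ≠ 0 :=
    hx i (i - 1) fun h0 => P.one_ne_zero_zmod (sub_eq_self.1 h0.symm)
  have hforth : ∀ᶠ δ in 𝓝[>] (0 : ℝ), P.vtx i + δ • (P.vtx i - x) ∈ P.inside :=
    hw.eventually_mem_openSegment.mono fun δ hδ => h.chord.openSegment_subset hδ
  have hback : ∀ᶠ δ in 𝓝[>] (0 : ℝ), P.vtx i + δ • -(P.vtx i - x) ∈ P.inside :=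
    (eventually_sub_smul_mem_openSegment x (P.vtx i)).mono fun δ hδ => by
      rw [smul_neg, ← sub_eq_add_neg]
      exact hw.openSegment_subset hδ
  have hab : cross2 (P.vtx (i - 1) - P.vtx i) (P.vtx (i + 1) - P.vtx i) ≠ 0 := by
    intro h0
    obtain ⟨ε, hε, hl⟩ := P.local_flat_vertex h0
    refine false_of_both_sides_mem_region (e := P.vtx i - x) hε hl ?_ ?_
    · rw [← neg_sub x, cross2_neg_right]
      exact neg_ne_zero.2 hsucc
    · filter_upwards [hforth, hback] with δ h1 h2
      refine ⟨P.inside_subset_region h1, P.inside_subset_region ?_⟩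
      rwa [smul_neg, ← sub_eq_add_neg] at h2
  obtain ⟨α, β, hαa, hαb, hβa, hβb, hrep⟩ := exists_dual_basis hab
  obtain ⟨ε, hε, hl⟩ := P.local_vertex i
  have hea : segment ℝ (P.vtx i) (P.vtx (i - 1)) ⊆ P.boundary := by
    intro z hz
    rw [segment_symm] at hz
    refine P.mem_boundary.2 ⟨i - 1, ?_⟩
    rw [edge, sub_add_cancel]
    exact hz
  have heb : segment ℝ (P.vtx i) (P.vtx (i + 1)) ⊆ P.boundary := fun z hz =>
    P.mem_boundary.2 ⟨i, hz⟩
  set r := P.vtx i with hr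
  set a := P.vtx (i - 1) - r with ha
  set b := P.vtx (i + 1) - r with hb
  set d := r - x with hd
  have hbd : ∀ p, ‖p - r‖ < ε → p ∈ P.boundary →
      0 ≤ cross2 β (p - r) ∧ 0 ≤ cross2 α (p - r) ∧
        (cross2 β (p - r) = 0 ∨ cross2 α (p - r) = 0) := by
    intro p hp hpb
    rcases (hl p hp).1 hpb with ⟨s, hs, h1⟩ | ⟨s, hs, h1⟩
    · rw [h1, cross2_smul_right, cross2_smul_right, hαa, hβa]
      simpa using hs
    · rw [h1, cross2_smul_right, cross2_smul_right, hαb, hβb]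
      simpa using hs
  have hαd : cross2 α d ≠ 0 := by
    intro h0
    have h1 := hrep d
    rw [h0, zero_smul, add_zero] at h1
    apply hpred
    rw [← neg_sub r x, cross2_neg_right, ← hd, h1, cross2_smul_right, cross2_self, mul_zero,
      neg_zero]
  have hβd : cross2 β d ≠ 0 := by
    intro h0
    have h1 := hrep d
    rw [h0, zero_smul, zero_add] at h1
    apply hsucc
    rw [← neg_sub r x, cross2_neg_right, ← hd, h1, cross2_smul_right, cross2_self, mul_zero,
      neg_zero]
  have hhalf : ∀ ξ : E2, (∀ p, ‖p - r‖ < ε → p ∈ P.boundary → 0 ≤ cross2 ξ (p - r)) →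
      cross2 ξ d ≠ 0 → ∀ p, ‖p - r‖ < ε → cross2 ξ (p - r) < 0 → p ∈ P.inside := by
    intro ξ hξ hξd p hp hp'
    refine subset_inside_of_isPreconnected (convex_ball_inter_cross2_neg r ε ξ).isPreconnected
      (Set.disjoint_left.2 fun q hq hqb => (hξ q hq.1 hqb).not_gt hq.2) ?_ ⟨hp, hp'⟩
    rcases hξd.lt_or_gt with h0 | h0
    · obtain ⟨δ, h1, h2, h3⟩ := (hforth.and ((eventually_near r d hε).and
        eventually_pos_nhdsGT)).exists
      refine ⟨_, ⟨h2, ?_⟩, h1⟩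
      rw [add_sub_cancel_left, cross2_smul_right]
      exact mul_neg_of_pos_of_neg h3 h0
    · obtain ⟨δ, h1, h2, h3⟩ := (hback.and ((eventually_near r (-d) hε).and
        eventually_pos_nhdsGT)).exists
      refine ⟨_, ⟨h2, ?_⟩, h1⟩
      rw [add_sub_cancel_left, cross2_smul_right, cross2_neg_right]
      exact mul_neg_of_pos_of_neg h3 (neg_neg_of_pos h0)
  have hS := hhalf β (fun p hp hpb => (hbd p hp hpb).1) hβd
  have hT := hhalf α (fun p hp hpb => (hbd p hp hpb).2.1) hαd
  have hout : {p | ‖p - r‖ < ε ∧ 0 < cross2 β (p - r)} ∩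
      {p | ‖p - r‖ < ε ∧ 0 < cross2 α (p - r)} ⊆ P.regionᶜ := by
    refine disjoint_region_of_isPreconnected ((convex_ball_inter_cross2_pos r ε β).inter
      (convex_ball_inter_cross2_pos r ε α)).isPreconnected ?_ ?_
    · rw [Set.disjoint_left]
      rintro p ⟨h1, h2⟩ hpb
      rcases (hbd p h1.1 hpb).2.2 with h0 | h0
      · exact h1.2.ne' h0
      · exact h2.2.ne' h0
    · obtain ⟨p, hp, hpr⟩ := mem_closure_iff.1
        (P.boundary_subset_closure_compl_region (P.vtx_mem_boundary i)) (ball r ε) isOpen_ball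
        (mem_ball_self hε)
      rw [mem_ball_iff_norm] at hp
      have hpb : p ∉ P.boundary := fun h0 => hpr (P.boundary_subset_region h0)
      have hps : 0 ≤ cross2 β (p - r) :=
        not_lt.1 fun h0 => hpr (P.inside_subset_region (hS p hp h0))
      have hpt : 0 ≤ cross2 α (p - r) :=
        not_lt.1 fun h0 => hpr (P.inside_subset_region (hT p hp h0))
      have h1 := hrep (p - r)
      refine ⟨p, ⟨⟨hp, hps.lt_of_ne fun h0 => hpb ((hl p hp).2 (.inr ⟨_, hpt, ?_⟩))⟩,
        ⟨hp, hpt.lt_of_ne fun h0 => hpb ((hl p hp).2 (.inl ⟨_, hps, ?_⟩))⟩⟩, hpr⟩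
      · rwa [← h0, zero_smul, zero_add] at h1
      · rwa [← h0, zero_smul, add_zero] at h1
  have hrefl : P.IsReflex i := by
    obtain ⟨ε₀, hε₀, hsub⟩ := mem_nhdsGT_iff_exists_Ioo_subset.1
      (eventually_near r ((1 / 2 : ℝ) • (a + b)) hε)
    refine ⟨ε₀, hε₀, fun δ hδ => hout ?_⟩
    have hmid : midpoint ℝ (r + δ • a) (r + δ • b) = r + δ • (1 / 2 : ℝ) • (a + b) := by
      rw [midpoint_eq_smul_add, invOf_eq_inv]
      module
    have h1 : ‖r + δ • (1 / 2 : ℝ) • (a + b) - r‖ < ε := hsub hδ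
    rw [← hr, ← ha, ← hb, hmid]
    refine ⟨⟨h1, ?_⟩, ⟨h1, ?_⟩⟩
    · simp only [add_sub_cancel_left, cross2_smul_right, cross2_add_right, hβa, hβb]
      linarith [hδ.1]
    · simp only [add_sub_cancel_left, cross2_smul_right, cross2_add_right, hαa, hαb]
      linarith [hδ.1]
  have hnot : ∀ y : E2, (∀ᶠ δ in 𝓝[>] (0 : ℝ), r + δ • y ∈ P.inside) → 0 < cross2 β y →
      0 < cross2 α y → False := by
    intro y hy h1 h2
    obtain ⟨δ, k1, k2, k3⟩ := (hy.and ((eventually_near r y hε).and eventually_pos_nhdsGT)).exists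
    refine hout ⟨⟨k2, ?_⟩, ⟨k2, ?_⟩⟩ (P.inside_subset_region k1)
    · rw [add_sub_cancel_left, cross2_smul_right]; exact mul_pos k3 h1
    · rw [add_sub_cancel_left, cross2_smul_right]; exact mul_pos k3 h2
  rcases hβd.lt_or_gt with h1 | h1 <;> rcases hαd.lt_or_gt with h2 | h2
  · exact (hnot (-d) hback (by rw [cross2_neg_right]; linarith)
      (by rw [cross2_neg_right]; linarith)).elim
  · exact hw.exists_cut_of_corner h hx₂ (.inr rfl) ha hea hrefl hαa hαb hβa hβb hε hS hT h1 h2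
  · exact hw.exists_cut_of_corner h hx₂ (.inl rfl) hb heb hrefl hβb hβa hαb hαa hε hT hS h2 h1
  · exact (hnot d hforth h1 h2).elim

/-- A connected set that meets every nonredundant cut sees the whole region. -/
theorem exists_visible {S : Set E2} (hS : IsConnected S) (hSr : S ⊆ P.region)
    (hC : ∀ C : P.Cut, C.Nonredundant → (S ∩ C.seg).Nonempty) {x : E2} (hx : x ∈ P.region) :
    ∃ p ∈ S, P.Visible x p := by
  by_contra hv
  push Not at hv
  have hpocket : ∀ C : P.Cut, ∃ p ∈ S, p ∈ C.pocket := by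
    intro C
    obtain ⟨C', hC', hsub⟩ := C.exists_nonredundant_subset
    obtain ⟨p, hp, hp'⟩ := hC C' hC'
    exact ⟨p, hp, hsub (C'.seg_subset_pocket hp')⟩
  choose p hpS hpC using hpocket
  obtain ⟨p₀, hp₀⟩ := hS.nonempty
  obtain ⟨K, hK, hKp, hKr, hKv, hp₀K, hpK⟩ := P.exists_isCompact_isPreconnected
    hS.isPreconnected hSr hv (P.isClosed_visible_left x).isOpen_compl hp₀ hpS
  obtain ⟨x', hx', hgen, hKv'⟩ := P.exists_isGeneric_not_visible hx hK hKv
  obtain ⟨i, e, P₁, P₂, hw, hs, hx₂, hsub⟩ :=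
    hgen.exists_isWindow hx' hKp ⟨p₀, hp₀K⟩ hKr hKv'
  obtain ⟨C, hC⟩ := hw.exists_cut hgen hs hx₂
  exact Set.disjoint_left.1 hC (hpC C) (hsub (hpK C))

theorem core_subset_region : P.core ⊆ P.region :=
  closure_minimal sdiff_subset P.isClosed_region

end SimplePolygon

/-- Let `Q = P.core` be the subpolygon of `P` obtained by cutting `P`
along all nonredundant cuts.  If `Q` is nonempty then `Q` is a simple polygon, and
every vertex of `Q` is visible from any connected curve inside `P` that intersects
every nonredundant cut of `P`. -/
theorem core_is_polygon_and_vertices_visible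
    (P : SimplePolygon) (hne : P.core.Nonempty) :
    (∃ R : SimplePolygon, R.region = P.core) ∧
    ∀ Pth : Set E2, IsConnected Pth → Pth ⊆ P.region →
      (∀ C : P.Cut, C.Nonredundant → (Pth ∩ C.seg).Nonempty) →
      ∀ R : SimplePolygon, R.region = P.core →
        ∀ k : ZMod R.n, ∃ p ∈ Pth, P.Visible (R.vtx k) p := by
  refine ⟨P.exists_region_eq_core hne, fun Pth hPth hsub hC R hR k => ?_⟩
  refine SimplePolygon.exists_visible hPth hsub hC (SimplePolygon.core_subset_region ?_)
  rw [← hR]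
  exact R.boundary_subset_region (R.vtx_mem_boundary k)
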